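/- Let k ≥ 1 and A ≥ 2 be integers with A > binom(2k,k)/(2k), and let f:ℝ→ℝ be supported on (−∞,1] with f ∈ C^A(ℝ) and f, f′, …, f^{(A)} all uniformly bounded. Then there is a constant C(k,f) > 0 such that for all x ≥ R ≥ 2 and every real T ≥ 1, Σ_{n ≤ x, Ω(n;R) ≥ T} M_f(n;R)^{2k} ≤ C(k,f)·x/(T·log R). -/

import Mathlib

open scoped Classical

/-- `M_f(n;R) := Σ_{d | n} μ(d) f(log d / log R)`. -/
noncomputable def Mf (f : ℝ → ℝ) (n : ℕ) (R : ℝ) : ℝ :=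
  ∑ d ∈ n.divisors,
    ((ArithmeticFunction.moebius d : ℤ) : ℝ) * f (Real.log d / Real.log R)

/-- `Ω(n;R)`: the number of prime factors of `n` that are `≤ R`, counted with
multiplicity. -/
noncomputable def bigOmega (n : ℕ) (R : ℝ) : ℕ :=
  ∑ p ∈ n.primeFactors.filter (fun p : ℕ => (p : ℝ) ≤ R), n.factorization p

lemma norm_succ_cpow_sub_le {s : ℂ} (hs : 1 < s.re) {n : ℕ} (hn : 1 ≤ n) :
    ‖((n + 1 : ℕ) : ℂ) ^ (-s) + ((n + 1 : ℕ) : ℂ) ^ (1 - s) / (s - 1)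
      - (n : ℂ) ^ (1 - s) / (s - 1)‖ ≤ ‖s‖ / (n : ℝ) ^ 2 := by
  have hs1 : s - 1 ≠ 0 := by
    intro h
    have := congrArg Complex.re h
    simp at this
    linarith
  have hn0 : (0 : ℝ) < n := by exact_mod_cast hn
  set c : ℂ := ((n + 1 : ℕ) : ℂ) ^ (-s) with hc
  have hder : ∀ u : ℝ, 0 < u → HasDerivAt (fun u : ℝ => (u : ℂ) ^ (-s)) (-s * (u : ℂ) ^ (-s - 1)) u := by
    intro u hu
    have := (hasDerivAt_id (u : ℂ)).cpow_const (c := -s) (Or.inl hu)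
    simpa using this.comp_ofReal
  have hder2 : ∀ u : ℝ, 0 < u → HasDerivAt (fun u : ℝ => (u : ℂ) ^ (1 - s)) ((1 - s) * (u : ℂ) ^ (-s)) u := by
    intro u hu
    have := (hasDerivAt_id (u : ℂ)).cpow_const (c := 1 - s) (Or.inl hu)
    have h2 := this.comp_ofReal
    simpa using h2
  have hnorm : ∀ u ∈ Set.Icc (n : ℝ) (n + 1), ‖-s * (u : ℂ) ^ (-s - 1)‖ ≤ ‖s‖ / (n : ℝ) ^ 2 := by
    intro u hu
    have hu0 : 0 < u := lt_of_lt_of_le hn0 hu.1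
    rw [norm_mul, norm_neg, Complex.norm_cpow_eq_rpow_re_of_pos hu0, div_eq_mul_inv]
    gcongr
    have h1 : (-s - 1).re = -(s.re + 1) := by simp; ring
    rw [h1, Real.rpow_neg hu0.le]
    gcongr
    calc (n : ℝ) ^ 2 ≤ u ^ 2 := by gcongr; exact hu.1
      _ = u ^ (2 : ℝ) := by norm_cast
      _ ≤ u ^ (s.re + 1) := by
        apply Real.rpow_le_rpow_of_exponent_le
        · have : (1 : ℝ) ≤ n := by exact_mod_cast hn
          linarith [hu.1]
        · linarith
  have hdiff : ∀ u ∈ Set.Icc (n : ℝ) (n + 1), ‖(u : ℂ) ^ (-s) - c‖ ≤ ‖s‖ / (n : ℝ) ^ 2 := by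
    intro u hu
    have h := (convex_Icc (n : ℝ) (n + 1)).norm_image_sub_le_of_norm_hasDerivWithin_le
      (f := fun u : ℝ => (u : ℂ) ^ (-s)) (C := ‖s‖ / (n : ℝ) ^ 2)
      (fun x hx => (hder x (lt_of_lt_of_le hn0 hx.1)).hasDerivWithinAt) hnorm
      (x := (n : ℝ) + 1) (y := u) ⟨by linarith, le_refl _⟩ hu
    have e : ((((n : ℝ) + 1 : ℝ)) : ℂ) ^ (-s) = c := by rw [hc]; push_cast; rfl
    simp only [e] at h
    refine h.trans ?_
    have h3 : ‖u - ((n : ℝ) + 1)‖ ≤ 1 := by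
      rw [Real.norm_eq_abs, abs_le]; constructor <;> linarith [hu.1, hu.2]
    calc _ ≤ ‖s‖ / (n : ℝ) ^ 2 * 1 := by gcongr
      _ = _ := mul_one _
  have hfin := (convex_Icc (n : ℝ) (n + 1)).norm_image_sub_le_of_norm_hasDerivWithin_le
      (f := fun u : ℝ => (u : ℂ) ^ (1 - s) / (1 - s) - u * c) (C := ‖s‖ / (n : ℝ) ^ 2)
      (f' := fun u => (u : ℂ) ^ (-s) - c)
      (fun x hx => by
        have h1 := (hder2 x (lt_of_lt_of_le hn0 hx.1)).div_const (1 - s)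
        have h2 : (1 - s) * (x : ℂ) ^ (-s) / (1 - s) = (x : ℂ) ^ (-s) := by
          have : 1 - s ≠ 0 := by intro h; apply hs1; linear_combination -h
          field_simp
        rw [h2] at h1
        have h3 : HasDerivAt (fun u : ℝ => (u : ℂ) * c) c x := by
          have := (hasDerivAt_id (x : ℂ)).comp_ofReal.mul_const c
          simpa using this
        exact (h1.sub h3).hasDerivWithinAt) hdiff
      (x := (n : ℝ)) (y := (n : ℝ) + 1) ⟨by linarith, by linarith⟩ ⟨by linarith, by linarith⟩
  have h4 : ‖(n : ℝ) + 1 - n‖ = 1 := by simp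
  rw [h4, mul_one] at hfin
  rw [← norm_neg]
  refine le_trans (le_of_eq (congrArg norm ?_)) hfin
  rw [show s - 1 = -(1 - s) by ring, div_neg, div_neg]
  push_cast
  ring

lemma norm_riemannZeta_sub_partial_le {s : ℂ} (hs : 1 < s.re) {N : ℕ} (hN : 1 ≤ N) :
    ‖riemannZeta s - (∑ n ∈ Finset.Icc 1 N, (n : ℂ) ^ (-s) + (N : ℂ) ^ (1 - s) / (s - 1))‖
      ≤ 2 * ‖s‖ / N := by
  set e : ℕ → ℂ := fun M => ∑ n ∈ Finset.Icc 1 M, (n : ℂ) ^ (-s) + (M : ℂ) ^ (1 - s) / (s - 1)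
    with he
  have hstep : ∀ M, 1 ≤ M → ‖e (M + 1) - e M‖ ≤ ‖s‖ / (M : ℝ) ^ 2 := by
    intro M hM
    have := norm_succ_cpow_sub_le hs hM
    convert this using 2
    simp only [he]
    rw [Finset.sum_Icc_succ_top (by omega)]
    ring
  have hbd : ∀ M, N ≤ M → ‖e M - e N‖ ≤ ‖s‖ * (2 / N - 2 / M) := by
    intro M hM
    induction M, hM using Nat.le_induction with
    | base => simp
    | succ M hM ih =>
      have hM0 : (1 : ℝ) ≤ M := by exact_mod_cast hN.trans hM
      calc ‖e (M + 1) - e N‖ = ‖(e (M + 1) - e M) + (e M - e N)‖ := by ring_nf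
        _ ≤ ‖s‖ / (M : ℝ) ^ 2 + ‖s‖ * (2 / N - 2 / M) :=
          (norm_add_le _ _).trans (add_le_add (hstep M (hN.trans hM)) ih)
        _ ≤ _ := by
          have h : (1 : ℝ) / M ^ 2 ≤ 2 / M - 2 / (M + 1) := by
            rw [div_sub_div _ _ (by positivity) (by positivity),
              div_le_div_iff₀ (by positivity) (by positivity)]
            nlinarith
          have h2 := mul_le_mul_of_nonneg_left h (norm_nonneg s)
          push_cast
          have e1 : ‖s‖ / (M : ℝ) ^ 2 = ‖s‖ * (1 / (M : ℝ) ^ 2) := by ring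
          rw [e1]
          nlinarith
  have hlim1 : Filter.Tendsto (fun M : ℕ => ∑ n ∈ Finset.Icc 1 M, (n : ℂ) ^ (-s)) Filter.atTop
      (nhds (riemannZeta s)) := by
    have hsum : HasSum (fun n : ℕ => 1 / (n : ℂ) ^ s) (riemannZeta s) := by
      rw [zeta_eq_tsum_one_div_nat_cpow hs]
      exact (Complex.summable_one_div_nat_cpow.mpr hs).hasSum
    have := (hsum.tendsto_sum_nat).comp (Filter.tendsto_add_atTop_nat 1)
    refine this.congr ?_
    intro M
    simp only [Function.comp]
    rw [Finset.range_eq_Ico, ← Finset.sum_Ioo_add_eq_sum_Ico (by omega)]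
    have h0 : (1 : ℂ) / ((0 : ℕ) : ℂ) ^ s = 0 := by
      rw [Nat.cast_zero, Complex.zero_cpow, div_zero]
      intro h
      rw [h] at hs
      simp at hs
      linarith
    rw [h0, add_zero]
    apply Finset.sum_congr
    · ext; simp; omega
    · intro n _
      rw [Complex.cpow_neg, one_div]
  have hlim2 : Filter.Tendsto (fun M : ℕ => (M : ℂ) ^ (1 - s) / (s - 1)) Filter.atTop (nhds 0) := by
    rw [← zero_div (s - 1)]
    apply Filter.Tendsto.div_const
    rw [tendsto_zero_iff_norm_tendsto_zero]
    have h1 : Filter.Tendsto (fun M : ℕ => ((M : ℝ)) ^ (-(s.re - 1))) Filter.atTop (nhds 0) :=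
      (tendsto_rpow_neg_atTop (by linarith)).comp tendsto_natCast_atTop_atTop
    refine h1.congr' ?_
    filter_upwards [Filter.eventually_gt_atTop 0] with M hM
    rw [Complex.norm_natCast_cpow_of_pos hM]
    simp
  have hlim : Filter.Tendsto e Filter.atTop (nhds (riemannZeta s)) := by
    simpa using hlim1.add hlim2
  refine le_of_tendsto ((hlim.sub_const (e N)).norm) ?_
  filter_upwards [Filter.eventually_ge_atTop N] with M hM
  refine (hbd M hM).trans ?_
  have : (0 : ℝ) ≤ 2 / M := by positivity
  have e1 : 2 * ‖s‖ / N = ‖s‖ * (2 / N) := by ring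
  rw [e1]
  nlinarith [norm_nonneg s]

lemma abs_rpow_neg_sub_le {n a x y : ℝ} (hn : 1 ≤ n) (hx : a ≤ x) (hy : a ≤ y) :
    |n ^ (-x) - n ^ (-y)| ≤ n ^ (-a) * Real.log n * |x - y| := by
  wlog h : x ≤ y generalizing x y
  · rw [abs_sub_comm, abs_sub_comm x y]
    exact this hy hx (le_of_not_ge h)
  have hn0 : 0 < n := by linarith
  have hlog := Real.log_nonneg hn
  have e : n ^ (-y) = n ^ (-x) * Real.exp (-(Real.log n * (y - x))) := by
    rw [Real.rpow_def_of_pos hn0, Real.rpow_def_of_pos hn0, ← Real.exp_add]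
    ring_nf
  have h1 := Real.add_one_le_exp (-(Real.log n * (y - x)))
  have h2 : Real.exp (-(Real.log n * (y - x))) ≤ 1 :=
    Real.exp_le_one_iff.mpr (by nlinarith)
  have h3 : n ^ (-x) ≤ n ^ (-a) := Real.rpow_le_rpow_of_exponent_le hn (by linarith)
  have h4 : 0 ≤ n ^ (-x) := Real.rpow_nonneg hn0.le _
  rw [e, abs_sub_comm x y, abs_of_nonneg (a := y - x) (by linarith), abs_of_nonneg (by nlinarith)]
  have h5 : 0 ≤ Real.log n * (y - x) := mul_nonneg hlog (by linarith)
  nlinarith [mul_le_mul_of_nonneg_right h3 h5]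

lemma one_le_log_add_three {τ : ℝ} (hτ : 0 ≤ τ) : 1 ≤ Real.log (τ + 3) := by
  rw [Real.le_log_iff_exp_le (by linarith)]
  linarith [Real.exp_one_lt_d9]

lemma sum_Icc_inv_le (N : ℕ) : ∑ n ∈ Finset.Icc 1 N, (n : ℝ)⁻¹ ≤ 1 + Real.log N := by
  have := harmonic_le_one_add_log N
  rw [harmonic_eq_sum_Icc] at this
  push_cast at this
  exact this

lemma norm_sub_one_ge (σ τ : ℝ) : |τ| ≤ ‖((σ : ℂ) + τ * Complex.I) - 1‖ := by
  have := Complex.abs_im_le_norm (((σ : ℂ) + τ * Complex.I) - 1)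
  simpa using this

lemma norm_add_mul_I_le {σ τ : ℝ} (h0 : 0 ≤ σ) : ‖(σ : ℂ) + τ * Complex.I‖ ≤ σ + |τ| := by
  refine (norm_add_le _ _).trans ?_
  rw [norm_mul, Complex.norm_I, mul_one, Complex.norm_real, Complex.norm_real, Real.norm_eq_abs,
    Real.norm_eq_abs, abs_of_nonneg h0]

lemma norm_riemannZeta_le {σ τ : ℝ} (hσ : 1 < σ) (hσ3 : σ ≤ 3) (hτ : 1 ≤ |τ|) :
    ‖riemannZeta (σ + τ * Complex.I)‖ ≤ 11 * Real.log (|τ| + 3) := by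
  set s : ℂ := σ + τ * Complex.I with hs
  have hre : s.re = σ := by simp [hs]
  set N := ⌈|τ|⌉₊ with hN
  have hN1 : 1 ≤ N := Nat.one_le_ceil_iff.mpr (by linarith)
  have hNτ : |τ| ≤ N := Nat.le_ceil _
  have hNτ' : (N : ℝ) < |τ| + 1 := Nat.ceil_lt_add_one (by linarith)
  have hN0 : (0 : ℝ) < N := by exact_mod_cast hN1
  have h := norm_riemannZeta_sub_partial_le (s := s) (by rw [hre]; exact hσ) hN1
  have h1 : ‖∑ n ∈ Finset.Icc 1 N, (n : ℂ) ^ (-s)‖ ≤ 1 + Real.log N := by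
    refine (norm_sum_le _ _).trans ((Finset.sum_le_sum ?_).trans (sum_Icc_inv_le N))
    intro n hn
    have hn1 : 1 ≤ n := (Finset.mem_Icc.mp hn).1
    rw [Complex.norm_natCast_cpow_of_pos hn1, ← Real.rpow_neg_one]
    apply Real.rpow_le_rpow_of_exponent_le (by exact_mod_cast hn1)
    simp [hre]; linarith
  have h2 : ‖(N : ℂ) ^ (1 - s) / (s - 1)‖ ≤ 1 := by
    rw [norm_div, Complex.norm_natCast_cpow_of_pos hN1]
    have : (N : ℝ) ^ (1 - s).re ≤ 1 :=
      Real.rpow_le_one_of_one_le_of_nonpos (by exact_mod_cast hN1) (by simp [hre]; linarith)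
    have h3 : 1 ≤ ‖s - 1‖ := hτ.trans (norm_sub_one_ge σ τ)
    rw [div_le_one (by linarith)]
    linarith
  have h3 : 2 * ‖s‖ / N ≤ 8 := by
    rw [div_le_iff₀ hN0]
    have := norm_add_mul_I_le (σ := σ) (τ := τ) (by linarith)
    rw [← hs] at this
    nlinarith
  have h4 : Real.log N ≤ Real.log (|τ| + 3) := Real.log_le_log hN0 (by linarith)
  have h5 := one_le_log_add_three (abs_nonneg τ)
  calc ‖riemannZeta s‖ = ‖(riemannZeta s - (∑ n ∈ Finset.Icc 1 N, (n : ℂ) ^ (-s)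
        + (N : ℂ) ^ (1 - s) / (s - 1))) + (∑ n ∈ Finset.Icc 1 N, (n : ℂ) ^ (-s)
        + (N : ℂ) ^ (1 - s) / (s - 1))‖ := by congr 1; ring
    _ ≤ 8 + ((1 + Real.log N) + 1) :=
      (norm_add_le _ _).trans (add_le_add (h.trans h3) ((norm_add_le _ _).trans (add_le_add h1 h2)))
    _ ≤ _ := by linarith

lemma norm_natCast_cpow_sub_le {n : ℕ} (hn : 1 ≤ n) {a b τ m : ℝ} (ha : m ≤ a) (hb : m ≤ b) :
    ‖(n : ℂ) ^ (-((a : ℂ) + τ * Complex.I)) - (n : ℂ) ^ (-((b : ℂ) + τ * Complex.I))‖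
      ≤ (n : ℝ) ^ (-m) * Real.log n * |a - b| := by
  have hn0 : (n : ℂ) ≠ 0 := by exact_mod_cast (by omega : n ≠ 0)
  have e : ∀ c : ℝ, (n : ℂ) ^ (-((c : ℂ) + τ * Complex.I))
      = (((n : ℝ) ^ (-c) : ℝ) : ℂ) * (n : ℂ) ^ (-(τ * Complex.I)) := by
    intro c
    rw [neg_add, Complex.cpow_add _ _ hn0, Complex.ofReal_cpow (by positivity)]
    push_cast
    rfl
  rw [e, e, ← sub_mul, norm_mul, Complex.norm_natCast_cpow_of_pos hn]
  have : (-(τ * Complex.I)).re = 0 := by simp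
  rw [this, Real.rpow_zero, mul_one, ← Complex.ofReal_sub, Complex.norm_real, Real.norm_eq_abs]
  exact abs_rpow_neg_sub_le (by exact_mod_cast hn) ha hb

lemma norm_riemannZeta_sub_le {a b τ : ℝ} (ha : 1 < a) (ha3 : a ≤ 3) (hb : 1 < b) (hb3 : b ≤ 3)
    (hτ : 1 ≤ |τ|) :
    ‖riemannZeta (a + τ * Complex.I) - riemannZeta (b + τ * Complex.I)‖
      ≤ 16 / |τ| ^ 2 + 36 * Real.log (|τ| + 3) ^ 2 * |a - b| := by
  set s : ℂ := a + τ * Complex.I with hs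
  set s' : ℂ := b + τ * Complex.I with hs'
  have hre : s.re = a := by simp [hs]
  have hre' : s'.re = b := by simp [hs']
  set Λ := Real.log (|τ| + 3) with hΛ
  have hΛ1 : 1 ≤ Λ := one_le_log_add_three (abs_nonneg τ)
  set N := ⌈|τ| ^ 3⌉₊ with hN
  have hτ3 : 1 ≤ |τ| ^ 3 := one_le_pow₀ hτ
  have hN1 : 1 ≤ N := Nat.one_le_ceil_iff.mpr (by linarith)
  have hNτ : |τ| ^ 3 ≤ N := Nat.le_ceil _
  have hNτ' : (N : ℝ) < |τ| ^ 3 + 1 := Nat.ceil_lt_add_one (by linarith)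
  have hN0 : (0 : ℝ) < N := by exact_mod_cast hN1
  have hlogN : Real.log N ≤ 3 * Λ := by
    calc Real.log N ≤ Real.log ((|τ| + 3) ^ 3) := Real.log_le_log hN0 (by nlinarith)
      _ = 3 * Λ := by rw [Real.log_pow, hΛ]; norm_num
  have hlogN0 : 0 ≤ Real.log N := Real.log_nonneg (by exact_mod_cast hN1)
  have h := norm_riemannZeta_sub_partial_le (s := s) (by rw [hre]; exact ha) hN1
  have h' := norm_riemannZeta_sub_partial_le (s := s') (by rw [hre']; exact hb) hN1
  have hsn : ∀ {c : ℝ}, 1 < c → c ≤ 3 → 2 * ‖(c : ℂ) + τ * Complex.I‖ / N ≤ 8 / |τ| ^ 2 := by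
    intro c hc hc3
    have := norm_add_mul_I_le (σ := c) (τ := τ) (by linarith)
    have h1 : 2 * ‖(c : ℂ) + τ * Complex.I‖ ≤ 8 * |τ| := by linarith
    rw [div_le_div_iff₀ hN0 (by positivity)]
    calc _ ≤ 8 * |τ| * |τ| ^ 2 := by gcongr
      _ = 8 * |τ| ^ 3 := by ring
      _ ≤ 8 * N := by linarith
  have h1 : ‖∑ n ∈ Finset.Icc 1 N, (n : ℂ) ^ (-s) - ∑ n ∈ Finset.Icc 1 N, (n : ℂ) ^ (-s')‖
      ≤ (1 + 3 * Λ) * (3 * Λ * |a - b|) := by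
    rw [← Finset.sum_sub_distrib]
    calc _ ≤ ∑ n ∈ Finset.Icc 1 N, (n : ℝ)⁻¹ * (3 * Λ * |a - b|) := by
          refine (norm_sum_le _ _).trans (Finset.sum_le_sum ?_)
          intro n hn
          have hn1 := (Finset.mem_Icc.mp hn).1
          have hnN := (Finset.mem_Icc.mp hn).2
          have hn0 : (0 : ℝ) < n := by exact_mod_cast hn1
          refine (norm_natCast_cpow_sub_le hn1 ha.le hb.le).trans ?_
          rw [Real.rpow_neg_one, mul_assoc]
          have : Real.log n ≤ 3 * Λ :=
            (Real.log_le_log hn0 (by exact_mod_cast hnN)).trans hlogN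
          gcongr
      _ = (∑ n ∈ Finset.Icc 1 N, (n : ℝ)⁻¹) * (3 * Λ * |a - b|) := by rw [Finset.sum_mul]
      _ ≤ _ := by
        gcongr
        exact (sum_Icc_inv_le N).trans (by linarith)
  have hs1 : |τ| ≤ ‖s - 1‖ := norm_sub_one_ge a τ
  have hs1' : |τ| ≤ ‖s' - 1‖ := norm_sub_one_ge b τ
  have hsne : s - 1 ≠ 0 := norm_pos_iff.mp (by linarith)
  have hsne' : s' - 1 ≠ 0 := norm_pos_iff.mp (by linarith)
  have h2 : ‖(N : ℂ) ^ (1 - s) / (s - 1) - (N : ℂ) ^ (1 - s') / (s' - 1)‖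
      ≤ 3 * Λ * |a - b| + |a - b| := by
    have e : (N : ℂ) ^ (1 - s) / (s - 1) - (N : ℂ) ^ (1 - s') / (s' - 1)
        = ((N : ℂ) ^ (1 - s) - (N : ℂ) ^ (1 - s')) / (s - 1)
          + (N : ℂ) ^ (1 - s') * (s' - s) / ((s - 1) * (s' - 1)) := by
      field_simp
      ring
    rw [e]
    refine (norm_add_le _ _).trans (add_le_add ?_ ?_)
    · rw [norm_div]
      have h3 := norm_natCast_cpow_sub_le (a := a - 1) (b := b - 1) (τ := τ) (m := 0) hN1
        (by linarith) (by linarith)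
      have e1 : (1 : ℂ) - s = -(((a - 1 : ℝ) : ℂ) + τ * Complex.I) := by
        rw [hs]; push_cast; ring
      have e2 : (1 : ℂ) - s' = -(((b - 1 : ℝ) : ℂ) + τ * Complex.I) := by
        rw [hs']; push_cast; ring
      rw [← e1, ← e2, neg_zero, Real.rpow_zero, one_mul, sub_sub_sub_cancel_right] at h3
      refine (div_le_self (norm_nonneg _) (hτ.trans hs1)).trans (h3.trans ?_)
      gcongr
    · rw [norm_div, norm_mul, norm_mul, Complex.norm_natCast_cpow_of_pos hN1]
      have h4 : (N : ℝ) ^ (1 - s').re ≤ 1 :=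
        Real.rpow_le_one_of_one_le_of_nonpos (by exact_mod_cast hN1) (by simp [hre']; linarith)
      have h5 : ‖s' - s‖ = |a - b| := by
        have : s' - s = ((b - a : ℝ) : ℂ) := by rw [hs, hs']; push_cast; ring
        rw [this, Complex.norm_real, Real.norm_eq_abs, abs_sub_comm]
      rw [h5]
      have h6 : 1 ≤ ‖s - 1‖ * ‖s' - 1‖ := one_le_mul_of_one_le_of_one_le (hτ.trans hs1) (hτ.trans hs1')
      refine (div_le_self (by positivity) h6).trans ?_
      calc _ ≤ 1 * |a - b| := by gcongr
        _ = _ := one_mul _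
  have key : riemannZeta s - riemannZeta s' =
      (riemannZeta s - (∑ n ∈ Finset.Icc 1 N, (n : ℂ) ^ (-s) + (N : ℂ) ^ (1 - s) / (s - 1)))
      - (riemannZeta s' - (∑ n ∈ Finset.Icc 1 N, (n : ℂ) ^ (-s') + (N : ℂ) ^ (1 - s') / (s' - 1)))
      + ((∑ n ∈ Finset.Icc 1 N, (n : ℂ) ^ (-s) - ∑ n ∈ Finset.Icc 1 N, (n : ℂ) ^ (-s'))
      + ((N : ℂ) ^ (1 - s) / (s - 1) - (N : ℂ) ^ (1 - s') / (s' - 1))) := by ring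
  rw [key]
  refine (norm_add_le _ _).trans ?_
  refine (add_le_add ((norm_sub_le _ _).trans (add_le_add (h.trans (hsn ha ha3))
    (h'.trans (hsn hb hb3)))) ((norm_add_le _ _).trans (add_le_add h1 h2))).trans ?_
  have h7 : (1 + 3 * Λ) * (3 * Λ * |a - b|) + (3 * Λ * |a - b| + |a - b|) ≤ 36 * Λ ^ 2 * |a - b| := by
    have : (1 + 3 * Λ) * (3 * Λ) + 3 * Λ + 1 ≤ 36 * Λ ^ 2 := by nlinarith
    nlinarith [mul_le_mul_of_nonneg_right this (abs_nonneg (a - b))]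
  have h8 : 8 / |τ| ^ 2 + 8 / |τ| ^ 2 = 16 / |τ| ^ 2 := by ring
  linarith

lemma exists_bounds_sub_one_mul_riemannZeta (t₀ : ℝ) : ∃ c C : ℝ, 0 < c ∧ 0 < C ∧
    ∀ σ τ : ℝ, 1 < σ → σ ≤ 3 → |τ| ≤ t₀ →
      c ≤ ‖((σ : ℂ) + τ * Complex.I - 1) * riemannZeta (σ + τ * Complex.I)‖ ∧
      ‖((σ : ℂ) + τ * Complex.I - 1) * riemannZeta (σ + τ * Complex.I)‖ ≤ C := by
  by_cases ht : 0 ≤ t₀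
  swap
  · exact ⟨1, 1, one_pos, one_pos, fun σ τ _ _ h => absurd ((abs_nonneg τ).trans h) ht⟩
  set g : ℂ → ℂ := Function.update (fun s => (s - 1) * riemannZeta s) 1 1 with hg
  have hcont : Continuous g := by
    rw [continuous_iff_continuousAt]
    intro s
    by_cases h : s = 1
    · subst h
      exact continuousAt_update_same.mpr riemannZeta_residue_one
    · rw [hg, continuousAt_update_of_ne h]
      exact ((differentiableAt_id.sub_const 1).mul (differentiableAt_riemannZeta h)).continuousAt
  have hne : ∀ s : ℂ, 1 ≤ s.re → g s ≠ 0 := by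
    intro s hs
    by_cases h : s = 1
    · subst h; simp [hg]
    · rw [hg, Function.update_of_ne h]
      exact mul_ne_zero (sub_ne_zero.mpr h) (riemannZeta_ne_zero_of_one_le_re hs)
  set K : Set ℂ := (Set.Icc 1 3) ×ℂ (Set.Icc (-t₀) t₀) with hK
  have hKc : IsCompact K := isCompact_Icc.reProdIm isCompact_Icc
  have hKne : K.Nonempty := ⟨1, by rw [hK, Complex.mem_reProdIm]; simp [ht]⟩
  obtain ⟨a, ha, hmin⟩ := hKc.exists_isMinOn hKne hcont.norm.continuousOn
  obtain ⟨b, hb, hmax⟩ := hKc.exists_isMaxOn hKne hcont.norm.continuousOn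
  have hare : ∀ s ∈ K, 1 ≤ s.re := fun s hs => (Complex.mem_reProdIm.mp hs).1.1
  refine ⟨‖g a‖, ‖g b‖, norm_pos_iff.mpr (hne a (hare a ha)), norm_pos_iff.mpr (hne b (hare b hb)), ?_⟩
  intro σ τ h1 h3 hτ
  have hmem : (σ : ℂ) + τ * Complex.I ∈ K := by
    rw [hK, Complex.mem_reProdIm]
    simp only [Complex.add_re, Complex.ofReal_re, Complex.mul_re, Complex.I_re, mul_zero,
      Complex.ofReal_im, Complex.I_im, mul_one, sub_self, add_zero, Complex.add_im, Complex.mul_im,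
      zero_add, Set.mem_Icc]
    exact ⟨⟨h1.le, h3⟩, abs_le.mp hτ⟩
  have hne1 : (σ : ℂ) + τ * Complex.I ≠ 1 := by
    intro h
    have := congrArg Complex.re h
    simp at this
    linarith
  have e : g ((σ : ℂ) + τ * Complex.I) =
      ((σ : ℂ) + τ * Complex.I - 1) * riemannZeta (σ + τ * Complex.I) := by
    rw [hg, Function.update_of_ne hne1]
  rw [← e]
  exact ⟨hmin hmem, hmax hmem⟩

lemma norm_riemannZeta_real_le {x : ℝ} (hx : 0 < x) (hx2 : x ≤ 2) :
    ‖riemannZeta (1 + x)‖ ≤ 15 / x := by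
  have h := norm_riemannZeta_sub_partial_le (s := 1 + x) (by simp [hx]) (le_refl 1)
  have hn : ‖(1 : ℂ) + x‖ = 1 + x := by
    rw [← Complex.ofReal_one, ← Complex.ofReal_add, Complex.norm_real, Real.norm_eq_abs,
      abs_of_pos (by linarith)]
  simp only [Finset.Icc_self, Finset.sum_singleton, Nat.cast_one, Complex.one_cpow,
    add_sub_cancel_left, hn, div_one] at h
  have h2 : ‖(1 : ℂ) + 1 / (x : ℂ)‖ ≤ 1 + 1 / x := by
    refine (norm_add_le _ _).trans ?_
    rw [norm_div, Complex.norm_real, Real.norm_eq_abs, abs_of_pos hx]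
    simp
  calc ‖riemannZeta (1 + x)‖ ≤ ‖riemannZeta (1 + x) - (1 + 1 / (x : ℂ))‖ + ‖(1 : ℂ) + 1 / (x : ℂ)‖ := by
        simpa using norm_add_le (riemannZeta (1 + x) - (1 + 1 / (x : ℂ))) ((1 : ℂ) + 1 / (x : ℂ))
    _ ≤ 2 * (1 + x) + (1 + 1 / x) := add_le_add h h2
    _ ≤ 15 / x := by
      rw [le_div_iff₀ hx]
      have : (2 * (1 + x) + (1 + 1 / x)) * x = 2 * x + 2 * x ^ 2 + x + 1 := by field_simp; ring
      rw [this]; nlinarith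

lemma riemannZeta_three_four_one {x : ℝ} (hx : 0 < x) (y : ℝ) :
    1 ≤ ‖riemannZeta (1 + x)‖ ^ 3 * ‖riemannZeta (1 + x + y * Complex.I)‖ ^ 4 *
      ‖riemannZeta (1 + x + (2 * y : ℝ) * Complex.I)‖ := by
  have h := DirichletCharacter.norm_LFunction_product_ge_one (1 : DirichletCharacter ℂ 1) hx y
  rw [DirichletCharacter.LFunctionTrivChar, DirichletCharacter.LFunction_modOne_eq,
    DirichletCharacter.LFunction_modOne_eq, norm_mul, norm_mul, norm_pow, norm_pow] at h
  have e1 : (1 : ℂ) + x + Complex.I * y = 1 + x + y * Complex.I := by ring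
  have e2 : (1 : ℂ) + x + 2 * Complex.I * y = 1 + x + (2 * y : ℝ) * Complex.I := by push_cast; ring
  rw [e1, e2] at h
  exact h

lemma norm_riemannZeta_pow_four_ge {x τ : ℝ} (hx : 0 < x) (hx2 : x ≤ 2) (hτ : 1 ≤ |τ|) :
    x ^ 3 / (80000 * Real.log (|τ| + 3)) ≤ ‖riemannZeta (((1 + x : ℝ) : ℂ) + τ * Complex.I)‖ ^ 4 := by
  have h := riemannZeta_three_four_one hx τ
  have h1 := norm_riemannZeta_real_le hx hx2
  have h2 := norm_riemannZeta_le (σ := 1 + x) (τ := 2 * τ) (by linarith) (by linarith)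
    (by rw [abs_mul, abs_two]; linarith)
  have hΛ := one_le_log_add_three (abs_nonneg τ)
  have h3 : Real.log (|2 * τ| + 3) ≤ 2 * Real.log (|τ| + 3) := by
    rw [abs_mul, abs_two]
    calc Real.log (2 * |τ| + 3) ≤ Real.log ((|τ| + 3) ^ 2) :=
          Real.log_le_log (by positivity) (by nlinarith [abs_nonneg τ])
      _ = _ := by rw [Real.log_pow]; norm_num
  push_cast at h2 ⊢
  push_cast at h
  set z := ‖riemannZeta (1 + x + τ * Complex.I)‖ with hz
  have hz0 : 0 ≤ z := norm_nonneg _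
  have h4 : 1 ≤ (15 / x) ^ 3 * z ^ 4 * (22 * Real.log (|τ| + 3)) := by
    refine h.trans ?_
    gcongr
    linarith
  rw [div_le_iff₀ (by positivity)]
  have e : (15 / x) ^ 3 * z ^ 4 * (22 * Real.log (|τ| + 3))
      = (z ^ 4 * (74250 * Real.log (|τ| + 3))) / x ^ 3 := by
    field_simp; ring
  rw [e, le_div_iff₀ (by positivity)] at h4
  have : 0 ≤ z ^ 4 * Real.log (|τ| + 3) := by positivity
  nlinarith

lemma exists_log_pow_seven_le (c : ℝ) (hc : 0 < c) :
    ∃ t₀ : ℝ, 1 ≤ t₀ ∧ ∀ t : ℝ, t₀ ≤ t → 16 / t ^ 2 ≤ c / Real.log (t + 3) ^ 7 := by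
  have h := (Real.isLittleO_pow_log_id_atTop (n := 7)).bound (show 0 < c / 64 by positivity)
  obtain ⟨a, ha⟩ := Filter.eventually_atTop.mp h
  refine ⟨max 1 a, le_max_left _ _, fun t ht => ?_⟩
  have h1 : 1 ≤ t := (le_max_left _ _).trans ht
  have h2 := ha (t + 3) (by linarith [(le_max_right 1 a).trans ht])
  have h3 := one_le_log_add_three (τ := t) (by linarith)
  rw [Real.norm_eq_abs, abs_of_nonneg (by positivity), id, Real.norm_eq_abs,
    abs_of_nonneg (by linarith)] at h2
  rw [div_le_div_iff₀ (by positivity) (by positivity)]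
  have h4 : c * t ≤ c * t ^ 2 := by gcongr; nlinarith
  have h5 : c * 1 ≤ c * t := by gcongr
  linarith

lemma exists_norm_riemannZeta_ge : ∃ c : ℝ, 0 < c ∧ ∀ σ τ : ℝ, 1 < σ → σ ≤ 3 → 1 ≤ |τ| →
    c / Real.log (|τ| + 3) ^ 7 ≤ ‖riemannZeta (σ + τ * Complex.I)‖ := by
  set b : ℝ := 1 / 2000 with hb
  obtain ⟨t₀, ht₀, hlarge⟩ := exists_log_pow_seven_le (b ^ 3 / 52) (by positivity)
  obtain ⟨c₁, C₁, hc₁, -, hcpt⟩ := exists_bounds_sub_one_mul_riemannZeta t₀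
  refine ⟨min (b ^ 3 / 2000) (c₁ / (3 + t₀)), by positivity, ?_⟩
  intro σ τ h1 h3 hτ
  set Λ := Real.log (|τ| + 3) with hΛdef
  have hΛ : 1 ≤ Λ := one_le_log_add_three (abs_nonneg τ)
  have hΛ7 : 1 ≤ Λ ^ 7 := one_le_pow₀ hΛ
  by_cases ht : |τ| ≤ t₀
  · have h := (hcpt σ τ h1 h3 ht).1
    rw [norm_mul] at h
    have h4 : ‖(σ : ℂ) + τ * Complex.I - 1‖ ≤ 3 + t₀ := by
      have e : (σ : ℂ) + τ * Complex.I - 1 = ((σ - 1 : ℝ) : ℂ) + τ * Complex.I := by push_cast; ring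
      rw [e]
      exact (norm_add_mul_I_le (by linarith)).trans (by linarith)
    have h5 : c₁ / (3 + t₀) ≤ ‖riemannZeta (σ + τ * Complex.I)‖ := by
      rw [div_le_iff₀ (by linarith)]
      refine h.trans ?_
      rw [mul_comm]
      gcongr
    refine le_trans ?_ h5
    exact (div_le_self (by positivity) hΛ7).trans (min_le_right _ _)
  · have ht' : t₀ ≤ |τ| := le_of_not_ge ht
    have h16 := hlarge |τ| ht'
    rw [← hΛdef] at h16
    set x : ℝ := b ^ 4 / Λ ^ 9 with hx
    have hx0 : 0 < x := by positivity
    have hx2 : x ≤ 2 := by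
      have : x ≤ b ^ 4 := div_le_self (by positivity) (one_le_pow₀ hΛ)
      have : b ^ 4 ≤ 2 := by rw [hb]; norm_num
      linarith
    have hz : ∀ y : ℝ, x ≤ y → y ≤ 2 →
        b ^ 3 / (17 * Λ ^ 7) ≤ ‖riemannZeta (((1 + y : ℝ) : ℂ) + τ * Complex.I)‖ := by
      intro y hxy hy2
      have h := norm_riemannZeta_pow_four_ge (lt_of_lt_of_le hx0 hxy) hy2 hτ
      rw [← hΛdef] at h
      refine le_of_pow_le_pow_left₀ (n := 4) (by norm_num) (norm_nonneg _) (le_trans ?_ h)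
      calc (b ^ 3 / (17 * Λ ^ 7)) ^ 4 = b ^ 12 / (83521 * Λ ^ 28) := by
            rw [div_pow, mul_pow]; ring_nf
        _ ≤ b ^ 12 / (80000 * Λ ^ 28) := by gcongr; norm_num
        _ = x ^ 3 / (80000 * Λ) := by rw [hx]; field_simp
        _ ≤ _ := by gcongr
    have hfin : b ^ 3 / 2000 / Λ ^ 7 ≤ ‖riemannZeta (σ + τ * Complex.I)‖ := by
      by_cases hσ : x ≤ σ - 1
      · have h := hz (σ - 1) hσ (by linarith)
        rw [add_sub_cancel] at h
        refine le_trans ?_ h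
        rw [div_div]
        gcongr
        norm_num
      · have h := hz x le_rfl hx2
        have hd := norm_riemannZeta_sub_le (a := 1 + x) (b := σ) (τ := τ) (by linarith) (by linarith)
          h1 h3 hτ
        rw [← hΛdef] at hd
        have habs : |1 + x - σ| ≤ x := by
          rw [abs_le]; constructor <;> linarith
        have h5 : 36 * Λ ^ 2 * |1 + x - σ| ≤ (b ^ 3 / 52) / Λ ^ 7 := by
          calc 36 * Λ ^ 2 * |1 + x - σ| ≤ 36 * Λ ^ 2 * x := by gcongr
            _ = (36 * b ^ 4) / Λ ^ 7 := by rw [hx]; field_simp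
            _ ≤ _ := by gcongr; rw [hb]; norm_num
        have h6 : ‖riemannZeta (((1 + x : ℝ) : ℂ) + τ * Complex.I)‖
            ≤ ‖riemannZeta (σ + τ * Complex.I)‖ +
              ‖riemannZeta (((1 + x : ℝ) : ℂ) + τ * Complex.I) - riemannZeta (σ + τ * Complex.I)‖ := by
          have := norm_add_le (riemannZeta (σ + τ * Complex.I))
            (riemannZeta (((1 + x : ℝ) : ℂ) + τ * Complex.I) - riemannZeta (σ + τ * Complex.I))
          simpa using this
        have e1 : b ^ 3 / (17 * Λ ^ 7) = b ^ 3 / Λ ^ 7 / 17 := by field_simp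
        have e2 : b ^ 3 / 52 / Λ ^ 7 = b ^ 3 / Λ ^ 7 / 52 := by field_simp
        have e3 : b ^ 3 / 2000 / Λ ^ 7 = b ^ 3 / Λ ^ 7 / 2000 := by field_simp
        have hw : 0 < b ^ 3 / Λ ^ 7 := by positivity
        rw [e1] at h
        rw [e2] at h5 h16
        rw [e3]
        linarith
    refine le_trans ?_ hfin
    gcongr
    exact min_le_left _ _

/-- `∑_p p^{-σ} cos (τ log p)`, the prime part of `log |ζ(σ + iτ)|`. -/
noncomputable def primeCosSum (σ τ : ℝ) : ℝ :=
  ∑' p : Nat.Primes, Real.cos (τ * Real.log p) * ((p : ℕ) : ℝ) ^ (-σ)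

lemma re_natCast_cpow (σ τ : ℝ) {n : ℕ} (hn : 0 < n) :
    ((n : ℂ) ^ (-((σ : ℂ) + τ * Complex.I))).re
      = Real.cos (τ * Real.log n) * (n : ℝ) ^ (-σ) := by
  have hn' : (0 : ℝ) < n := by exact_mod_cast hn
  rw [Complex.cpow_def_of_ne_zero (by exact_mod_cast hn.ne'), Complex.exp_re,
    ← Complex.natCast_log, Real.rpow_def_of_pos hn']
  have h1 : (((Real.log n : ℝ) : ℂ) * (-((σ : ℂ) + τ * Complex.I))).re = Real.log n * -σ := by
    generalize Real.log n = a
    simp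
  have h2 : (((Real.log n : ℝ) : ℂ) * (-((σ : ℂ) + τ * Complex.I))).im = -(τ * Real.log n) := by
    generalize Real.log n = a
    simp; ring
  rw [h1, h2, Real.cos_neg, mul_comm]

lemma summable_primes_rpow {σ : ℝ} (hσ : 1 < σ) :
    Summable fun p : Nat.Primes => ((p : ℕ) : ℝ) ^ (-σ) :=
  Nat.Primes.summable_rpow.mpr (by linarith)

lemma summable_primes_cos {σ : ℝ} (hσ : 1 < σ) (τ : ℝ) :
    Summable fun p : Nat.Primes => Real.cos (τ * Real.log p) * ((p : ℕ) : ℝ) ^ (-σ) := by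
  refine Summable.of_norm_bounded (summable_primes_rpow hσ) fun p => ?_
  rw [norm_mul, Real.norm_eq_abs, Real.norm_eq_abs,
    abs_of_nonneg (a := ((p : ℕ) : ℝ) ^ (-σ)) (by positivity)]
  exact mul_le_of_le_one_left (by positivity) (Real.abs_cos_le_one _)

lemma exists_abs_primeCosSum_sub_le : ∃ C : ℝ, 0 ≤ C ∧ ∀ σ τ : ℝ, 1 < σ →
    |primeCosSum σ τ - Real.log ‖riemannZeta (σ + τ * Complex.I)‖| ≤ C := by
  have h2 := summable_primes_rpow (σ := 2) (by norm_num)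
  refine ⟨∑' p : Nat.Primes, ((p : ℕ) : ℝ) ^ (-2 : ℝ), tsum_nonneg fun p => by positivity, ?_⟩
  intro σ τ hσ
  set s : ℂ := (σ : ℂ) + τ * Complex.I with hs
  have hsre : s.re = σ := by simp [hs]
  have hnorm : ∀ p : Nat.Primes, ‖((p : ℕ) : ℂ) ^ (-s)‖ = ((p : ℕ) : ℝ) ^ (-σ) := fun p => by
    rw [Complex.norm_natCast_cpow_of_pos p.prop.pos, Complex.neg_re, hsre]
  have hsum : Summable fun p : Nat.Primes => ((p : ℕ) : ℂ) ^ (-s) := by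
    refine Summable.of_norm ?_
    simpa only [hnorm] using summable_primes_rpow hσ
  have hlogs := hsum.clog_one_sub.neg
  have hz := riemannZeta_eulerProduct_exp_log (s := s) (by rw [hsre]; exact hσ)
  have hlog : Real.log ‖riemannZeta s‖
      = ∑' p : Nat.Primes, (-Complex.log (1 - ((p : ℕ) : ℂ) ^ (-s))).re := by
    rw [← hz, Complex.norm_exp, Real.log_exp, Complex.re_tsum hlogs]
  have hre := (Complex.hasSum_re hlogs.hasSum).summable
  rw [hlog, primeCosSum, ← (summable_primes_cos hσ τ).tsum_sub hre, ← Real.norm_eq_abs]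
  refine tsum_of_norm_bounded h2.hasSum fun p => ?_
  rw [← re_natCast_cpow σ τ p.prop.pos, ← Complex.sub_re, Real.norm_eq_abs, ← hs]
  refine (Complex.abs_re_le_norm _).trans ?_
  set z := ((p : ℕ) : ℂ) ^ (-s) with hzdef
  have hp2 : (2 : ℝ) ≤ ((p : ℕ) : ℝ) := by exact_mod_cast p.prop.two_le
  have hz1 : ‖z‖ ≤ ((p : ℕ) : ℝ) ^ (-1 : ℝ) := by
    rw [hnorm]
    exact Real.rpow_le_rpow_of_exponent_le (by linarith) (by linarith)
  have hz2 : ‖z‖ ≤ 1 / 2 := by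
    refine hz1.trans ?_
    rw [Real.rpow_neg_one, one_div]
    exact inv_anti₀ (by norm_num) hp2
  have h := Complex.norm_log_one_sub_inv_sub_self_le (z := z) (by linarith)
  rw [Complex.log_inv] at h
  · rw [← norm_neg, neg_sub]
    refine h.trans ?_
    have h3 : (1 - ‖z‖)⁻¹ ≤ 2 := by
      rw [inv_le_comm₀ (by linarith) (by norm_num)]; linarith
    calc ‖z‖ ^ 2 * (1 - ‖z‖)⁻¹ / 2 ≤ ‖z‖ ^ 2 * 2 / 2 := by gcongr
      _ = ‖z‖ ^ 2 := by ring
      _ ≤ (((p : ℕ) : ℝ) ^ (-1 : ℝ)) ^ 2 := by gcongr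
      _ = _ := by rw [← Real.rpow_natCast, ← Real.rpow_mul (by positivity)]; norm_num
  · intro harg
    have : 0 < (1 - z).re := by
      have := (Complex.re_le_norm z)
      simp only [Complex.sub_re, Complex.one_re]; linarith
    have h5 := Complex.abs_arg_lt_pi_div_two_iff.mpr (Or.inl this)
    rw [harg, abs_of_pos Real.pi_pos] at h5
    linarith [Real.pi_pos]

lemma exists_log_log_le {ε : ℝ} (hε : 0 < ε) : ∃ C : ℝ, 0 ≤ C ∧ ∀ T : ℝ, 1 ≤ T →
    7 * Real.log (Real.log (6 * T + 3)) ≤ ε * Real.log T + C := by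
  refine ⟨|ε * Real.log 9| + |7 * Real.log (ε / 7)|, by positivity, fun T hT => ?_⟩
  have hv : 0 < Real.log (6 * T + 3) := Real.log_pos (by linarith)
  have h := Real.log_le_sub_one_of_pos (x := ε / 7 * Real.log (6 * T + 3)) (by positivity)
  rw [Real.log_mul (by positivity) hv.ne'] at h
  have h2 : Real.log (6 * T + 3) ≤ Real.log 9 + Real.log T := by
    rw [← Real.log_mul (by norm_num) (by linarith)]
    exact Real.log_le_log (by linarith) (by linarith)
  have h3 := neg_abs_le (7 * Real.log (ε / 7))
  have h4 := le_abs_self (ε * Real.log 9)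
  have h5 : ε * Real.log (6 * T + 3) ≤ ε * (Real.log 9 + Real.log T) := by gcongr
  linarith

lemma log_two_gt : (0.69 : ℝ) < Real.log 2 := by
  have := Real.log_two_gt_d9; linarith

/-- Two-sided bounds for the prime cosine sum near the line `σ = 1`, uniform in the height. -/
lemma exists_primeCosSum_bounds {ε : ℝ} (hε : 0 < ε) : ∃ C : ℝ, 0 ≤ C ∧ ∀ L T l : ℝ,
    Real.log 2 ≤ L → 1 ≤ T → |l| ≤ 4 * T →
    Real.log L - Real.log (min T L) - ε * Real.log T - C ≤ primeCosSum (1 + 1 / L) (l / L) ∧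
    primeCosSum (1 + 1 / L) (l / L) ≤
      Real.log L - Real.log (min T L) + (Real.log T - Real.log (1 + |l|)) + ε * Real.log T + C := by
  obtain ⟨C₀, hC₀, h₀⟩ := exists_abs_primeCosSum_sub_le
  obtain ⟨c₁, C₁, hc₁, hC₁, h₁⟩ := exists_bounds_sub_one_mul_riemannZeta 1
  obtain ⟨c₂, hc₂, h₂⟩ := exists_norm_riemannZeta_ge
  obtain ⟨C₃, hC₃, h₃⟩ := exists_log_log_le hε
  refine ⟨C₀ + |Real.log c₁| + |Real.log C₁| + |Real.log c₂| + C₃ + Real.log 5 + Real.log 5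
    + Real.log 11, ?_, ?_⟩
  · have := Real.log_nonneg (show (1 : ℝ) ≤ 5 by norm_num)
    have := Real.log_nonneg (show (1 : ℝ) ≤ 11 by norm_num)
    positivity
  intro L T l hL hT hl
  have hL0 : 0.69 < L := log_two_gt.trans_le hL
  have hLpos : 0 < L := by linarith
  have hσ1 : 1 < 1 + 1 / L := by have : 0 < 1 / L := by positivity
                                 linarith
  have hσ3 : 1 + 1 / L ≤ 3 := by
    have : 1 / L ≤ 1 / 0.69 := by gcongr
    norm_num at this ⊢; linarith
  have hkey := abs_le.mp (h₀ (1 + 1 / L) (l / L) hσ1)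
  have hlog5 := Real.log_nonneg (show (1 : ℝ) ≤ 5 by norm_num)
  have hlog11 := Real.log_nonneg (show (1 : ℝ) ≤ 11 by norm_num)
  have hlogT := Real.log_nonneg hT
  have hεT : 0 ≤ ε * Real.log T := by positivity
  have hmpos : 0 < min T L := lt_min (by linarith) hLpos
  have hmT : Real.log (min T L) ≤ Real.log T := Real.log_le_log hmpos (min_le_left _ _)
  have hmL : Real.log (min T L) ≤ Real.log L := Real.log_le_log hmpos (min_le_right _ _)
  have hab1 := neg_abs_le (Real.log c₁)
  have hab2 := le_abs_self (Real.log C₁)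
  have hab3 := neg_abs_le (Real.log c₂)
  have hab4 := abs_nonneg (Real.log c₁)
  have hab5 := abs_nonneg (Real.log C₁)
  have hab6 := abs_nonneg (Real.log c₂)
  have hl5 : Real.log (1 + |l|) ≤ Real.log 5 + Real.log T := by
    rw [← Real.log_mul (by norm_num) (by linarith)]
    exact Real.log_le_log (by positivity) (by linarith)
  rcases le_total |l / L| 1 with hτ | hτ
  · obtain ⟨hlo, hhi⟩ := h₁ (1 + 1 / L) (l / L) hσ1 hσ3 hτ
    rw [norm_mul] at hlo hhi
    set Z := ‖riemannZeta (((1 + 1 / L : ℝ) : ℂ) + ((l / L : ℝ) : ℂ) * Complex.I)‖ with hZ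
    set D := ‖(((1 + 1 / L : ℝ) : ℂ) + ((l / L : ℝ) : ℂ) * Complex.I - 1)‖ with hD
    have hDpos : 0 < D := by
      rcases (norm_nonneg _ : 0 ≤ D).lt_or_eq with h | h
      · exact h
      · rw [hD, ← h, zero_mul] at hlo; linarith
    have hZpos : 0 < Z := by
      rcases (norm_nonneg _ : 0 ≤ Z).lt_or_eq with h | h
      · exact h
      · rw [hZ, ← h, mul_zero] at hlo; linarith
    have hlL : |l| ≤ L := by
      rwa [abs_div, abs_of_pos hLpos, div_le_one hLpos] at hτ
    have hDle : D ≤ (1 + |l|) / L := by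
      have e : (((1 + 1 / L : ℝ) : ℂ) + ((l / L : ℝ) : ℂ) * Complex.I - 1)
          = ((1 / L : ℝ) : ℂ) + ((l / L : ℝ) : ℂ) * Complex.I := by push_cast; ring
      rw [hD, e]
      refine (norm_add_le _ _).trans (le_of_eq ?_)
      rw [norm_mul, Complex.norm_I, mul_one, Complex.norm_real, Complex.norm_real,
        Real.norm_eq_abs, Real.norm_eq_abs, abs_div, abs_div, abs_of_pos hLpos, abs_one, add_div]
    have hDge : (1 + |l|) / (2 * L) ≤ D := by
      have hre := Complex.abs_re_le_norm
        (((1 + 1 / L : ℝ) : ℂ) + ((l / L : ℝ) : ℂ) * Complex.I - 1)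
      have him := Complex.abs_im_le_norm
        (((1 + 1 / L : ℝ) : ℂ) + ((l / L : ℝ) : ℂ) * Complex.I - 1)
      rw [← hD] at hre him
      simp only [Complex.sub_re, Complex.add_re, Complex.ofReal_re, Complex.mul_re, Complex.I_re,
        mul_zero, Complex.ofReal_im, Complex.I_im, sub_self, add_zero, Complex.one_re,
        add_sub_cancel_left, Complex.sub_im, Complex.add_im, Complex.mul_im, mul_one, zero_add,
        Complex.one_im, sub_zero] at hre him
      rw [abs_of_pos (by positivity)] at hre
      rw [abs_div, abs_of_pos hLpos] at him
      have : (1 + |l|) / (2 * L) = (1 / L + |l| / L) / 2 := by field_simp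
      linarith
    have hlogD1 : Real.log D ≤ Real.log (1 + |l|) - Real.log L := by
      rw [← Real.log_div (by positivity) (by positivity)]
      exact Real.log_le_log hDpos hDle
    have hlogD2 : Real.log (1 + |l|) - Real.log L - Real.log 2 ≤ Real.log D := by
      rw [sub_sub, ← Real.log_mul (by positivity) (by norm_num),
        ← Real.log_div (by positivity) (by positivity), mul_comm L]
      exact Real.log_le_log (by positivity) hDge
    have hlog25 : Real.log 2 ≤ Real.log 5 := Real.log_le_log (by norm_num) (by norm_num)
    have hA := Real.log_le_log hc₁ hlo
    have hB := Real.log_le_log (by positivity) hhi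
    rw [Real.log_mul hDpos.ne' hZpos.ne'] at hA hB
    constructor
    · rcases le_total T L with hTL | hTL
      · rw [min_eq_left hTL]
        linarith
      · rw [min_eq_right hTL]
        have : Real.log (1 + |l|) ≤ Real.log 5 + Real.log L := by
          rw [← Real.log_mul (by norm_num) (by linarith)]
          exact Real.log_le_log (by positivity) (by linarith)
        linarith
    · linarith
  · have hlL : L ≤ |l| := by
      rwa [abs_div, abs_of_pos hLpos, one_le_div hLpos] at hτ
    have hτT : |l / L| ≤ 6 * T := by
      rw [abs_div, abs_of_pos hLpos, div_le_iff₀ hLpos]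
      nlinarith
    have hΛ1 := one_le_log_add_three (abs_nonneg (l / L))
    have hll : Real.log (Real.log (|l / L| + 3)) ≤ Real.log (Real.log (6 * T + 3)) := by
      apply Real.log_le_log (by linarith)
      exact Real.log_le_log (by positivity) (by linarith)
    have hll0 : 0 ≤ Real.log (Real.log (|l / L| + 3)) := Real.log_nonneg hΛ1
    have h3 := h₃ T hT
    have hlo := h₂ (1 + 1 / L) (l / L) hσ1 hσ3 hτ
    have hhi := norm_riemannZeta_le hσ1 hσ3 hτ
    have hlo' := Real.log_le_log (by positivity) hlo
    have hZpos := (show 0 < c₂ / Real.log (|l / L| + 3) ^ 7 by positivity).trans_le hlo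
    have hhi' := Real.log_le_log hZpos hhi
    rw [Real.log_div hc₂.ne' (by positivity), Real.log_pow] at hlo'
    rw [Real.log_mul (by norm_num) (by positivity)] at hhi'
    rw [Nat.cast_ofNat] at hlo'
    have hLm : Real.log L ≤ Real.log 5 + Real.log (min T L) := by
      rw [← Real.log_mul (by norm_num) hmpos.ne']
      apply Real.log_le_log hLpos
      rcases le_total T L with hTL | hTL
      · rw [min_eq_left hTL]; linarith
      · rw [min_eq_right hTL]; linarith
    constructor <;> linarith

lemma sum_mul_log_eq (g : ℕ → ℝ) (N : ℕ) :
    ∑ n ∈ Finset.Icc 1 N, g n * Real.log n =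
      ∑ m ∈ Finset.Icc 1 N, ∑ d ∈ Finset.Icc 1 (N / m),
        ArithmeticFunction.vonMangoldt d * g (d * m) := by
  have h1 : ∀ n ∈ Finset.Icc 1 N, g n * Real.log n =
      ∑ x ∈ n.divisorsAntidiagonal, ArithmeticFunction.vonMangoldt x.1 * g n := by
    intro n _
    rw [← ArithmeticFunction.vonMangoldt_sum, ← Finset.sum_mul, mul_comm,
      Nat.sum_divisorsAntidiagonal (f := fun d _ => ArithmeticFunction.vonMangoldt d)]
  rw [Finset.sum_congr rfl h1, Finset.sum_sigma', Finset.sum_sigma']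
  refine Finset.sum_nbij' (fun a => ⟨a.2.2, a.2.1⟩) (fun b => ⟨b.2 * b.1, (b.2, b.1)⟩) ?_ ?_ ?_ ?_ ?_
  · rintro ⟨n, d, m⟩ h
    simp only [Finset.mem_sigma, Finset.mem_Icc, Nat.mem_divisorsAntidiagonal] at h ⊢
    obtain ⟨⟨h1, h2⟩, rfl, h3⟩ := h
    have hd : 0 < d := Nat.pos_of_ne_zero (by rintro rfl; simp at h3)
    have hm : 0 < m := Nat.pos_of_ne_zero (by rintro rfl; simp at h3)
    refine ⟨⟨hm, ?_⟩, hd, ?_⟩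
    · nlinarith
    · rwa [Nat.le_div_iff_mul_le hm]
  · rintro ⟨m, d⟩ h
    simp only [Finset.mem_sigma, Finset.mem_Icc, Nat.mem_divisorsAntidiagonal] at h ⊢
    obtain ⟨⟨h1, h2⟩, h3, h4⟩ := h
    rw [Nat.le_div_iff_mul_le h1] at h4
    exact ⟨⟨Nat.mul_pos h3 h1, h4⟩, trivial, by positivity⟩
  · rintro ⟨n, d, m⟩ h
    simp only [Finset.mem_sigma, Nat.mem_divisorsAntidiagonal] at h ⊢
    obtain ⟨-, rfl, -⟩ := h
    rfl
  · rintro ⟨m, d⟩ _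
    rfl
  · rintro ⟨n, d, m⟩ h
    simp only [Finset.mem_sigma, Nat.mem_divisorsAntidiagonal] at h ⊢
    obtain ⟨-, rfl, -⟩ := h
    rfl

lemma mem_primesLE {p N : ℕ} : p ∈ Nat.primesLE N ↔ p.Prime ∧ p ≤ N := by
  rw [Nat.primesLE_eq_filter_range]
  simp [and_comm]

lemma sum_log_div_primesLE_le {N : ℕ} (hN : 1 ≤ N) :
    ∑ p ∈ Nat.primesLE N, Real.log p / p ≤ Real.log N + Real.log 4 := by
  have hN' : (0 : ℝ) < N := by exact_mod_cast hN
  have h1 := sum_mul_log_eq (fun _ => 1) N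
  simp only [one_mul, mul_one] at h1
  have h2 : ∑ m ∈ Finset.Icc 1 N, ∑ d ∈ Finset.Icc 1 (N / m), ArithmeticFunction.vonMangoldt d
      = ∑ d ∈ Finset.Icc 1 N, ((N / d : ℕ) : ℝ) * ArithmeticFunction.vonMangoldt d := by
    rw [Finset.sum_comm' (t' := Finset.Icc 1 N) (s' := fun d => Finset.Icc 1 (N / d))]
    · simp
    · intro a b
      simp only [Finset.mem_Icc]
      constructor
      · rintro ⟨⟨ha, _⟩, hb, hab⟩
        rw [Nat.le_div_iff_mul_le ha] at hab
        refine ⟨⟨ha, ?_⟩, hb, by nlinarith⟩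
        rw [Nat.le_div_iff_mul_le hb]; linarith
      · rintro ⟨⟨ha, hab⟩, hb, _⟩
        rw [Nat.le_div_iff_mul_le hb] at hab
        refine ⟨⟨ha, by nlinarith⟩, hb, ?_⟩
        rw [Nat.le_div_iff_mul_le ha]; linarith
  have h3 : ∑ n ∈ Finset.Icc 1 N, Real.log n ≤ N * Real.log N := by
    calc ∑ n ∈ Finset.Icc 1 N, Real.log n ≤ ∑ n ∈ Finset.Icc 1 N, Real.log N := by
          refine Finset.sum_le_sum fun n hn => ?_
          rw [Finset.mem_Icc] at hn
          exact Real.log_le_log (by exact_mod_cast hn.1) (by exact_mod_cast hn.2)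
      _ = _ := by simp
  have h4 : ∑ p ∈ Nat.primesLE N, ((N / p : ℕ) : ℝ) * Real.log p
      ≤ ∑ d ∈ Finset.Icc 1 N, ((N / d : ℕ) : ℝ) * ArithmeticFunction.vonMangoldt d := by
    have : ∑ p ∈ Nat.primesLE N, ((N / p : ℕ) : ℝ) * Real.log p
        = ∑ p ∈ Nat.primesLE N, ((N / p : ℕ) : ℝ) * ArithmeticFunction.vonMangoldt p := by
      refine Finset.sum_congr rfl fun p hp => ?_
      rw [ArithmeticFunction.vonMangoldt_apply_prime (mem_primesLE.mp hp).1]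
    rw [this]
    refine Finset.sum_le_sum_of_subset_of_nonneg ?_ fun d _ _ => ?_
    · intro p hp
      have := mem_primesLE.mp hp
      exact Finset.mem_Icc.mpr ⟨this.1.one_le, this.2⟩
    · exact mul_nonneg (by positivity) ArithmeticFunction.vonMangoldt_nonneg
  have h5 : ∑ p ∈ Nat.primesLE N, (N * (Real.log p / p) - Real.log p)
      ≤ ∑ p ∈ Nat.primesLE N, ((N / p : ℕ) : ℝ) * Real.log p := by
    refine Finset.sum_le_sum fun p hp => ?_
    have hp' := (mem_primesLE.mp hp).1
    have hp0 : (0 : ℝ) < p := by exact_mod_cast hp'.pos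
    have h6 : (N : ℝ) / p - 1 ≤ ((N / p : ℕ) : ℝ) := by
      rw [← Nat.floor_div_eq_div (K := ℝ)]
      exact (Nat.sub_one_lt_floor _).le
    have h7 : 0 ≤ Real.log p := Real.log_natCast_nonneg p
    calc N * (Real.log p / p) - Real.log p = ((N : ℝ) / p - 1) * Real.log p := by ring
      _ ≤ _ := by gcongr
  rw [Finset.sum_sub_distrib, ← Finset.mul_sum] at h5
  have h8 := Chebyshev.theta_le_log4_mul_x (x := N) hN'.le
  rw [Chebyshev.theta_eq_sum_primesLE_log] at h8
  have h9 : (N : ℝ) * ∑ p ∈ Nat.primesLE N, Real.log p / p ≤ N * (Real.log N + Real.log 4) := by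
    linarith
  exact le_of_mul_le_mul_left h9 hN'

/-- Replacing `p^{-1-1/L}` by `p^{-1}` costs at most `(log p / L) / p`. -/
lemma inv_sub_rpow_bounds {L : ℝ} (hL : 0 < L) {p : ℕ} (hp : 1 ≤ p) :
    (p : ℝ) ^ (-(1 + 1 / L)) ≤ (p : ℝ)⁻¹ ∧
    (p : ℝ)⁻¹ ≤ (p : ℝ) ^ (-(1 + 1 / L)) + Real.log p / p / L := by
  have hp0 : (0 : ℝ) < p := by exact_mod_cast hp
  have hlog : 0 ≤ Real.log p := Real.log_natCast_nonneg p
  have e : (p : ℝ) ^ (-(1 + 1 / L)) = (p : ℝ)⁻¹ * Real.exp (-(Real.log p / L)) := by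
    rw [neg_add, Real.rpow_add hp0, Real.rpow_neg_one, Real.rpow_def_of_pos hp0]
    congr 2; ring
  have h1 := Real.add_one_le_exp (-(Real.log p / L))
  have h2 : Real.exp (-(Real.log p / L)) ≤ 1 := Real.exp_le_one_iff.mpr (by
    have : 0 ≤ Real.log p / L := by positivity
    linarith)
  rw [e]
  have hi : 0 < (p : ℝ)⁻¹ := by positivity
  constructor
  · exact mul_le_of_le_one_right hi.le h2
  · have : Real.log p / p / L = (p : ℝ)⁻¹ * (Real.log p / L) := by ring
    rw [this]
    nlinarith

lemma sum_log_div_div_le {R : ℝ} (hR : 2 ≤ R) :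
    ∑ p ∈ Nat.primesLE ⌊R⌋₊, Real.log p / p / Real.log R ≤ 4 := by
  have hL : 0.69 < Real.log R := log_two_gt.trans_le (Real.log_le_log (by norm_num) hR)
  rw [← Finset.sum_div, div_le_iff₀ (by linarith)]
  have hf : 1 ≤ ⌊R⌋₊ := Nat.le_floor (by norm_num; linarith)
  refine (sum_log_div_primesLE_le hf).trans ?_
  have h1 : Real.log ⌊R⌋₊ ≤ Real.log R :=
    Real.log_le_log (by exact_mod_cast hf) (Nat.floor_le (by linarith))
  have h2 : Real.log 4 = 2 * Real.log 2 := by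
    rw [show (4 : ℝ) = 2 ^ 2 by norm_num, Real.log_pow]; norm_num
  have h3 : Real.log 2 ≤ Real.log R := Real.log_le_log (by norm_num) hR
  linarith

/-- Finite sums over primes are dominated by the full Dirichlet series at `1 + 1/log R`. -/
lemma sum_div_primesLE_le_tsum {R K : ℝ} (hR : 2 ≤ R) (h : ℕ → ℝ) (h0 : ∀ p, 0 ≤ h p)
    (hK : ∀ p, h p ≤ K) :
    ∑ p ∈ Nat.primesLE ⌊R⌋₊, h p / p ≤
      (∑' p : Nat.Primes, h p * ((p : ℕ) : ℝ) ^ (-(1 + 1 / Real.log R))) + 4 * K := by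
  have hL : 0 < Real.log R := Real.log_pos (by linarith)
  have hK0 : 0 ≤ K := (h0 0).trans (hK 0)
  have hσ : 1 < 1 + 1 / Real.log R := by
    have : 0 < 1 / Real.log R := by positivity
    linarith
  have hsum : Summable fun p : Nat.Primes => h p * ((p : ℕ) : ℝ) ^ (-(1 + 1 / Real.log R)) := by
    refine Summable.of_nonneg_of_le (fun p => mul_nonneg (h0 _) (by positivity)) (fun p => ?_)
      ((summable_primes_rpow hσ).mul_left K)
    exact mul_le_mul_of_nonneg_right (hK _) (by positivity)
  have h1 : ∑ p ∈ Nat.primesLE ⌊R⌋₊, h p / p ≤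
      ∑ p ∈ Nat.primesLE ⌊R⌋₊, (h p * (p : ℝ) ^ (-(1 + 1 / Real.log R)) +
        K * (Real.log p / p / Real.log R)) := by
    refine Finset.sum_le_sum fun p hp => ?_
    have hp' := (mem_primesLE.mp hp).1
    have hb := (inv_sub_rpow_bounds hL hp'.one_le).2
    have hlog : 0 ≤ Real.log p := Real.log_natCast_nonneg p
    calc h p / p = h p * (p : ℝ)⁻¹ := div_eq_mul_inv _ _
      _ ≤ h p * ((p : ℝ) ^ (-(1 + 1 / Real.log R)) + Real.log p / p / Real.log R) :=
        mul_le_mul_of_nonneg_left hb (h0 p)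
      _ = h p * (p : ℝ) ^ (-(1 + 1 / Real.log R)) + h p * (Real.log p / p / Real.log R) := by ring
      _ ≤ _ := by
        gcongr
        exact hK p
  rw [Finset.sum_add_distrib, ← Finset.mul_sum] at h1
  have h2 := sum_log_div_div_le hR
  have h3 : ∑ p ∈ Nat.primesLE ⌊R⌋₊, h p * (p : ℝ) ^ (-(1 + 1 / Real.log R)) ≤
      ∑' p : Nat.Primes, h p * ((p : ℕ) : ℝ) ^ (-(1 + 1 / Real.log R)) := by
    have e : ∑ p ∈ Nat.primesLE ⌊R⌋₊, h p * (p : ℝ) ^ (-(1 + 1 / Real.log R)) =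
        ∑ p ∈ (Nat.primesLE ⌊R⌋₊).subtype Nat.Prime,
          h p * ((p : ℕ) : ℝ) ^ (-(1 + 1 / Real.log R)) := by
      rw [Finset.sum_subtype_of_mem (f := fun p : ℕ => h p * (p : ℝ) ^ (-(1 + 1 / Real.log R)))]
      exact fun p hp => (mem_primesLE.mp hp).1
    have key : ∀ s : Finset Nat.Primes, ∑ p ∈ s, h p * ((p : ℕ) : ℝ) ^ (-(1 + 1 / Real.log R)) ≤
        ∑' p : Nat.Primes, h p * ((p : ℕ) : ℝ) ^ (-(1 + 1 / Real.log R)) :=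
      fun s => hsum.sum_le_tsum s fun p _ => mul_nonneg (h0 _) (by positivity)
    rw [e]
    exact key _
  nlinarith

lemma exists_sum_inv_primesLE_le : ∃ C : ℝ, ∀ R : ℝ, 2 ≤ R →
    ∑ p ∈ Nat.primesLE ⌊R⌋₊, (1 : ℝ) / p ≤ Real.log (Real.log R) + C := by
  obtain ⟨C, -, hC⟩ := exists_primeCosSum_bounds one_pos
  refine ⟨C - Real.log 0.69 + 4, fun R hR => ?_⟩
  have hL2 : Real.log 2 ≤ Real.log R := Real.log_le_log (by norm_num) hR
  have hL : 0.69 < Real.log R := log_two_gt.trans_le hL2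
  have h1 := sum_div_primesLE_le_tsum (K := 1) hR (fun _ => 1) (fun _ => zero_le_one) fun _ => le_rfl
  have h2 := (hC (Real.log R) 1 0 hL2 le_rfl (by simp)).2
  simp only [primeCosSum, zero_div, zero_mul, Real.cos_zero, Real.log_one, abs_zero, add_zero,
    sub_self, mul_zero] at h2
  have h3 : Real.log 0.69 ≤ Real.log (min 1 (Real.log R)) :=
    Real.log_le_log (by norm_num) (le_min (by norm_num) hL.le)
  linarith

lemma exists_le_sum_inv_primesLE : ∃ C : ℝ, ∀ R : ℝ, 2 ≤ R →
    Real.log (Real.log R) - C ≤ ∑ p ∈ Nat.primesLE ⌊R⌋₊, (1 : ℝ) / p := by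
  have h2 := summable_primes_rpow (σ := 2) (by norm_num)
  refine ⟨2 * ∑' p : Nat.Primes, ((p : ℕ) : ℝ) ^ (-2 : ℝ), fun R hR => ?_⟩
  have hL : 0.69 < Real.log R := log_two_gt.trans_le (Real.log_le_log (by norm_num) hR)
  set N := ⌊R⌋₊ with hN
  let φ : ℕ →* ℝ :=
    { toFun := fun n => (n : ℝ)⁻¹, map_one' := by simp, map_mul' := fun a b => by
        push_cast; rw [mul_inv] }
  have hE := EulerProduct.summable_and_hasSum_smoothNumbers_prod_primesBelow_geometric (f := φ)
    (fun {p} hp => by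
      change ‖(p : ℝ)⁻¹‖ < 1
      rw [norm_inv, Real.norm_natCast]
      exact inv_lt_one_of_one_lt₀ (by exact_mod_cast hp.one_lt)) (N + 1)
  have h3 : Real.log R ≤ ∏ p ∈ Nat.primesLE N, (1 - (p : ℝ)⁻¹)⁻¹ := by
    refine (log_le_harmonic_floor R (by linarith)).trans ?_
    rw [harmonic_eq_sum_Icc]
    push_cast
    have hmem : ∀ n ∈ Finset.Icc 1 N, n ∈ (N + 1).smoothNumbers := by
      intro n hn
      rw [Finset.mem_Icc] at hn
      exact Nat.mem_smoothNumbers_of_lt hn.1 (by omega)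
    have h4 := hE.2.summable.sum_le_tsum ((Finset.Icc 1 N).subtype (· ∈ (N + 1).smoothNumbers))
      (fun i _ => by change 0 ≤ ((i : ℕ) : ℝ)⁻¹; positivity)
    rw [hE.2.tsum_eq] at h4
    refine le_trans (le_of_eq ?_) h4
    rw [Finset.sum_subtype_of_mem (f := fun n : ℕ => φ n) hmem]
    rfl
  have h5 : Real.log (Real.log R) ≤ ∑ p ∈ Nat.primesLE N, -Real.log (1 - (p : ℝ)⁻¹) := by
    refine (Real.log_le_log (by linarith) h3).trans (le_of_eq ?_)
    rw [Real.log_prod]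
    · exact Finset.sum_congr rfl fun p _ => Real.log_inv _
    · intro p hp
      have h6 : (1 : ℝ) < p := by exact_mod_cast (mem_primesLE.mp hp).1.one_lt
      have : (p : ℝ)⁻¹ < 1 := inv_lt_one_of_one_lt₀ h6
      exact inv_ne_zero (by linarith)
  have h7 : ∑ p ∈ Nat.primesLE N, -Real.log (1 - (p : ℝ)⁻¹) ≤
      ∑ p ∈ Nat.primesLE N, ((1 : ℝ) / p + 2 * (p : ℝ) ^ (-2 : ℝ)) := by
    refine Finset.sum_le_sum fun p hp => ?_
    have h6 : (2 : ℝ) ≤ p := by exact_mod_cast (mem_primesLE.mp hp).1.two_le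
    have h8 : (p : ℝ) ^ (-2 : ℝ) = ((p : ℝ)⁻¹) ^ 2 := by
      rw [Real.rpow_neg (by linarith), inv_pow]; norm_num
    have h9 : (p : ℝ)⁻¹ ≤ 1 / 2 := by
      rw [one_div]; exact inv_anti₀ (by norm_num) h6
    rw [h8, one_div]
    set z := (p : ℝ)⁻¹
    have hz : 0 ≤ z := by positivity
    have h10 := Real.one_sub_inv_le_log_of_pos (x := 1 - z) (by linarith)
    have h11 : (1 - z)⁻¹ ≤ 1 + z + 2 * z ^ 2 := by
      rw [inv_le_iff_one_le_mul₀ (by linarith)]; nlinarith [mul_nonneg hz hz]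
    linarith
  rw [Finset.sum_add_distrib, ← Finset.mul_sum] at h7
  have h14 : ∑ p ∈ Nat.primesLE N, (p : ℝ) ^ (-2 : ℝ) ≤
      ∑' p : Nat.Primes, ((p : ℕ) : ℝ) ^ (-2 : ℝ) := by
    have key : ∀ s : Finset Nat.Primes, ∑ p ∈ s, ((p : ℕ) : ℝ) ^ (-2 : ℝ) ≤
        ∑' p : Nat.Primes, ((p : ℕ) : ℝ) ^ (-2 : ℝ) :=
      fun s => h2.sum_le_tsum s fun p _ => by positivity
    rw [← Finset.sum_subtype_of_mem (f := fun p : ℕ => (p : ℝ) ^ (-2 : ℝ)) (p := Nat.Prime)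
      fun p hp => (mem_primesLE.mp hp).1]
    exact key _
  linarith

/-- `ρ^{Ω(n;R)} ∏_{p ∣ n, p ≤ R} h(p)`. -/
noncomputable def multWeight (ρ : ℝ) (h : ℕ → ℝ) (R : ℝ) (n : ℕ) : ℝ :=
  ρ ^ bigOmega n R * ∏ p ∈ n.primeFactors.filter (fun p : ℕ => (p : ℝ) ≤ R), h p

lemma bigOmega_mul {m n : ℕ} (hm : m ≠ 0) (hn : n ≠ 0) (R : ℝ) :
    bigOmega (m * n) R = bigOmega m R + bigOmega n R := by
  have key : ∀ a : ℕ, a.primeFactors ⊆ (m * n).primeFactors →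
      bigOmega a R = ∑ p ∈ (m * n).primeFactors.filter (fun p : ℕ => (p : ℝ) ≤ R),
        a.factorization p := by
    intro a ha
    refine Finset.sum_subset (Finset.filter_subset_filter _ ha) fun p hp hpa => ?_
    rw [Finset.mem_filter] at hp hpa
    rw [← Finsupp.notMem_support_iff, Nat.support_factorization]
    exact fun h => hpa ⟨h, hp.2⟩
  rw [key m (by rw [Nat.primeFactors_mul hm hn]; exact Finset.subset_union_left),
    key n (by rw [Nat.primeFactors_mul hm hn]; exact Finset.subset_union_right),
    ← Finset.sum_add_distrib, bigOmega, Nat.factorization_mul hm hn]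
  rfl

lemma bigOmega_prime_pow {p : ℕ} (hp : p.Prime) {i : ℕ} (hi : i ≠ 0) (R : ℝ) :
    bigOmega (p ^ i) R = if (p : ℝ) ≤ R then i else 0 := by
  rw [bigOmega, Nat.primeFactors_prime_pow hi hp, Finset.filter_singleton]
  split_ifs <;> simp [hp.factorization_pow]

lemma multWeight_nonneg {ρ : ℝ} (hρ : 0 ≤ ρ) {h : ℕ → ℝ} (h0 : ∀ p, 0 ≤ h p) (R : ℝ) (n : ℕ) :
    0 ≤ multWeight ρ h R n :=
  mul_nonneg (pow_nonneg hρ _) (Finset.prod_nonneg fun p _ => h0 p)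

lemma multWeight_one (ρ : ℝ) (h : ℕ → ℝ) (R : ℝ) : multWeight ρ h R 1 = 1 := by
  simp [multWeight, bigOmega]

lemma multWeight_mul_of_coprime (ρ : ℝ) (h : ℕ → ℝ) (R : ℝ) {m n : ℕ} (hmn : m.Coprime n) :
    multWeight ρ h R (m * n) = multWeight ρ h R m * multWeight ρ h R n := by
  rcases eq_or_ne m 0 with rfl | hm
  · rw [Nat.coprime_zero_left] at hmn
    rw [hmn, mul_one, multWeight_one, mul_one]
  rcases eq_or_ne n 0 with rfl | hn
  · rw [Nat.coprime_zero_right] at hmn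
    rw [hmn, one_mul, multWeight_one, one_mul]
  rw [multWeight, multWeight, multWeight, bigOmega_mul hm hn, pow_add, hmn.primeFactors_mul,
    Finset.filter_union, Finset.prod_union]
  · ring
  · exact Finset.disjoint_filter_filter hmn.disjoint_primeFactors

lemma multWeight_prime_pow (ρ : ℝ) (h : ℕ → ℝ) (R : ℝ) {p : ℕ} (hp : p.Prime) {i : ℕ}
    (hi : i ≠ 0) : multWeight ρ h R (p ^ i) = if (p : ℝ) ≤ R then ρ ^ i * h p else 1 := by
  rw [multWeight, bigOmega_prime_pow hp hi, Nat.primeFactors_prime_pow hi hp,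
    Finset.filter_singleton]
  split_ifs <;> simp

lemma multWeight_prime_pow_mul_le {ρ K : ℝ} (hρ : 1 ≤ ρ) (hK : 1 ≤ K) {h : ℕ → ℝ}
    (h0 : ∀ p, 0 ≤ h p) (hhK : ∀ p, h p ≤ K) (R : ℝ) {p : ℕ} (hp : p.Prime) {i : ℕ}
    (hi : i ≠ 0) {m : ℕ} (hm : m ≠ 0) :
    multWeight ρ h R (p ^ i * m) ≤ K * ρ ^ i * multWeight ρ h R m := by
  have hρi : 1 ≤ ρ ^ i := one_le_pow₀ hρ
  have hg := multWeight_nonneg (by linarith : 0 ≤ ρ) h0 R m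
  by_cases hpm : p ∣ m
  · have e : (p ^ i * m).primeFactors = m.primeFactors := by
      rw [Nat.primeFactors_mul (pow_ne_zero _ hp.ne_zero) hm, Nat.primeFactors_prime_pow hi hp]
      exact Finset.union_eq_right.mpr (Finset.singleton_subset_iff.mpr
        (Nat.mem_primeFactors.mpr ⟨hp, hpm, hm⟩))
    rw [multWeight, e, bigOmega_mul (pow_ne_zero _ hp.ne_zero) hm, pow_add, mul_assoc]
    change _ * multWeight ρ h R m ≤ _
    refine mul_le_mul_of_nonneg_right ?_ hg
    rw [bigOmega_prime_pow hp hi]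
    split_ifs
    · nlinarith
    · rw [pow_zero]; nlinarith
  · have hc : (p ^ i).Coprime m := Nat.Coprime.pow_left i ((Nat.Prime.coprime_iff_not_dvd hp).mpr hpm)
    rw [multWeight_mul_of_coprime _ _ _ hc, multWeight_prime_pow _ _ _ hp hi]
    refine mul_le_mul_of_nonneg_right ?_ hg
    split_ifs
    · rw [mul_comm]
      exact mul_le_mul_of_nonneg_right (hhK p) (by linarith)
    · nlinarith

lemma sum_vonMangoldt_weight_le (y : ℕ) :
    ∑ d ∈ Finset.Icc 1 y, ArithmeticFunction.vonMangoldt d *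
      (if d.Prime then 5 / 4 else (d : ℝ) ^ (1 / 3 : ℝ)) ≤ 14 * y := by
  rcases Nat.eq_zero_or_pos y with rfl | hy
  · simp
  have hy1 : (1 : ℝ) ≤ y := by exact_mod_cast hy
  have hpsi : Chebyshev.psi y = ∑ d ∈ Finset.Icc 1 y, ArithmeticFunction.vonMangoldt d := by
    rw [Chebyshev.psi, Nat.floor_natCast]; rfl
  have hth : Chebyshev.theta y = ∑ d ∈ Finset.Icc 1 y,
      (if d.Prime then ArithmeticFunction.vonMangoldt d else 0) := by
    rw [Chebyshev.theta, Nat.floor_natCast, Finset.sum_filter]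
    refine Finset.sum_congr rfl fun d _ => ?_
    split_ifs with hd
    · rw [ArithmeticFunction.vonMangoldt_apply_prime hd]
    · rfl
  have h1 : ∑ d ∈ Finset.Icc 1 y, ArithmeticFunction.vonMangoldt d *
      (if d.Prime then 5 / 4 else (d : ℝ) ^ (1 / 3 : ℝ)) ≤
      5 / 4 * Chebyshev.theta y + (y : ℝ) ^ (1 / 3 : ℝ) * (Chebyshev.psi y - Chebyshev.theta y) := by
    rw [hpsi, hth, ← Finset.sum_sub_distrib, Finset.mul_sum, Finset.mul_sum,
      ← Finset.sum_add_distrib]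
    refine Finset.sum_le_sum fun d hd => ?_
    rw [Finset.mem_Icc] at hd
    have hΛ := ArithmeticFunction.vonMangoldt_nonneg (n := d)
    split_ifs
    · linarith
    · have : (d : ℝ) ^ (1 / 3 : ℝ) ≤ (y : ℝ) ^ (1 / 3 : ℝ) := by
        apply Real.rpow_le_rpow (by positivity) (by exact_mod_cast hd.2) (by norm_num)
      nlinarith
  have h2 := Chebyshev.theta_le_log4_mul_x (x := y) (by positivity)
  have h3 := Chebyshev.psi_sub_theta_le hy1
  have h4 := Real.log_le_rpow_div (x := y) (ε := 1 / 6) (by positivity) (by norm_num)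
  have h5 : Real.log 4 ≤ 1.6 := by
    have h2 : Real.log 4 = 2 * Real.log 2 := by
      rw [show (4 : ℝ) = 2 ^ 2 by norm_num, Real.log_pow]; norm_num
    have := Real.log_two_lt_d9; linarith
  have h6 : (y : ℝ) ^ (1 / 3 : ℝ) * (Chebyshev.psi y - Chebyshev.theta y) ≤ 12 * y := by
    calc (y : ℝ) ^ (1 / 3 : ℝ) * (Chebyshev.psi y - Chebyshev.theta y)
        ≤ (y : ℝ) ^ (1 / 3 : ℝ) * (2 * √y * ((y : ℝ) ^ (1 / 6 : ℝ) / (1 / 6))) := by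
          refine mul_le_mul_of_nonneg_left (h3.trans ?_) (by positivity)
          gcongr
      _ = 12 * ((y : ℝ) ^ (1 / 3 : ℝ) * (y : ℝ) ^ (1 / 2 : ℝ) * (y : ℝ) ^ (1 / 6 : ℝ)) := by
          rw [Real.sqrt_eq_rpow]; ring
      _ = 12 * y := by
          rw [← Real.rpow_add (by linarith), ← Real.rpow_add (by linarith)]; norm_num
  nlinarith

lemma pow_le_rpow_third {ρ : ℝ} (h1 : 1 ≤ ρ) (h2 : ρ ≤ 5 / 4) {p : ℕ} (hp : 2 ≤ p) (i : ℕ) :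
    ρ ^ i ≤ ((p ^ i : ℕ) : ℝ) ^ (1 / 3 : ℝ) := by
  have hp' : (2 : ℝ) ≤ p := by exact_mod_cast hp
  have h : ρ ≤ (p : ℝ) ^ (1 / 3 : ℝ) := by
    have h3 : ρ ^ 3 ≤ p := by
      have : ρ ^ 3 ≤ (5 / 4) ^ 3 := by gcongr
      norm_num at this; linarith
    calc ρ = (ρ ^ 3) ^ (1 / 3 : ℝ) := by
          rw [← Real.rpow_natCast, ← Real.rpow_mul (by linarith)]; norm_num
      _ ≤ _ := Real.rpow_le_rpow (by positivity) h3 (by norm_num)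
  calc ρ ^ i ≤ ((p : ℝ) ^ (1 / 3 : ℝ)) ^ i := by gcongr
    _ = _ := by
      push_cast
      rw [← Real.rpow_natCast, ← Real.rpow_mul (by linarith), mul_comm,
        Real.rpow_mul (by linarith), Real.rpow_natCast]

lemma sum_multWeight_mul_log_le {ρ K : ℝ} (hρ : 1 ≤ ρ) (hρ2 : ρ ≤ 5 / 4) (hK : 1 ≤ K)
    {h : ℕ → ℝ} (h0 : ∀ p, 0 ≤ h p) (hhK : ∀ p, h p ≤ K) (R : ℝ) {N : ℕ} (hN : 1 ≤ N) :
    Real.log N * ∑ n ∈ Finset.Icc 1 N, multWeight ρ h R n ≤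
      15 * K * N * ∑ n ∈ Finset.Icc 1 N, multWeight ρ h R n / n := by
  have hg := multWeight_nonneg (by linarith : 0 ≤ ρ) h0 R
  have hN' : (0 : ℝ) < N := by exact_mod_cast hN
  have h1 : ∑ n ∈ Finset.Icc 1 N, multWeight ρ h R n * Real.log n ≤
      ∑ m ∈ Finset.Icc 1 N, 14 * K * N * (multWeight ρ h R m / m) := by
    rw [sum_mul_log_eq]
    refine Finset.sum_le_sum fun m hm => ?_
    rw [Finset.mem_Icc] at hm
    have hm0 : m ≠ 0 := by omega
    have hm' : (0 : ℝ) < m := by exact_mod_cast hm.1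
    have h2 : ∑ d ∈ Finset.Icc 1 (N / m), ArithmeticFunction.vonMangoldt d *
        multWeight ρ h R (d * m) ≤ ∑ d ∈ Finset.Icc 1 (N / m), K * multWeight ρ h R m *
          (ArithmeticFunction.vonMangoldt d *
            (if d.Prime then 5 / 4 else (d : ℝ) ^ (1 / 3 : ℝ))) := by
      refine Finset.sum_le_sum fun d _ => ?_
      by_cases hd : IsPrimePow d
      · rw [isPrimePow_nat_iff] at hd
        obtain ⟨p, i, hp, hi, rfl⟩ := hd
        have h3 := multWeight_prime_pow_mul_le hρ hK h0 hhK R hp hi.ne' hm0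
        have h4 : ρ ^ i ≤ if (p ^ i).Prime then 5 / 4 else ((p ^ i : ℕ) : ℝ) ^ (1 / 3 : ℝ) := by
          split_ifs with hpi
          · have : i = 1 := by
              by_contra hne
              exact Nat.Prime.not_prime_pow (by omega) hpi
            rw [this, pow_one]; exact hρ2
          · exact pow_le_rpow_third hρ hρ2 hp.two_le i
        calc _ ≤ ArithmeticFunction.vonMangoldt (p ^ i) * (K * (if (p ^ i).Prime then 5 / 4 else
              ((p ^ i : ℕ) : ℝ) ^ (1 / 3 : ℝ)) * multWeight ρ h R m) := by
              refine mul_le_mul_of_nonneg_left (h3.trans ?_) ArithmeticFunction.vonMangoldt_nonneg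
              refine mul_le_mul_of_nonneg_right ?_ (hg m)
              exact mul_le_mul_of_nonneg_left h4 (by linarith)
          _ = _ := by ring
      · rw [ArithmeticFunction.vonMangoldt_eq_zero_iff.mpr hd]; simp
    rw [← Finset.mul_sum] at h2
    refine h2.trans ?_
    calc K * multWeight ρ h R m * _ ≤ K * multWeight ρ h R m * (14 * (N / m : ℕ)) :=
          mul_le_mul_of_nonneg_left (sum_vonMangoldt_weight_le _) (mul_nonneg (by linarith) (hg m))
      _ ≤ K * multWeight ρ h R m * (14 * (N / m)) := by
          refine mul_le_mul_of_nonneg_left ?_ (mul_nonneg (by linarith) (hg m))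
          have : ((N / m : ℕ) : ℝ) ≤ N / m := Nat.cast_div_le
          linarith
      _ = _ := by ring
  have h5 : Real.log N * ∑ n ∈ Finset.Icc 1 N, multWeight ρ h R n ≤
      ∑ n ∈ Finset.Icc 1 N, (N * (multWeight ρ h R n / n) + multWeight ρ h R n * Real.log n) := by
    rw [Finset.mul_sum]
    refine Finset.sum_le_sum fun n hn => ?_
    rw [Finset.mem_Icc] at hn
    have hn' : (0 : ℝ) < n := by exact_mod_cast hn.1
    have h6 : Real.log N - Real.log n ≤ N / n := by
      rw [← Real.log_div hN'.ne' hn'.ne']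
      exact Real.log_le_self (by positivity)
    have h7 : (Real.log N - Real.log n) * multWeight ρ h R n ≤ N / n * multWeight ρ h R n :=
      mul_le_mul_of_nonneg_right h6 (hg n)
    have h8 : (N : ℝ) / n * multWeight ρ h R n = N * (multWeight ρ h R n / n) := by ring
    linarith
  rw [Finset.sum_add_distrib, ← Finset.mul_sum] at h5
  rw [← Finset.mul_sum] at h1
  have h9 : 0 ≤ ∑ n ∈ Finset.Icc 1 N, multWeight ρ h R n / n :=
    Finset.sum_nonneg fun n _ => div_nonneg (hg n) (by positivity)
  have h10 : (N : ℝ) * ∑ n ∈ Finset.Icc 1 N, multWeight ρ h R n / n ≤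
      K * (N * ∑ n ∈ Finset.Icc 1 N, multWeight ρ h R n / n) :=
    le_mul_of_one_le_left (by positivity) hK
  linarith

lemma multWeight_prime_pow_le {ρ K : ℝ} (hρ : 1 ≤ ρ) (hK : 1 ≤ K) {h : ℕ → ℝ}
    (h0 : ∀ p, 0 ≤ h p) (hhK : ∀ p, h p ≤ K) (R : ℝ) {p : ℕ} (hp : p.Prime) {i : ℕ}
    (hi : i ≠ 0) : multWeight ρ h R (p ^ i) ≤ K * ρ ^ i := by
  simpa [multWeight_one] using multWeight_prime_pow_mul_le hρ hK h0 hhK R hp hi one_ne_zero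

lemma hasSum_prime_pow_bound {ρ K : ℝ} (hρ : 1 ≤ ρ) (hρ2 : ρ ≤ 5 / 4) (hK : 1 ≤ K) {h : ℕ → ℝ}
    (h0 : ∀ p, 0 ≤ h p) (hhK : ∀ p, h p ≤ K) (R : ℝ) {p : ℕ} (hp : p.Prime) :
    Summable (fun n : ℕ => multWeight ρ h R (p ^ n) / ((p ^ n : ℕ) : ℝ)) ∧
    ∑' n : ℕ, multWeight ρ h R (p ^ n) / ((p ^ n : ℕ) : ℝ) ≤
      1 + multWeight ρ h R p / p + 5 * K * (p : ℝ) ^ (-2 : ℝ) := by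
  have hp2 : (2 : ℝ) ≤ p := by exact_mod_cast hp.two_le
  have hg := multWeight_nonneg (by linarith : 0 ≤ ρ) h0 R
  set x : ℝ := ρ / p with hx
  have hx0 : 0 ≤ x := by positivity
  have hx1 : x ≤ 5 / 8 := by
    rw [hx, div_le_iff₀ (by linarith)]; linarith
  have hgeo := hasSum_geometric_of_lt_one hx0 (by linarith)
  have hle : ∀ n : ℕ, multWeight ρ h R (p ^ (n + 1)) / ((p ^ (n + 1) : ℕ) : ℝ) ≤ K * x * x ^ n := by
    intro n
    have h1 := multWeight_prime_pow_le hρ hK h0 hhK R hp (Nat.succ_ne_zero n)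
    calc _ ≤ K * ρ ^ (n + 1) / ((p ^ (n + 1) : ℕ) : ℝ) := by gcongr
      _ = _ := by push_cast; rw [hx, pow_succ, pow_succ, div_pow]; field_simp
  have hs1 : Summable (fun n : ℕ => multWeight ρ h R (p ^ (n + 1)) / ((p ^ (n + 1) : ℕ) : ℝ)) :=
    Summable.of_nonneg_of_le (fun n => div_nonneg (hg _) (by positivity)) hle
      (hgeo.summable.mul_left _)
  have hs : Summable (fun n : ℕ => multWeight ρ h R (p ^ n) / ((p ^ n : ℕ) : ℝ)) :=
    (summable_nat_add_iff 1).mp hs1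
  refine ⟨hs, ?_⟩
  rw [hs.tsum_eq_zero_add, hs1.tsum_eq_zero_add]
  simp only [pow_zero, zero_add, pow_one, multWeight_one, Nat.cast_one, div_one]
  have h2 : ∑' n : ℕ, multWeight ρ h R (p ^ (n + 1 + 1)) / ((p ^ (n + 1 + 1) : ℕ) : ℝ) ≤
      K * x ^ 2 * (1 - x)⁻¹ := by
    rw [← hgeo.tsum_eq, ← tsum_mul_left]
    refine Summable.tsum_le_tsum (fun n => ?_) ((summable_nat_add_iff 1).mpr hs1)
      (hgeo.summable.mul_left _)
    refine (hle (n + 1)).trans (le_of_eq ?_)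
    ring
  have h3 : (1 - x)⁻¹ ≤ 8 / 3 := by
    rw [inv_le_comm₀ (by linarith) (by norm_num)]; norm_num; linarith
  have h4 : x ^ 2 ≤ 25 / 16 * (p : ℝ) ^ (-2 : ℝ) := by
    rw [Real.rpow_neg (by linarith), Real.rpow_two, hx, div_pow, div_eq_mul_inv]
    gcongr
    nlinarith
  have h5 : K * x ^ 2 * (1 - x)⁻¹ ≤ K * (25 / 16 * (p : ℝ) ^ (-2 : ℝ)) * (8 / 3) := by
    gcongr
    have : 0 < 1 - x := by linarith
    positivity
  have h6 : 0 ≤ K * (p : ℝ) ^ (-2 : ℝ) := by positivity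
  nlinarith

lemma exists_sum_multWeight_div_le : ∃ c : ℝ, 0 ≤ c ∧ ∀ (ρ K : ℝ) (h : ℕ → ℝ) (R : ℝ) (N : ℕ),
    1 ≤ ρ → ρ ≤ 5 / 4 → 1 ≤ K → (∀ p, 0 ≤ h p) → (∀ p, h p ≤ K) →
    ∑ n ∈ Finset.Icc 1 N, multWeight ρ h R n / n ≤
      Real.exp (∑ p ∈ Nat.primesLE N, multWeight ρ h R p / p + c * K) := by
  have h2 := summable_primes_rpow (σ := 2) (by norm_num)
  refine ⟨5 * ∑' p : Nat.Primes, ((p : ℕ) : ℝ) ^ (-2 : ℝ),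
    mul_nonneg (by norm_num) (tsum_nonneg fun p => by positivity), ?_⟩
  intro ρ K h R N hρ hρ2 hK h0 hhK
  have hg := multWeight_nonneg (by linarith : 0 ≤ ρ) h0 R
  have hb := fun {p : ℕ} (hp : p.Prime) => hasSum_prime_pow_bound hρ hρ2 hK h0 hhK R hp
  have hE := EulerProduct.summable_and_hasSum_smoothNumbers_prod_primesBelow_tsum
    (f := fun n : ℕ => multWeight ρ h R n / (n : ℝ)) (by simp [multWeight_one])
    (fun {m n} hmn => by
      simp only [multWeight_mul_of_coprime ρ h R hmn, Nat.cast_mul]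
      rw [mul_div_mul_comm])
    (fun {p} hp => (hb hp).1.norm) (N + 1)
  have h3 : ∑ n ∈ Finset.Icc 1 N, multWeight ρ h R n / n ≤
      ∏ p ∈ Nat.primesLE N, ∑' n : ℕ, multWeight ρ h R (p ^ n) / ((p ^ n : ℕ) : ℝ) := by
    have hmem : ∀ n ∈ Finset.Icc 1 N, n ∈ (N + 1).smoothNumbers := by
      intro n hn
      rw [Finset.mem_Icc] at hn
      exact Nat.mem_smoothNumbers_of_lt hn.1 (by omega)
    have h4 := hE.2.summable.sum_le_tsum ((Finset.Icc 1 N).subtype (· ∈ (N + 1).smoothNumbers))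
      (fun i _ => div_nonneg (hg _) (by positivity))
    rw [hE.2.tsum_eq] at h4
    refine le_trans (le_of_eq ?_) h4
    rw [Finset.sum_subtype_of_mem (f := fun n : ℕ => multWeight ρ h R n / (n : ℝ)) hmem]
  refine h3.trans ?_
  have h5 : ∏ p ∈ Nat.primesLE N, ∑' n : ℕ, multWeight ρ h R (p ^ n) / ((p ^ n : ℕ) : ℝ) ≤
      ∏ p ∈ Nat.primesLE N, Real.exp (multWeight ρ h R p / p + 5 * K * (p : ℝ) ^ (-2 : ℝ)) := by
    refine Finset.prod_le_prod (fun p _ => tsum_nonneg fun n => div_nonneg (hg _) (by positivity))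
      fun p hp => ?_
    refine (hb (mem_primesLE.mp hp).1).2.trans ?_
    have := Real.add_one_le_exp (multWeight ρ h R p / p + 5 * K * (p : ℝ) ^ (-2 : ℝ))
    linarith
  refine h5.trans ?_
  rw [← Real.exp_sum, Finset.sum_add_distrib, ← Finset.mul_sum]
  have key : ∀ s : Finset Nat.Primes, ∑ p ∈ s, ((p : ℕ) : ℝ) ^ (-2 : ℝ) ≤
      ∑' p : Nat.Primes, ((p : ℕ) : ℝ) ^ (-2 : ℝ) :=
    fun s => h2.sum_le_tsum s fun p _ => by positivity
  have h14 : ∑ p ∈ Nat.primesLE N, (p : ℝ) ^ (-2 : ℝ) ≤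
      ∑' p : Nat.Primes, ((p : ℕ) : ℝ) ^ (-2 : ℝ) := by
    rw [← Finset.sum_subtype_of_mem (f := fun p : ℕ => (p : ℝ) ^ (-2 : ℝ)) (p := Nat.Prime)
      fun p hp => (mem_primesLE.mp hp).1]
    exact key _
  apply Real.exp_le_exp.mpr
  have : 5 * K * ∑ p ∈ Nat.primesLE N, (p : ℝ) ^ (-2 : ℝ) ≤
    5 * K * ∑' p : Nat.Primes, ((p : ℕ) : ℝ) ^ (-2 : ℝ) := by gcongr
  linarith

/-- Hall–Tenenbaum type mean value bound for `multWeight`. -/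
lemma exists_sum_multWeight_le (K : ℝ) (hK : 1 ≤ K) : ∃ C : ℝ, 0 < C ∧
    ∀ (ρ : ℝ) (h : ℕ → ℝ) (x R : ℝ), 1 ≤ ρ → ρ ≤ 5 / 4 → (∀ p, 0 ≤ h p) → (∀ p, h p ≤ K) →
      2 ≤ R → R ≤ x →
      ∑ n ∈ Finset.Icc 1 ⌊x⌋₊, multWeight ρ h R n ≤
        C * (x / Real.log R) * Real.exp (ρ * ∑ p ∈ Nat.primesLE ⌊R⌋₊, h p / p) := by
  obtain ⟨c, hc, hsum⟩ := exists_sum_multWeight_div_le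
  obtain ⟨C₁, hC₁⟩ := exists_sum_inv_primesLE_le
  obtain ⟨C₂, hC₂⟩ := exists_le_sum_inv_primesLE
  refine ⟨30 * K * Real.exp (C₁ + C₂ + c * K), by positivity, ?_⟩
  intro ρ h x R hρ hρ2 h0 hhK hR hRx
  have hx : 2 ≤ x := hR.trans hRx
  set N := ⌊x⌋₊ with hN
  have hN2 : 2 ≤ N := Nat.le_floor (by exact_mod_cast hx)
  have hN2' : (2 : ℝ) ≤ N := by exact_mod_cast hN2
  have hNx : (N : ℝ) ≤ x := Nat.floor_le (by linarith)
  have hxN : x < N + 1 := Nat.lt_floor_add_one x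
  have hlogR : 0 < Real.log R := Real.log_pos (by linarith)
  have hlogx : 0 < Real.log x := Real.log_pos (by linarith)
  have hlogN : Real.log x ≤ 2 * Real.log N := by
    have : Real.log x ≤ Real.log ((N : ℝ) ^ 2) := Real.log_le_log (by linarith) (by nlinarith)
    rwa [Real.log_pow, Nat.cast_ofNat] at this
  have h1 := sum_multWeight_mul_log_le hρ hρ2 hK h0 hhK R (N := N) (by omega)
  have h2 := hsum ρ K h R N hρ hρ2 hK h0 hhK
  have h3 : ∑ p ∈ Nat.primesLE N, multWeight ρ h R p / p ≤
      ρ * ∑ p ∈ Nat.primesLE ⌊R⌋₊, h p / p + (Real.log (Real.log x) + C₁)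
        - (Real.log (Real.log R) - C₂) := by
    have hsub : Nat.primesLE ⌊R⌋₊ ⊆ Nat.primesLE N := by
      intro p hp
      rw [mem_primesLE] at hp ⊢
      exact ⟨hp.1, hp.2.trans (Nat.floor_mono hRx)⟩
    have e1 : ∑ p ∈ Nat.primesLE ⌊R⌋₊, multWeight ρ h R p / p =
        ρ * ∑ p ∈ Nat.primesLE ⌊R⌋₊, h p / p := by
      rw [Finset.mul_sum]
      refine Finset.sum_congr rfl fun p hp => ?_
      rw [mem_primesLE] at hp
      have := multWeight_prime_pow ρ h R hp.1 one_ne_zero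
      rw [pow_one, if_pos ((Nat.le_floor_iff (by linarith)).mp hp.2), pow_one] at this
      rw [this]; ring
    have e2 : ∑ p ∈ Nat.primesLE N \ Nat.primesLE ⌊R⌋₊, multWeight ρ h R p / p =
        ∑ p ∈ Nat.primesLE N \ Nat.primesLE ⌊R⌋₊, (1 : ℝ) / p := by
      refine Finset.sum_congr rfl fun p hp => ?_
      rw [Finset.mem_sdiff, mem_primesLE, mem_primesLE] at hp
      have := multWeight_prime_pow ρ h R hp.1.1 one_ne_zero
      rw [pow_one, if_neg] at this
      · rw [this]
      · intro hpR
        exact hp.2 ⟨hp.1.1, Nat.le_floor hpR⟩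
    have e3 := Finset.sum_sdiff (f := fun p : ℕ => multWeight ρ h R p / (p : ℝ)) hsub
    have e4 := Finset.sum_sdiff (f := fun p : ℕ => (1 : ℝ) / p) hsub
    have e5 := hC₁ x hx
    have e6 := hC₂ R hR
    rw [← hN] at e5
    linarith
  have h4 : Real.exp (∑ p ∈ Nat.primesLE N, multWeight ρ h R p / p + c * K) ≤
      Real.exp (ρ * ∑ p ∈ Nat.primesLE ⌊R⌋₊, h p / p) * (Real.log x / Real.log R) *
        Real.exp (C₁ + C₂ + c * K) := by
    rw [← Real.exp_log (show 0 < Real.log x / Real.log R by positivity),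
      Real.log_div hlogx.ne' hlogR.ne', ← Real.exp_add, ← Real.exp_add]
    apply Real.exp_le_exp.mpr
    linarith
  set S := ∑ n ∈ Finset.Icc 1 N, multWeight ρ h R n with hS
  set E := Real.exp (ρ * ∑ p ∈ Nat.primesLE ⌊R⌋₊, h p / p) with hE
  set F := Real.exp (C₁ + C₂ + c * K) with hF
  have hS0 : 0 ≤ S := Finset.sum_nonneg fun n _ => multWeight_nonneg (by linarith) h0 R n
  have h5 : Real.log x * S ≤ Real.log x * (30 * K * F * (x / Real.log R) * E) := by
    calc Real.log x * S ≤ 2 * (Real.log N * S) := by nlinarith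
      _ ≤ 2 * (15 * K * N * (E * (Real.log x / Real.log R) * F)) := by
          refine mul_le_mul_of_nonneg_left (h1.trans ?_) (by norm_num)
          exact mul_le_mul_of_nonneg_left (h2.trans h4) (by positivity)
      _ ≤ 2 * (15 * K * x * (E * (Real.log x / Real.log R) * F)) := by gcongr
      _ = _ := by ring
  exact le_of_mul_le_mul_left h5 hlogx

lemma two_sub_two_cos_pow_eq_sum (m : ℕ) (φ : ℝ) :
    (2 - 2 * Real.cos φ) ^ m = ∑ j ∈ Finset.range (2 * m + 1),
      ((-1) ^ (m + j) * ((2 * m).choose j : ℝ)) * Real.cos (((j : ℝ) - m) * φ) := by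
  have e0 : Complex.exp (-(φ * Complex.I)) * Complex.exp (φ * Complex.I) = 1 := by
    rw [← Complex.exp_add]; simp
  have e1 : (2 - 2 * Complex.cos φ) =
      -(Complex.exp (-(φ * Complex.I)) * (-Complex.exp (φ * Complex.I) + 1) ^ 2) := by
    rw [Complex.cos, neg_mul]
    linear_combination (-2 + Complex.exp (φ * Complex.I)) * e0
  have e2 : (2 - 2 * Complex.cos φ) ^ m = ∑ j ∈ Finset.range (2 * m + 1),
      (((-1) ^ (m + j) * ((2 * m).choose j : ℝ) : ℝ) : ℂ) *
        Complex.exp (((((j : ℝ) - m) * φ : ℝ) : ℂ) * Complex.I) := by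
    rw [e1, neg_pow, mul_pow, ← pow_mul, add_pow, Finset.mul_sum, Finset.mul_sum]
    refine Finset.sum_congr rfl fun j _ => ?_
    have : Complex.exp (((((j : ℝ) - m) * φ : ℝ) : ℂ) * Complex.I) =
        Complex.exp (-(φ * Complex.I)) ^ m * Complex.exp (φ * Complex.I) ^ j := by
      rw [← Complex.exp_nat_mul, ← Complex.exp_nat_mul, ← Complex.exp_add]
      congr 1
      push_cast
      ring
    rw [this, neg_pow (Complex.exp (φ * Complex.I))]
    push_cast
    ring
  have e3 := congrArg Complex.re e2
  rw [Complex.re_sum] at e3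
  have e4 : ((2 - 2 * Complex.cos φ) ^ m).re = (2 - 2 * Real.cos φ) ^ m := by
    rw [← Complex.ofReal_re ((2 - 2 * Real.cos φ) ^ m)]
    congr 1
    push_cast
    rfl
  rw [← e4, e3]
  refine Finset.sum_congr rfl fun j _ => ?_
  rw [Complex.re_ofReal_mul, Complex.exp_ofReal_mul_I_re]

lemma pair_cos_expansion (m : ℕ) (θ φ : ℝ) :
    (2 - 2 * Real.cos θ) * (2 - 2 * Real.cos φ) ^ m = ∑ j ∈ Finset.range (2 * m + 1),
      ((-1) ^ (m + j) * ((2 * m).choose j : ℝ)) *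
        (2 * Real.cos (((j : ℝ) - m) * φ) - Real.cos (((j : ℝ) - m) * φ + θ)
          - Real.cos (((j : ℝ) - m) * φ - θ)) := by
  rw [two_sub_two_cos_pow_eq_sum, Finset.mul_sum]
  refine Finset.sum_congr rfl fun j _ => ?_
  rw [Real.cos_add, Real.cos_sub]
  ring

/-- `|1 - p^{-(1+it)/L}|²`. -/
noncomputable def eulerFactorSq (L t : ℝ) (p : ℕ) : ℝ :=
  1 - 2 * Real.exp (-(Real.log p / L)) * Real.cos (t * Real.log p / L)
    + Real.exp (-(Real.log p / L)) ^ 2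

lemma eulerFactorSq_nonneg (L t : ℝ) (p : ℕ) : 0 ≤ eulerFactorSq L t p := by
  have h1 := Real.sin_sq_add_cos_sq (t * Real.log p / L)
  have : eulerFactorSq L t p =
      (1 - Real.exp (-(Real.log p / L)) * Real.cos (t * Real.log p / L)) ^ 2
      + (Real.exp (-(Real.log p / L)) * Real.sin (t * Real.log p / L)) ^ 2 := by
    rw [eulerFactorSq]
    linear_combination (-Real.exp (-(Real.log p / L)) ^ 2) * h1
  rw [this]
  positivity

lemma exp_neg_log_div_mem {L : ℝ} (hL : 0 < L) (p : ℕ) :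
    0 < Real.exp (-(Real.log p / L)) ∧ Real.exp (-(Real.log p / L)) ≤ 1 := by
  refine ⟨Real.exp_pos _, Real.exp_le_one_iff.mpr ?_⟩
  have := Real.log_natCast_nonneg p
  simp only [Left.neg_nonpos_iff]
  positivity

lemma eulerFactorSq_le {L : ℝ} (hL : 0 < L) (t : ℝ) (p : ℕ) : eulerFactorSq L t p ≤ 4 := by
  obtain ⟨h0, h1⟩ := exp_neg_log_div_mem hL p
  rw [eulerFactorSq]
  nlinarith [Real.neg_one_le_cos (t * Real.log p / L)]

lemma eulerFactorSq_le_add {L : ℝ} (hL : 0 < L) (t : ℝ) (p : ℕ) :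
    eulerFactorSq L t p ≤ 2 - 2 * Real.cos (t * Real.log p / L) + 4 * (Real.log p / L) := by
  obtain ⟨h0, h1⟩ := exp_neg_log_div_mem hL p
  have h2 := Real.add_one_le_exp (-(Real.log p / L))
  have h3 : 0 ≤ Real.log p / L := div_nonneg (Real.log_natCast_nonneg p) hL.le
  rw [eulerFactorSq]
  nlinarith [Real.cos_le_one (t * Real.log p / L)]

lemma pow_le_pow_add_mul {a b d : ℝ} (ha : 0 ≤ a) (hb : 0 ≤ b) (ha4 : a ≤ 4) (hb4 : b ≤ 4)
    (hd : 0 ≤ d) (hab : a ≤ b + d) (m : ℕ) : a ^ m ≤ b ^ m + m * 4 ^ m * d := by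
  induction m with
  | zero => simp
  | succ m ih =>
    have h1 : b ^ m ≤ 4 ^ m := pow_le_pow_left₀ hb hb4 m
    have h2 : 0 ≤ b ^ m := by positivity
    have h3 : (0 : ℝ) ≤ m * 4 ^ m * d := by positivity
    calc a ^ (m + 1) = a ^ m * a := pow_succ _ _
      _ ≤ (b ^ m + m * 4 ^ m * d) * a := by gcongr
      _ = b ^ m * a + m * 4 ^ m * d * a := by ring
      _ ≤ b ^ m * (b + d) + m * 4 ^ m * d * 4 := by gcongr
      _ = b ^ (m + 1) + b ^ m * d + m * 4 ^ (m + 1) * d := by ring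
      _ ≤ b ^ (m + 1) + 4 ^ m * d + m * 4 ^ (m + 1) * d := by gcongr
      _ ≤ b ^ (m + 1) + 4 ^ (m + 1) * d + m * 4 ^ (m + 1) * d := by gcongr <;> norm_num
      _ = _ := by push_cast; ring

lemma pair_factor_le {L : ℝ} (hL : 0 < L) (m : ℕ) (t s : ℝ) (p : ℕ) :
    eulerFactorSq L t p * eulerFactorSq L s p ^ m ≤
      (2 - 2 * Real.cos (t * Real.log p / L)) * (2 - 2 * Real.cos (s * Real.log p / L)) ^ m
        + 4 ^ (m + 2) * (m + 1) * (Real.log p / L) := by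
  set a := eulerFactorSq L t p
  set b := eulerFactorSq L s p
  set a' := 2 - 2 * Real.cos (t * Real.log p / L)
  set b' := 2 - 2 * Real.cos (s * Real.log p / L)
  have hd : 0 ≤ Real.log p / L := div_nonneg (Real.log_natCast_nonneg p) hL.le
  have ha' : 0 ≤ a' := by have := Real.cos_le_one (t * Real.log p / L); simp only [a']; linarith
  have ha4 : a' ≤ 4 := by have := Real.neg_one_le_cos (t * Real.log p / L); simp only [a']; linarith
  have hb' : 0 ≤ b' := by have := Real.cos_le_one (s * Real.log p / L); simp only [b']; linarith
  have hb4 : b' ≤ 4 := by have := Real.neg_one_le_cos (s * Real.log p / L); simp only [b']; linarith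
  have h1 := pow_le_pow_add_mul (eulerFactorSq_nonneg L s p) hb' (eulerFactorSq_le hL s p) hb4
    (by positivity) (eulerFactorSq_le_add hL s p) m
  have hb0 : b ^ m ≤ 4 ^ m := pow_le_pow_left₀ (eulerFactorSq_nonneg L s p) (eulerFactorSq_le hL s p) m
  have hbn : 0 ≤ b ^ m := pow_nonneg (eulerFactorSq_nonneg L s p) m
  calc a * b ^ m ≤ (a' + 4 * (Real.log p / L)) * b ^ m := by
        gcongr; exact eulerFactorSq_le_add hL t p
    _ = a' * b ^ m + 4 * (Real.log p / L) * b ^ m := by ring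
    _ ≤ a' * (b' ^ m + m * 4 ^ m * (4 * (Real.log p / L))) + 4 * (Real.log p / L) * 4 ^ m := by
        gcongr
    _ = a' * b' ^ m + a' * (m * 4 ^ m * (4 * (Real.log p / L)))
        + 4 * (Real.log p / L) * 4 ^ m := by ring
    _ ≤ a' * b' ^ m + 4 * (m * 4 ^ m * (4 * (Real.log p / L)))
        + 4 * (4 * (Real.log p / L) * 4 ^ m) := by
        have : 0 ≤ 4 * (Real.log p / L) * 4 ^ m := by positivity
        have : a' * (m * 4 ^ m * (4 * (Real.log p / L))) ≤
          4 * (m * 4 ^ m * (4 * (Real.log p / L))) := by gcongr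
        linarith
    _ = _ := by ring

lemma exists_primeCosSum_bounds_of_le {ε N : ℝ} (hε : 0 < ε) (hN : 1 ≤ N) :
    ∃ C : ℝ, 0 ≤ C ∧ ∀ L T l : ℝ, Real.log 2 ≤ L → 1 ≤ T → |l| ≤ N * T →
    Real.log L - Real.log (min T L) - ε * Real.log T - C ≤ primeCosSum (1 + 1 / L) (l / L) ∧
    primeCosSum (1 + 1 / L) (l / L) ≤
      Real.log L - Real.log (min T L) + (Real.log T - Real.log (1 + |l|)) + ε * Real.log T + C := by
  obtain ⟨C, hC, h⟩ := exists_primeCosSum_bounds hε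
  have hlogN := Real.log_nonneg hN
  refine ⟨C + (1 + ε) * Real.log N, by positivity, fun L T l hL hT hl => ?_⟩
  have hL0 : 0 < L := (by norm_num : (0 : ℝ) < 0.69).trans (log_two_gt.trans_le hL)
  have hNT : 1 ≤ N * T := one_le_mul_of_one_le_of_one_le hN hT
  obtain ⟨h1, h2⟩ := h L (N * T) l hL hNT (by linarith [abs_nonneg l])
  have hm : 0 < min T L := lt_min (by linarith) hL0
  have e1 : Real.log (min (N * T) L) ≤ Real.log N + Real.log (min T L) := by
    rw [← Real.log_mul (by linarith) hm.ne']
    apply Real.log_le_log (lt_min (by linarith) hL0)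
    rcases le_total T L with hTL | hTL
    · rw [min_eq_left hTL]; exact min_le_left _ _
    · rw [min_eq_right hTL]; exact (min_le_right _ _).trans (le_mul_of_one_le_left hL0.le hN)
  have e2 : Real.log (min T L) ≤ Real.log (min (N * T) L) := by
    apply Real.log_le_log hm
    exact min_le_min_right _ (le_mul_of_one_le_left (by linarith) hN)
  rw [Real.log_mul (by linarith) (by linarith)] at h1 h2
  constructor <;> linarith

lemma tsum_pair_eq {L : ℝ} (hL : 0 < L) (m : ℕ) (t s : ℝ) :
    ∑' p : Nat.Primes, ((2 - 2 * Real.cos (t * Real.log p / L)) *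
        (2 - 2 * Real.cos (s * Real.log p / L)) ^ m) * ((p : ℕ) : ℝ) ^ (-(1 + 1 / L)) =
      ∑ j ∈ Finset.range (2 * m + 1), ((-1) ^ (m + j) * ((2 * m).choose j : ℝ)) *
        (2 * primeCosSum (1 + 1 / L) (((j : ℝ) - m) * s / L)
          - primeCosSum (1 + 1 / L) ((((j : ℝ) - m) * s + t) / L)
          - primeCosSum (1 + 1 / L) ((((j : ℝ) - m) * s - t) / L)) := by
  have hσ : 1 < 1 + 1 / L := by have : 0 < 1 / L := by positivity
                                linarith
  have hs := fun l : ℝ => (summable_primes_cos hσ l).hasSum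
  have key := hasSum_sum (s := Finset.range (2 * m + 1)) fun j _ =>
    ((((hs (((j : ℝ) - m) * s / L)).mul_left 2).sub (hs ((((j : ℝ) - m) * s + t) / L))).sub
      (hs ((((j : ℝ) - m) * s - t) / L))).mul_left ((-1) ^ (m + j) * ((2 * m).choose j : ℝ))
  rw [show (∑ j ∈ Finset.range (2 * m + 1), ((-1) ^ (m + j) * ((2 * m).choose j : ℝ)) *
        (2 * primeCosSum (1 + 1 / L) (((j : ℝ) - m) * s / L)
          - primeCosSum (1 + 1 / L) ((((j : ℝ) - m) * s + t) / L)
          - primeCosSum (1 + 1 / L) ((((j : ℝ) - m) * s - t) / L))) = _ from key.tsum_eq.symm]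
  refine tsum_congr fun p => ?_
  rw [pair_cos_expansion, Finset.sum_mul]
  refine Finset.sum_congr rfl fun j _ => ?_
  rw [show ((j : ℝ) - m) * (s * Real.log p / L) = ((j : ℝ) - m) * s / L * Real.log p by ring,
    show ((j : ℝ) - m) * s / L * Real.log p + t * Real.log p / L
      = (((j : ℝ) - m) * s + t) / L * Real.log p by ring,
    show ((j : ℝ) - m) * s / L * Real.log p - t * Real.log p / L
      = (((j : ℝ) - m) * s - t) / L * Real.log p by ring]
  ring

/-- The contribution of one frequency to the correlation of two Euler factors. -/
lemma pair_term_le {c : ℝ → ℝ} {M E T s t : ℝ} {m j : ℕ} (hj : j < 2 * m + 1)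
    (hT : 1 ≤ T) (hs1 : T - 1 ≤ s) (hs0 : 0 ≤ s) (hs2 : s ≤ 2 * T - 1) (ht1 : T - 1 ≤ t) (ht0 : 0 ≤ t)
    (ht2 : t ≤ 2 * T - 1)
    (hc : ∀ l : ℝ, |l| ≤ 2 * (m + 1) * T → M - E ≤ c l ∧
      c l ≤ M + (Real.log T - Real.log (1 + |l|)) + E) :
    ((-1) ^ (m + j) * ((2 * m).choose j : ℝ)) *
        (2 * c (((j : ℝ) - m) * s) - c (((j : ℝ) - m) * s + t) - c (((j : ℝ) - m) * s - t)) ≤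
      (if j = m then 2 * ((2 * m).choose m : ℝ) * Real.log T else 0) +
      (if j = m + 1 ∨ j + 1 = m then ((2 * m).choose (m + 1) : ℝ) *
        (Real.log T - Real.log (1 + |t - s|)) else 0) +
      ((2 * m).choose j : ℝ) * (4 * E + 2 * Real.log 2) := by
  have hlogT := Real.log_nonneg hT
  have hl2 := log_two_gt
  have hjm : |(j : ℝ) - m| ≤ m := by
    have : (j : ℝ) ≤ 2 * m := by exact_mod_cast (show j ≤ 2 * m by omega)
    rw [abs_le]; constructor <;> linarith [Nat.cast_nonneg (α := ℝ) j]
  set n : ℝ := (j : ℝ) - m with hn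
  have hns : |n * s| ≤ 2 * m * T := by
    rw [abs_mul, abs_of_nonneg hs0]
    nlinarith [abs_nonneg n, Nat.cast_nonneg (α := ℝ) m]
  have hl0 := hc (n * s) (by nlinarith)
  have hlp := hc (n * s + t) (by
    refine (abs_add_le _ _).trans ?_; rw [abs_of_nonneg ht0]; nlinarith)
  have hlm := hc (n * s - t) (by
    refine (abs_sub _ _).trans ?_; rw [abs_of_nonneg ht0]; nlinarith)
  have hfar : ∀ l : ℝ, T - 2 ≤ |l| → Real.log T - Real.log (1 + |l|) ≤ Real.log 2 := by
    intro l hl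
    have : Real.log T ≤ Real.log 2 + Real.log (1 + |l|) := by
      rw [← Real.log_mul (by norm_num) (by positivity)]
      exact Real.log_le_log (by linarith) (by linarith [abs_nonneg l])
    linarith
  have hv : (0 : ℝ) ≤ (2 * m).choose j := Nat.cast_nonneg _
  set v : ℝ := ((2 * m).choose j : ℝ) with hvdef
  rcases Nat.even_or_odd (m + j) with he | ho
  · rw [he.neg_one_pow, one_mul]
    have h1 : ¬ (j = m + 1 ∨ j + 1 = m) := by
      obtain ⟨r, hr⟩ := he
      omega
    rw [if_neg h1, add_zero]
    by_cases hjm' : j = m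
    · rw [if_pos hjm']
      have e : v = ((2 * m).choose m : ℝ) := by rw [hvdef, hjm']
      rw [← e]
      have hx : Real.log (1 + |n * s|) ≥ 0 := Real.log_nonneg (by linarith [abs_nonneg (n * s)])
      have : 2 * c (n * s) - c (n * s + t) - c (n * s - t) ≤
        2 * Real.log T + (4 * E + 2 * Real.log 2) := by linarith
      calc _ ≤ v * (2 * Real.log T + (4 * E + 2 * Real.log 2)) := by gcongr
        _ = _ := by ring
    · rw [if_neg hjm', zero_add]
      have hn1 : 1 ≤ |n| := by
        have h3 : (1 : ℤ) ≤ |(j : ℤ) - (m : ℤ)| := Int.one_le_abs (by omega)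
        have : (1 : ℝ) ≤ |((j : ℤ) - (m : ℤ) : ℤ)| := by exact_mod_cast h3
        simpa [hn] using this
      have hx := hfar (n * s) (by rw [abs_mul, abs_of_nonneg hs0]; nlinarith)
      have : 2 * c (n * s) - c (n * s + t) - c (n * s - t) ≤ 4 * E + 2 * Real.log 2 := by linarith
      gcongr
  · rw [ho.neg_one_pow]
    have h1 : j ≠ m := by
      obtain ⟨r, hr⟩ := ho
      omega
    rw [if_neg h1, zero_add]
    by_cases h2 : j = m + 1 ∨ j + 1 = m
    · rw [if_pos h2]
      have e : v = ((2 * m).choose (m + 1) : ℝ) := by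
        rcases h2 with h2 | h2
        · rw [hvdef, h2]
        · rw [hvdef]
          congr 1
          exact Nat.choose_symm_of_eq_add (by omega)
      rw [← e]
      have : c (n * s + t) + c (n * s - t) - 2 * c (n * s) ≤
          (Real.log T - Real.log (1 + |t - s|)) + (4 * E + 2 * Real.log 2) := by
        rcases h2 with h2 | h2
        · have hn1 : n = 1 := by rw [hn, h2]; push_cast; ring
          rw [hn1, one_mul] at hlp hlm hl0 ⊢
          have := hfar (s + t) (by rw [abs_of_nonneg (by linarith)]; linarith)
          rw [abs_sub_comm] at hlm
          linarith
        · have hn1 : n = -1 := by rw [hn, ← h2]; push_cast; ring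
          rw [hn1, neg_one_mul] at hlp hlm hl0 ⊢
          have := hfar (-s - t) (by
            rw [← neg_add', abs_neg, abs_of_nonneg (by linarith)]; linarith)
          rw [neg_add_eq_sub] at hlp ⊢
          linarith
      calc _ = v * (c (n * s + t) + c (n * s - t) - 2 * c (n * s)) := by ring
        _ ≤ v * ((Real.log T - Real.log (1 + |t - s|)) + (4 * E + 2 * Real.log 2)) := by gcongr
        _ = _ := by ring
    · rw [if_neg h2, zero_add]
      have hn2 : 2 ≤ |n| := by
        have h3 : (2 : ℤ) ≤ |(j : ℤ) - (m : ℤ)| := by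
          rcases le_total (j : ℤ) m with h | h
          · rw [abs_of_nonpos (by omega)]; omega
          · rw [abs_of_nonneg (by omega)]; omega
        have : (2 : ℝ) ≤ |((j : ℤ) - (m : ℤ) : ℤ)| := by exact_mod_cast h3
        simpa [hn] using this
      have hn3 : 3 ≤ |n| := by
        have h3 : (3 : ℤ) ≤ |(j : ℤ) - (m : ℤ)| := by
          obtain ⟨r, hr⟩ := ho
          rcases le_total (j : ℤ) m with h | h
          · rw [abs_of_nonpos (by omega)]; omega
          · rw [abs_of_nonneg (by omega)]; omega
        have : (3 : ℝ) ≤ |((j : ℤ) - (m : ℤ) : ℤ)| := by exact_mod_cast h3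
        simpa [hn] using this
      have hns3 : 3 * (T - 1) ≤ |n * s| := by
        rw [abs_mul, abs_of_nonneg hs0]; nlinarith
      have hx1 := hfar (n * s + t) (by
        have := abs_sub_abs_le_abs_sub (n * s) (-t)
        rw [abs_neg, abs_of_nonneg ht0, sub_neg_eq_add] at this
        linarith)
      have hx2 := hfar (n * s - t) (by
        have := abs_sub_abs_le_abs_sub (n * s) t
        rw [abs_of_nonneg ht0] at this
        linarith)
      have : c (n * s + t) + c (n * s - t) - 2 * c (n * s) ≤ 4 * E + 2 * Real.log 2 := by linarith
      calc _ = v * (c (n * s + t) + c (n * s - t) - 2 * c (n * s)) := by ring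
        _ ≤ v * (4 * E + 2 * Real.log 2) := by gcongr

lemma pair_sum_le {c : ℝ → ℝ} {M E T s t : ℝ} {m : ℕ}
    (hT : 1 ≤ T)
    (hs1 : T - 1 ≤ s) (hs0 : 0 ≤ s) (hs2 : s ≤ 2 * T - 1) (ht1 : T - 1 ≤ t) (ht0 : 0 ≤ t)
    (ht2 : t ≤ 2 * T - 1)
    (hc : ∀ l : ℝ, |l| ≤ 2 * (m + 1) * T → M - E ≤ c l ∧
      c l ≤ M + (Real.log T - Real.log (1 + |l|)) + E) :
    ∑ j ∈ Finset.range (2 * m + 1), ((-1) ^ (m + j) * ((2 * m).choose j : ℝ)) *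
        (2 * c (((j : ℝ) - m) * s) - c (((j : ℝ) - m) * s + t) - c (((j : ℝ) - m) * s - t)) ≤
      ((2 * (m + 1)).choose (m + 1) : ℝ) * Real.log T
        - 2 * ((2 * m).choose (m + 1) : ℝ) * Real.log (1 + |t - s|)
        + 4 ^ m * (4 * E + 2 * Real.log 2) := by
  refine (Finset.sum_le_sum fun j hj => pair_term_le (Finset.mem_range.mp hj) hT hs1 hs0 hs2
    ht1 ht0 ht2 hc).trans ?_
  rw [Finset.sum_add_distrib, Finset.sum_add_distrib, ← Finset.sum_mul, ← Nat.cast_sum,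
    Nat.sum_range_choose, Finset.sum_ite_eq' (Finset.range (2 * m + 1)) m,
    if_pos (Finset.mem_range.mpr (by omega))]
  have hch : (((2 * (m + 1)).choose (m + 1) : ℕ) : ℝ) =
      2 * ((2 * m).choose m : ℝ) + 2 * ((2 * m).choose (m + 1) : ℝ) := by
    have : (2 * (m + 1)).choose (m + 1) = 2 * (2 * m).choose m + 2 * (2 * m).choose (m + 1) := by
      have h2 := Nat.choose_succ_succ' (2 * m + 1) m
      have h3 := Nat.choose_succ_succ' (2 * m) m
      have h4 := Nat.choose_symm_half m
      rw [show 2 * (m + 1) = 2 * m + 1 + 1 by ring]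
      omega
    exact_mod_cast this
  have h4 : ((2 ^ (2 * m) : ℕ) : ℝ) = 4 ^ m := by
    rw [pow_mul]; norm_num
  rw [hch, h4]
  have hmid : ∑ j ∈ Finset.range (2 * m + 1), (if j = m + 1 ∨ j + 1 = m then
      ((2 * m).choose (m + 1) : ℝ) * (Real.log T - Real.log (1 + |t - s|)) else 0) =
      2 * ((2 * m).choose (m + 1) : ℝ) * (Real.log T - Real.log (1 + |t - s|)) := by
    rcases Nat.eq_zero_or_pos m with rfl | hm
    · simp
    · rw [← Finset.sum_filter]
      have : (Finset.range (2 * m + 1)).filter (fun j => j = m + 1 ∨ j + 1 = m) =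
          {m + 1, m - 1} := by
        ext j
        simp only [Finset.mem_filter, Finset.mem_range, Finset.mem_insert, Finset.mem_singleton]
        omega
      rw [this, Finset.sum_pair (by omega)]
      ring
  rw [hmid]
  linarith

lemma sum_pair_factor_le {R T s t E : ℝ} {m : ℕ} (hR : 2 ≤ R)
    (hT : 1 ≤ T)
    (hs1 : T - 1 ≤ s) (hs2 : s ≤ 2 * T - 1) (ht1 : T - 1 ≤ t) (ht2 : t ≤ 2 * T - 1)
    (hc : ∀ l : ℝ, |l| ≤ 2 * (m + 1) * T →
      Real.log (Real.log R) - Real.log (min T (Real.log R)) - E ≤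
        primeCosSum (1 + 1 / Real.log R) (l / Real.log R) ∧
      primeCosSum (1 + 1 / Real.log R) (l / Real.log R) ≤
        Real.log (Real.log R) - Real.log (min T (Real.log R))
          + (Real.log T - Real.log (1 + |l|)) + E) :
    ∑ p ∈ Nat.primesLE ⌊R⌋₊,
      eulerFactorSq (Real.log R) t p * eulerFactorSq (Real.log R) s p ^ m / p ≤
      ((2 * (m + 1)).choose (m + 1) : ℝ) * Real.log T
        - 2 * ((2 * m).choose (m + 1) : ℝ) * Real.log (1 + |t - s|)
        + 4 ^ m * (4 * E + 2 * Real.log 2) + (4 ^ (m + 2) + 4 ^ (m + 2) * (m + 1) * 4) := by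
  have hL : 0 < Real.log R := Real.log_pos (by linarith)
  set L := Real.log R with hLdef
  set h₀ : ℕ → ℝ := fun p =>
    (2 - 2 * Real.cos (t * Real.log p / L)) * (2 - 2 * Real.cos (s * Real.log p / L)) ^ m with hh₀
  have hb : ∀ u : ℝ, 0 ≤ 2 - 2 * Real.cos u ∧ 2 - 2 * Real.cos u ≤ 4 := fun u =>
    ⟨by linarith [Real.cos_le_one u], by linarith [Real.neg_one_le_cos u]⟩
  have h0 : ∀ p, 0 ≤ h₀ p := fun p => mul_nonneg (hb _).1 (pow_nonneg (hb _).1 m)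
  have hK : ∀ p, h₀ p ≤ 4 ^ (m + 1) := fun p => by
    rw [pow_succ', hh₀]
    exact mul_le_mul (hb _).2 (pow_le_pow_left₀ (hb _).1 (hb _).2 m) (pow_nonneg (hb _).1 m)
      (by norm_num)
  have h1 := sum_div_primesLE_le_tsum hR h₀ h0 hK
  rw [← hLdef, tsum_pair_eq hL] at h1
  have h2 := pair_sum_le (c := fun l => primeCosSum (1 + 1 / L) (l / L)) hT hs1
    (by linarith) hs2 ht1 (by linarith) ht2 hc
  have h3 : ∑ p ∈ Nat.primesLE ⌊R⌋₊, eulerFactorSq L t p * eulerFactorSq L s p ^ m / p ≤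
      ∑ p ∈ Nat.primesLE ⌊R⌋₊, (h₀ p / p + 4 ^ (m + 2) * (m + 1) * (Real.log p / p / L)) := by
    refine Finset.sum_le_sum fun p _ => ?_
    have := div_le_div_of_nonneg_right (pair_factor_le hL m t s p) (Nat.cast_nonneg (α := ℝ) p)
    refine this.trans (le_of_eq ?_)
    rw [hh₀]
    ring
  rw [Finset.sum_add_distrib, ← Finset.mul_sum] at h3
  have h4 := mul_le_mul_of_nonneg_left (sum_log_div_div_le hR)
    (show (0 : ℝ) ≤ 4 ^ (m + 2) * (m + 1) by positivity)
  have h5 : (4 : ℝ) * 4 ^ (m + 1) = 4 ^ (m + 2) := by ring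
  rw [← hLdef] at h4
  linarith

lemma exists_pair_moment_le (m : ℕ) : ∃ ε C : ℝ, 0 < ε ∧ 0 < C ∧ ∀ x R T s t : ℝ, 2 ≤ R → R ≤ x →
    1 ≤ T → T - 1 ≤ s → s ≤ 2 * T - 1 → T - 1 ≤ t → t ≤ 2 * T - 1 →
    ∑ n ∈ Finset.Icc 1 ⌊x⌋₊, multWeight (1 + ε) (fun p => eulerFactorSq (Real.log R) t p *
        eulerFactorSq (Real.log R) s p ^ m) R n ≤
      C * (x / Real.log R) * T ^ (((2 * (m + 1)).choose (m + 1) : ℝ) + 1 / 2)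
        * ((1 + |t - s|) ^ (2 * (2 * m).choose (m + 1)))⁻¹ := by
  set B : ℝ := ((2 * (m + 1)).choose (m + 1) : ℝ) with hB
  have hB0 : 0 ≤ B := Nat.cast_nonneg _
  set b : ℕ := (2 * m).choose (m + 1) with hb
  have h4 : (0 : ℝ) < 4 ^ m := by positivity
  obtain ⟨C₁, hC₁, hcos⟩ := exists_primeCosSum_bounds_of_le (ε := 1 / (16 * 4 ^ m))
    (N := 2 * (m + 1)) (by positivity) (by have := Nat.cast_nonneg (α := ℝ) m; linarith)
  obtain ⟨C₂, hC₂, hsum⟩ := exists_sum_multWeight_le (4 ^ (m + 1)) (one_le_pow₀ (by norm_num))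
  set D : ℝ := 4 ^ m * (4 * C₁ + 2 * Real.log 2) + (4 ^ (m + 2) + 4 ^ (m + 2) * (m + 1) * 4) with hD
  have hlog2 := log_two_gt
  have hD0 : 0 ≤ D := by positivity
  set ε : ℝ := 1 / (8 * (B + 1)) with hε
  have hε0 : 0 < ε := by positivity
  have hεB : ε * (B + 1) = 1 / 8 := by rw [hε]; field_simp
  have hε4 : ε ≤ 1 / 4 := by nlinarith
  refine ⟨ε, C₂ * Real.exp (2 * D), hε0, by positivity, ?_⟩
  intro x R T s t hR hx hT hs1 hs2 ht1 ht2
  have hlogR : Real.log 2 ≤ Real.log R := Real.log_le_log (by norm_num) hR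
  have hL : 0 < Real.log R := by linarith
  have hlogT := Real.log_nonneg hT
  have hw := hsum (1 + ε) (fun p => eulerFactorSq (Real.log R) t p *
    eulerFactorSq (Real.log R) s p ^ m) x R (by linarith) (by linarith)
    (fun p => mul_nonneg (eulerFactorSq_nonneg _ _ _) (pow_nonneg (eulerFactorSq_nonneg _ _ _) m))
    (fun p => by
      rw [pow_succ']
      exact mul_le_mul (eulerFactorSq_le hL _ _) (pow_le_pow_left₀ (eulerFactorSq_nonneg _ _ _)
        (eulerFactorSq_le hL _ _) m) (pow_nonneg (eulerFactorSq_nonneg _ _ _) m) (by norm_num))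
    hR hx
  refine hw.trans ?_
  have hp := sum_pair_factor_le (R := R) (m := m) (E := 1 / (16 * 4 ^ m) * Real.log T + C₁)
    hR hT hs1 hs2 ht1 ht2 (fun l hl => by
      have := hcos (Real.log R) T l hlogR hT hl
      constructor <;> linarith [this.1, this.2])
  have hell : 0 ≤ Real.log (1 + |t - s|) := Real.log_nonneg (by linarith [abs_nonneg (t - s)])
  have e1 : (4 : ℝ) ^ m * (4 * (1 / (16 * 4 ^ m) * Real.log T + C₁) + 2 * Real.log 2) =
      1 / 4 * Real.log T + 4 ^ m * (4 * C₁ + 2 * Real.log 2) := by field_simp; ring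
  rw [e1, ← hB, ← hb] at hp
  set S := ∑ p ∈ Nat.primesLE ⌊R⌋₊,
      eulerFactorSq (Real.log R) t p * eulerFactorSq (Real.log R) s p ^ m / p with hS
  have hp' : S ≤ (B + 1 / 4) * Real.log T - 2 * b * Real.log (1 + |t - s|) + D := by linarith
  have hbl : 0 ≤ 2 * (b : ℝ) * Real.log (1 + |t - s|) := by positivity
  have hfin : (1 + ε) * S ≤ (B + 1 / 2) * Real.log T - 2 * b * Real.log (1 + |t - s|) + 2 * D := by
    have h6 : (1 + ε) * S ≤
        (1 + ε) * ((B + 1 / 4) * Real.log T - 2 * b * Real.log (1 + |t - s|) + D) := by gcongr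
    have h7 : ε * (B + 1 / 4) * Real.log T ≤ 1 / 8 * Real.log T := by
      gcongr
      nlinarith
    nlinarith
  have e2 : T ^ (B + 1 / 2) * ((1 + |t - s|) ^ (2 * b))⁻¹ * Real.exp (2 * D) =
      Real.exp ((B + 1 / 2) * Real.log T - 2 * b * Real.log (1 + |t - s|) + 2 * D) := by
    rw [Real.exp_add, Real.exp_sub, mul_comm _ (Real.log T),
      ← Real.rpow_def_of_pos (by linarith), ← div_eq_mul_inv]
    congr 2
    rw [← Real.rpow_natCast, Real.rpow_def_of_pos (by positivity)]
    push_cast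
    ring_nf
  have hxL : 0 ≤ x / Real.log R := div_nonneg (by linarith) hL.le
  calc _ ≤ C₂ * (x / Real.log R) * Real.exp
        ((B + 1 / 2) * Real.log T - 2 * b * Real.log (1 + |t - s|) + 2 * D) := by
        gcongr
    _ = _ := by rw [← e2]; ring

/-- `|∏_{p ∣ n, p ≤ R} (1 - p^{-(1+it)/log R})|²`. -/
noncomputable def eulerSq (R t : ℝ) (n : ℕ) : ℝ :=
  ∏ p ∈ n.primeFactors.filter (fun p : ℕ => (p : ℝ) ≤ R), eulerFactorSq (Real.log R) t p

lemma eulerSq_nonneg (R t : ℝ) (n : ℕ) : 0 ≤ eulerSq R t n :=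
  Finset.prod_nonneg fun _ _ => eulerFactorSq_nonneg _ _ _

lemma multWeight_pair_eq (ρ R t s : ℝ) (m n : ℕ) :
    multWeight ρ (fun p => eulerFactorSq (Real.log R) t p * eulerFactorSq (Real.log R) s p ^ m) R n
      = ρ ^ bigOmega n R * (eulerSq R t n * eulerSq R s n ^ m) := by
  rw [multWeight, Finset.prod_mul_distrib, Finset.prod_pow, eulerSq, eulerSq]

lemma sum_pow_le_weighted {ι : Type*} (S : Finset ι) (β y : ι → ℝ) {c : ℝ} (m : ℕ)
    (hβ : ∀ i ∈ S, 0 < β i) (h1 : 1 ≤ ∑ i ∈ S, β i) (hc : ∑ i ∈ S, β i ≤ c)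
    (hy : ∀ i ∈ S, 0 ≤ y i) :
    (∑ i ∈ S, y i) ^ m ≤ c ^ m * ∑ i ∈ S, β i * ((β i)⁻¹ ^ m * y i ^ m) := by
  set b := ∑ i ∈ S, β i with hb
  have hb0 : 0 < b := by linarith
  have key := Real.pow_arith_mean_le_arith_mean_pow S (fun i => β i / b) (fun i => (β i)⁻¹ * y i)
    (fun i hi => div_nonneg (hβ i hi).le hb0.le) (by rw [← Finset.sum_div, div_self hb0.ne'])
    (fun i hi => mul_nonneg (inv_nonneg.mpr (hβ i hi).le) (hy i hi)) m
  have e1 : ∑ i ∈ S, β i / b * ((β i)⁻¹ * y i) = (∑ i ∈ S, y i) / b := by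
    rw [Finset.sum_div]
    refine Finset.sum_congr rfl fun i hi => ?_
    have := (hβ i hi).ne'
    field_simp
  have e2 : ∑ i ∈ S, β i / b * ((β i)⁻¹ * y i) ^ m =
      (∑ i ∈ S, β i * ((β i)⁻¹ ^ m * y i ^ m)) / b := by
    rw [Finset.sum_div]
    refine Finset.sum_congr rfl fun i hi => ?_
    rw [mul_pow]
    ring
  rw [e1, e2, div_pow, div_le_iff₀ (by positivity)] at key
  have h0 : 0 ≤ ∑ i ∈ S, β i * ((β i)⁻¹ ^ m * y i ^ m) := Finset.sum_nonneg fun i hi => by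
    have := hβ i hi
    have := hy i hi
    positivity
  refine key.trans ?_
  rw [mul_comm]
  have hc0 : 0 ≤ c := hb0.le.trans hc
  gcongr
  exact div_le_self h0 h1

lemma exists_sum_inv_sq_le : ∃ c : ℝ, 1 ≤ c ∧ ∀ (S : Finset ℕ) (i : ℕ),
    ∑ i' ∈ S, ((1 + |(i : ℝ) - i'|) ^ 2)⁻¹ ≤ c := by
  have hn : Summable fun n : ℕ => (((1 : ℝ) + n) ^ 2)⁻¹ := by
    have := (summable_nat_add_iff 1).mpr (Real.summable_nat_pow_inv.mpr (one_lt_two))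
    refine this.congr fun n => ?_
    push_cast
    rw [add_comm]
  have hz : Summable fun z : ℤ => (((1 : ℝ) + |(z : ℝ)|) ^ 2)⁻¹ := by
    refine Summable.of_nat_of_neg ?_ ?_
    · simpa using hn
    · simpa using hn
  refine ⟨1 + ∑' z : ℤ, (((1 : ℝ) + |(z : ℝ)|) ^ 2)⁻¹, ?_, fun S i => ?_⟩
  · have : 0 ≤ ∑' z : ℤ, (((1 : ℝ) + |(z : ℝ)|) ^ 2)⁻¹ := tsum_nonneg fun z => by positivity
    linarith
  · have h1 := hz.sum_le_tsum (S.image fun i' : ℕ => (i : ℤ) - i') fun z _ => by positivity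
    rw [Finset.sum_image (by intro a _ b _ h; simpa using h)] at h1
    push_cast at h1
    linarith

lemma le_choose_two_mul (m : ℕ) : m ≤ (2 * m).choose (m + 1) := by
  rcases m with _ | _ | m
  · simp
  · simp
  · have h1 : (m + 1 + 1 + 2).choose (m + 1 + 1 + 1) ≤
        (2 * (m + 1 + 1)).choose (m + 1 + 1 + 1) :=
      Nat.choose_le_choose _ (by omega)
    have h2 : (m + 1 + 1 + 2).choose (m + 1 + 1 + 1) = m + 1 + 1 + 2 :=
      Nat.choose_succ_self_right (m + 1 + 1 + 1)
    omega

lemma exists_block_moment_le (m : ℕ) : ∃ ε C : ℝ, 0 < ε ∧ 0 < C ∧ ∀ (x R u : ℝ) (N : ℕ), 2 ≤ R →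
    R ≤ x → 0 ≤ u → u ≤ 1 → 1 ≤ N →
    ∑ n ∈ Finset.Icc 1 ⌊x⌋₊, (1 + ε) ^ bigOmega n R *
        (∑ i ∈ Finset.Ico (N - 1) (2 * N - 1), eulerSq R (i + u) n) ^ (m + 1) ≤
      C * (x / Real.log R) * (N : ℝ) ^ (((2 * (m + 1)).choose (m + 1) : ℝ) + 3 / 2) := by
  obtain ⟨ε, C, hε, hC, hpair⟩ := exists_pair_moment_le m
  obtain ⟨c, hc, hsum⟩ := exists_sum_inv_sq_le
  refine ⟨ε, C * c ^ (m + 1), hε, by positivity, ?_⟩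
  intro x R u N hR hx hu0 hu1 hN
  set S := Finset.Ico (N - 1) (2 * N - 1) with hS
  set B : ℝ := ((2 * (m + 1)).choose (m + 1) : ℝ) with hB
  have hNR : (1 : ℝ) ≤ N := by exact_mod_cast hN
  have hmem : ∀ i ∈ S, (N : ℝ) - 1 ≤ i + u ∧ (i : ℝ) + u ≤ 2 * N - 1 := by
    intro i hi
    rw [hS, Finset.mem_Ico] at hi
    have h1 : (N : ℝ) ≤ i + 1 := by exact_mod_cast (show N ≤ i + 1 by omega)
    have h2 : (i : ℝ) + 1 + 1 ≤ 2 * N := by exact_mod_cast (show i + 1 + 1 ≤ 2 * N by omega)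
    constructor <;> linarith
  have hxL : 0 ≤ x / Real.log R := div_nonneg (by linarith) (Real.log_nonneg (by linarith))
  have hcard : (S.card : ℝ) = N := by
    rw [hS, Nat.card_Ico]; congr 1; omega
  set G := C * (x / Real.log R) * (N : ℝ) ^ (B + 1 / 2) with hG
  have hG0 : 0 ≤ G := by positivity
  have hβpos : ∀ i i' : ℕ, 0 < ((1 + |(i : ℝ) - i'|) ^ 2)⁻¹ := fun i i' => by positivity
  have hpt : ∀ n : ℕ, (1 + ε) ^ bigOmega n R * (∑ i ∈ S, eulerSq R (i + u) n) ^ (m + 1) ≤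
      ∑ i ∈ S, c ^ m * ∑ i' ∈ S, ((1 + |(i : ℝ) - i'|) ^ 2)⁻¹ *
        ((((1 + |(i : ℝ) - i'|) ^ 2)⁻¹)⁻¹ ^ m *
          ((1 + ε) ^ bigOmega n R * (eulerSq R (i + u) n * eulerSq R (i' + u) n ^ m))) := by
    intro n
    rw [pow_succ', Finset.sum_mul, Finset.mul_sum]
    refine Finset.sum_le_sum fun i hi => ?_
    have h1 : 1 ≤ ∑ i' ∈ S, ((1 + |(i : ℝ) - i'|) ^ 2)⁻¹ := by
      have := Finset.single_le_sum (fun i' _ => (hβpos i i').le) hi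
      simpa using this
    have h2 := sum_pow_le_weighted S (fun i' : ℕ => ((1 + |(i : ℝ) - i'|) ^ 2)⁻¹)
      (fun i' : ℕ => eulerSq R (i' + u) n) m (fun i' _ => hβpos i i') h1 (hsum S i)
      (fun i' _ => eulerSq_nonneg _ _ _)
    have h3 : 0 ≤ (1 + ε) ^ bigOmega n R * eulerSq R (i + u) n :=
      mul_nonneg (by positivity) (eulerSq_nonneg _ _ _)
    calc _ = (1 + ε) ^ bigOmega n R * eulerSq R (i + u) n *
          (∑ i' ∈ S, eulerSq R (i' + u) n) ^ m := by ring
      _ ≤ (1 + ε) ^ bigOmega n R * eulerSq R (i + u) n * _ := mul_le_mul_of_nonneg_left h2 h3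
      _ = _ := by
        rw [← mul_assoc, mul_comm _ (c ^ m), mul_assoc, Finset.mul_sum]
        congr 1
        refine Finset.sum_congr rfl fun i' _ => ?_
        ring
  refine (Finset.sum_le_sum fun n _ => hpt n).trans ?_
  rw [Finset.sum_comm]
  have hi : ∀ i ∈ S, ∑ n ∈ Finset.Icc 1 ⌊x⌋₊, c ^ m * ∑ i' ∈ S, ((1 + |(i : ℝ) - i'|) ^ 2)⁻¹ *
        ((((1 + |(i : ℝ) - i'|) ^ 2)⁻¹)⁻¹ ^ m *
          ((1 + ε) ^ bigOmega n R * (eulerSq R (i + u) n * eulerSq R (i' + u) n ^ m))) ≤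
      c ^ m * (c * G) := by
    intro i hi
    rw [← Finset.mul_sum, Finset.sum_comm]
    gcongr
    calc _ ≤ ∑ i' ∈ S, ((1 + |(i : ℝ) - i'|) ^ 2)⁻¹ * G := by
          refine Finset.sum_le_sum fun i' hi' => ?_
          rw [← Finset.mul_sum, ← Finset.mul_sum]
          refine mul_le_mul_of_nonneg_left ?_ (hβpos i i').le
          have h4 := hpair x R N (i' + u) (i + u) hR hx hNR (hmem i' hi').1 (hmem i' hi').2
            (hmem i hi).1 (hmem i hi).2
          simp only [multWeight_pair_eq] at h4
          rw [add_sub_add_right_eq_sub] at h4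
          set a := 1 + |(i : ℝ) - i'| with ha
          have ha1 : 1 ≤ a := by rw [ha]; linarith [abs_nonneg ((i : ℝ) - i')]
          have h5 : a ^ (2 * m) ≤ a ^ (2 * (2 * m).choose (m + 1)) :=
            pow_le_pow_right₀ ha1 (Nat.mul_le_mul_left 2 (le_choose_two_mul m))
          rw [inv_inv, ← pow_mul]
          calc _ ≤ a ^ (2 * m) * (G * (a ^ (2 * (2 * m).choose (m + 1)))⁻¹) := by gcongr
            _ ≤ a ^ (2 * (2 * m).choose (m + 1)) *
                (G * (a ^ (2 * (2 * m).choose (m + 1)))⁻¹) := by gcongr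
            _ = G := by field_simp
      _ = (∑ i' ∈ S, ((1 + |(i : ℝ) - i'|) ^ 2)⁻¹) * G := by rw [Finset.sum_mul]
      _ ≤ c * G := by gcongr; exact hsum S i
  refine (Finset.sum_le_sum hi).trans (le_of_eq ?_)
  have e : (N : ℝ) ^ (B + 3 / 2) = N * (N : ℝ) ^ (B + 1 / 2) := by
    rw [show B + 3 / 2 = 1 + (B + 1 / 2) by ring, Real.rpow_add (by linarith), Real.rpow_one]
  rw [Finset.sum_const, nsmul_eq_mul, hcard, hG, e]
  ring

lemma sum_dyadic_blocks (g : ℕ → ℝ) (J : ℕ) :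
    ∑ j ∈ Finset.range J, ∑ i ∈ Finset.Ico (2 ^ j - 1) (2 * 2 ^ j - 1), g i =
      ∑ i ∈ Finset.range (2 ^ J - 1), g i := by
  induction J with
  | zero => simp
  | succ J ih =>
    have := Nat.one_le_two_pow (n := J)
    rw [Finset.sum_range_succ, ih, pow_succ', Finset.range_eq_Ico, Finset.range_eq_Ico,
      Finset.sum_Ico_consecutive _ (by omega) (by omega)]

lemma inv_one_add_sq_le {T t : ℝ} (hT : 1 ≤ T) (ht : T - 1 ≤ t) :
    (1 + t ^ 2)⁻¹ ≤ 2 * (T ^ 2)⁻¹ := by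
  have h : T ^ 2 / 2 ≤ 1 + t ^ 2 := by
    have : (T - 1) ^ 2 ≤ t ^ 2 := pow_le_pow_left₀ (by linarith) ht 2
    nlinarith [sq_nonneg (T - 2)]
  calc (1 + t ^ 2)⁻¹ ≤ (T ^ 2 / 2)⁻¹ := inv_anti₀ (by positivity) h
    _ = _ := by rw [inv_div, div_eq_mul_inv]

lemma exists_weighted_block_moment_le {m A : ℕ}
    (hA : (2 * (m + 1)).choose (m + 1) + 2 ≤ 2 * (m + 1) * A) :
    ∃ ε C : ℝ, 0 < ε ∧ 0 < C ∧ ∀ (x R u : ℝ) (j : ℕ), 2 ≤ R → R ≤ x → 0 ≤ u → u ≤ 1 →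
    ∑ n ∈ Finset.Icc 1 ⌊x⌋₊, (1 + ε) ^ bigOmega n R *
        (∑ i ∈ Finset.Ico (2 ^ j - 1 : ℕ) (2 * 2 ^ j - 1),
          ((1 + ((i : ℝ) + u) ^ 2)⁻¹ ^ A * eulerSq R (i + u) n)) ^ (m + 1) ≤
      C * (x / Real.log R) * ((2 : ℝ) ^ (-(1 / 2) : ℝ)) ^ j := by
  obtain ⟨ε, C, hε, hC, h⟩ := exists_block_moment_le m
  refine ⟨ε, C * 2 ^ (A * (m + 1)), hε, by positivity, ?_⟩
  intro x R u j hR hx hu0 hu1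
  have hN := Nat.one_le_two_pow (n := j)
  have h1 := h x R u (2 ^ j) hR hx hu0 hu1 hN
  set N : ℕ := 2 ^ j with hNdef
  have hNR : (1 : ℝ) ≤ N := by exact_mod_cast hN
  set S := Finset.Ico (N - 1) (2 * N - 1) with hS
  have hxL : 0 ≤ x / Real.log R := div_nonneg (by linarith) (Real.log_nonneg (by linarith))
  set W : ℝ := (2 * ((N : ℝ) ^ 2)⁻¹) ^ A with hW
  have hW0 : 0 ≤ W := by positivity
  have h2 : ∀ n : ℕ, (1 + ε) ^ bigOmega n R *
      (∑ i ∈ S, ((1 + ((i : ℝ) + u) ^ 2)⁻¹ ^ A * eulerSq R (i + u) n)) ^ (m + 1) ≤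
      W ^ (m + 1) * ((1 + ε) ^ bigOmega n R * (∑ i ∈ S, eulerSq R (i + u) n) ^ (m + 1)) := by
    intro n
    have h3 : ∑ i ∈ S, ((1 + ((i : ℝ) + u) ^ 2)⁻¹ ^ A * eulerSq R (i + u) n) ≤
        W * ∑ i ∈ S, eulerSq R (i + u) n := by
      rw [Finset.mul_sum]
      refine Finset.sum_le_sum fun i hi => ?_
      refine mul_le_mul_of_nonneg_right ?_ (eulerSq_nonneg _ _ _)
      refine pow_le_pow_left₀ (by positivity) (inv_one_add_sq_le hNR ?_) A
      rw [hS, Finset.mem_Ico] at hi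
      have h1 : (N : ℝ) ≤ i + 1 := by exact_mod_cast (show N ≤ i + 1 by omega)
      linarith
    have h0 : 0 ≤ ∑ i ∈ S, ((1 + ((i : ℝ) + u) ^ 2)⁻¹ ^ A * eulerSq R (i + u) n) :=
      Finset.sum_nonneg fun i _ => mul_nonneg (by positivity) (eulerSq_nonneg _ _ _)
    calc _ ≤ (1 + ε) ^ bigOmega n R * (W * ∑ i ∈ S, eulerSq R (i + u) n) ^ (m + 1) := by
          gcongr
      _ = _ := by ring
  refine (Finset.sum_le_sum fun n _ => h2 n).trans ?_
  rw [← Finset.mul_sum]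
  set B : ℝ := ((2 * (m + 1)).choose (m + 1) : ℝ) with hB
  have hAR : B + 2 ≤ 2 * (m + 1) * A := by rw [hB]; exact_mod_cast hA
  have h4 : W ^ (m + 1) * (N : ℝ) ^ (B + 3 / 2) ≤
      2 ^ (A * (m + 1)) * ((2 : ℝ) ^ (-(1 / 2) : ℝ)) ^ j := by
    have e1 : W ^ (m + 1) = 2 ^ (A * (m + 1)) * (N : ℝ) ^ (-(2 * (m + 1) * A) : ℝ) := by
      rw [hW, ← pow_mul, mul_pow, inv_pow, ← pow_mul, ← Real.rpow_natCast (N : ℝ),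
        ← Real.rpow_neg (by linarith)]
      congr 2
      push_cast
      ring
    have e2 : ((2 : ℝ) ^ (-(1 / 2) : ℝ)) ^ j = (N : ℝ) ^ (-(1 / 2) : ℝ) := by
      rw [hNdef, ← Real.rpow_natCast, ← Real.rpow_mul (by norm_num), mul_comm,
        Real.rpow_mul (by norm_num), Real.rpow_natCast]
      push_cast
      rfl
    rw [e1, e2, mul_assoc, ← Real.rpow_add (by linarith)]
    gcongr
    linarith
  calc _ ≤ W ^ (m + 1) * (C * (x / Real.log R) * (N : ℝ) ^ (B + 3 / 2)) := by gcongr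
    _ = C * (x / Real.log R) * (W ^ (m + 1) * (N : ℝ) ^ (B + 3 / 2)) := by ring
    _ ≤ C * (x / Real.log R) * (2 ^ (A * (m + 1)) * ((2 : ℝ) ^ (-(1 / 2) : ℝ)) ^ j) := by gcongr
    _ = _ := by ring

/-- Moments of a Riemann sum for the Plancherel side, uniformly in its length and its phase. -/
lemma exists_riemann_sum_moment_le {m A : ℕ}
    (hA : (2 * (m + 1)).choose (m + 1) + 2 ≤ 2 * (m + 1) * A) :
    ∃ ε C : ℝ, 0 < ε ∧ 0 < C ∧ ∀ (x R u : ℝ) (J : ℕ), 2 ≤ R → R ≤ x → 0 ≤ u → u ≤ 1 →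
    ∑ n ∈ Finset.Icc 1 ⌊x⌋₊, (1 + ε) ^ bigOmega n R *
        (∑ i ∈ Finset.range (2 ^ J - 1),
          ((1 + ((i : ℝ) + u) ^ 2)⁻¹ ^ A * eulerSq R (i + u) n)) ^ (m + 1) ≤
      C * (x / Real.log R) := by
  obtain ⟨ε, C, hε, hC, h⟩ := exists_weighted_block_moment_le hA
  obtain ⟨c, hc, hsum⟩ := exists_sum_inv_sq_le
  set r : ℝ := (2 : ℝ) ^ (-(1 / 2) : ℝ) with hr
  have hr0 : 0 < r := by positivity
  have hr1 : r < 1 := Real.rpow_lt_one_of_one_lt_of_neg (by norm_num) (by norm_num)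
  have hsr : Summable fun j : ℕ => ((1 : ℝ) + j) ^ (2 * (m + 1)) * r ^ j := by
    have h1 := (summable_nat_add_iff 1).mpr (summable_pow_mul_geometric_of_norm_lt_one
      (2 * (m + 1)) (r := r) (by rwa [Real.norm_of_nonneg hr0.le]))
    refine (h1.mul_left r⁻¹).congr fun j => ?_
    push_cast
    rw [pow_succ]
    field_simp
    ring
  set c₂ := ∑' j : ℕ, ((1 : ℝ) + j) ^ (2 * (m + 1)) * r ^ j with hc₂
  have hc₂0 : 0 ≤ c₂ := tsum_nonneg fun j => by positivity
  refine ⟨ε, c ^ (m + 1) * C * (c₂ + 1), hε, by positivity, ?_⟩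
  intro x R u J hR hx hu0 hu1
  have hxL : 0 ≤ x / Real.log R := div_nonneg (by linarith) (Real.log_nonneg (by linarith))
  rcases Nat.eq_zero_or_pos J with rfl | hJ
  · simp only [pow_zero, le_refl, tsub_eq_zero_of_le, Finset.range_zero, Finset.sum_empty, ne_eq,
      Nat.add_eq_zero_iff, one_ne_zero, and_false, not_false_eq_true, zero_pow, mul_zero,
      Finset.sum_const_zero]
    positivity
  set Q : ℕ → ℕ → ℝ := fun j n => ∑ i ∈ Finset.Ico (2 ^ j - 1 : ℕ) (2 * 2 ^ j - 1),
          ((1 + ((i : ℝ) + u) ^ 2)⁻¹ ^ A * eulerSq R (i + u) n) with hQ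
  have hQ0 : ∀ j n, 0 ≤ Q j n := fun j n => Finset.sum_nonneg fun i _ =>
    mul_nonneg (by positivity) (eulerSq_nonneg _ _ _)
  have hpt : ∀ n : ℕ, (1 + ε) ^ bigOmega n R * (∑ i ∈ Finset.range (2 ^ J - 1),
          ((1 + ((i : ℝ) + u) ^ 2)⁻¹ ^ A * eulerSq R (i + u) n)) ^ (m + 1) ≤
      c ^ (m + 1) * ∑ j ∈ Finset.range J, ((1 : ℝ) + j) ^ (2 * (m + 1)) *
        ((1 + ε) ^ bigOmega n R * Q j n ^ (m + 1)) := by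
    intro n
    rw [← sum_dyadic_blocks]
    have h1 : 1 ≤ ∑ j ∈ Finset.range J, ((1 + |((0 : ℕ) : ℝ) - j|) ^ 2)⁻¹ := by
      have := Finset.single_le_sum (f := fun j : ℕ => ((1 + |((0 : ℕ) : ℝ) - j|) ^ 2)⁻¹)
        (fun i' _ => by positivity) (Finset.mem_range.mpr hJ)
      simpa using this
    have h2 := sum_pow_le_weighted (Finset.range J)
      (fun j : ℕ => ((1 + |((0 : ℕ) : ℝ) - j|) ^ 2)⁻¹)
      (fun j => Q j n) (m + 1) (fun j _ => by positivity) h1 (hsum _ 0) (fun j _ => hQ0 j n)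
    calc _ ≤ (1 + ε) ^ bigOmega n R * _ := mul_le_mul_of_nonneg_left h2 (by positivity)
      _ ≤ (1 + ε) ^ bigOmega n R * (c ^ (m + 1) * ∑ j ∈ Finset.range J,
          ((1 : ℝ) + j) ^ (2 * (m + 1)) * Q j n ^ (m + 1)) := by
        refine mul_le_mul_of_nonneg_left (mul_le_mul_of_nonneg_left
          (Finset.sum_le_sum fun j hj => ?_) (by positivity)) (by positivity)
        rw [Nat.cast_zero, zero_sub, abs_neg, Nat.abs_cast, inv_inv, ← pow_mul, ← mul_assoc]
        refine mul_le_mul_of_nonneg_right ?_ (pow_nonneg (hQ0 j n) _)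
        refine mul_le_of_le_one_left (by positivity) (inv_le_one_of_one_le₀ ?_)
        exact one_le_pow₀ (by linarith [Nat.cast_nonneg (α := ℝ) j])
      _ = _ := by
        rw [mul_left_comm, Finset.mul_sum]
        congr 1
        refine Finset.sum_congr rfl fun j _ => ?_
        ring
  refine (Finset.sum_le_sum fun n _ => hpt n).trans ?_
  rw [← Finset.mul_sum, Finset.sum_comm]
  have hblocks : ∑ j ∈ Finset.range J, ∑ n ∈ Finset.Icc 1 ⌊x⌋₊, ((1 : ℝ) + j) ^ (2 * (m + 1)) *
        ((1 + ε) ^ bigOmega n R * Q j n ^ (m + 1)) ≤ C * (x / Real.log R) * c₂ := by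
    calc _ ≤ ∑ j ∈ Finset.range J, C * (x / Real.log R) *
          (((1 : ℝ) + j) ^ (2 * (m + 1)) * r ^ j) := by
          refine Finset.sum_le_sum fun j _ => ?_
          rw [← Finset.mul_sum]
          refine (mul_le_mul_of_nonneg_left (h x R u j hR hx hu0 hu1) (by positivity)).trans
            (le_of_eq ?_)
          ring
      _ = C * (x / Real.log R) *
          ∑ j ∈ Finset.range J, ((1 : ℝ) + j) ^ (2 * (m + 1)) * r ^ j := by rw [Finset.mul_sum]
      _ ≤ _ := by
          gcongr
          exact hsr.sum_le_tsum _ fun j _ => by positivity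
  calc _ ≤ c ^ (m + 1) * (C * (x / Real.log R) * c₂) := by gcongr
    _ ≤ c ^ (m + 1) * (C * (x / Real.log R) * (c₂ + 1)) := by gcongr; linarith
    _ = _ := by ring

lemma intervalIntegral_pow_le {F : ℝ → ℝ} (hF : Continuous F) (h0 : ∀ u, 0 ≤ F u) (k : ℕ) :
    (∫ u in (0 : ℝ)..1, F u) ^ k ≤ ∫ u in (0 : ℝ)..1, F u ^ k := by
  rw [intervalIntegral.integral_of_le zero_le_one, intervalIntegral.integral_of_le zero_le_one]
  have : MeasureTheory.IsProbabilityMeasure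
      (MeasureTheory.volume.restrict (Set.Ioc (0 : ℝ) 1)) := ⟨by simp⟩
  refine ConvexOn.map_integral_le (s := Set.Ici 0) (g := fun y : ℝ => y ^ k) (convexOn_pow k)
    (by fun_prop) isClosed_Ici (Filter.Eventually.of_forall fun u => h0 u) ?_ ?_
  · exact (hF.integrableOn_Icc (a := 0) (b := 1)).mono_set Set.Ioc_subset_Icc_self
  · exact ((hF.pow k).integrableOn_Icc (a := 0) (b := 1)).mono_set Set.Ioc_subset_Icc_self

lemma intervalIntegral_eq_integral_sum {g : ℝ → ℝ} (hg : Continuous g) (N : ℕ) :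
    ∫ t in (0 : ℝ)..N, g t = ∫ u in (0 : ℝ)..1, ∑ i ∈ Finset.range N, g (i + u) := by
  have hi : ∀ i ∈ Finset.range N, IntervalIntegrable (fun u : ℝ => g (i + u))
      MeasureTheory.volume 0 1 := fun i _ =>
    (hg.comp (by fun_prop : Continuous fun u : ℝ => (i : ℝ) + u)).intervalIntegrable _ _
  rw [intervalIntegral.integral_finsetSum hi]
  have := intervalIntegral.sum_integral_adjacent_intervals (f := g) (μ := MeasureTheory.volume)
    (a := fun i : ℕ => (i : ℝ)) (n := N) fun i _ => hg.intervalIntegrable _ _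
  rw [Nat.cast_zero] at this
  rw [← this]
  refine Finset.sum_congr rfl fun i _ => ?_
  rw [intervalIntegral.integral_comp_add_left (fun t => g t)]
  simp

lemma continuous_eulerSq (R : ℝ) (n : ℕ) : Continuous fun t => eulerSq R t n := by
  unfold eulerSq eulerFactorSq
  fun_prop

lemma eulerSq_le {R : ℝ} (hR : 2 ≤ R) (t : ℝ) (n : ℕ) :
    eulerSq R t n ≤ 4 ^ (n.primeFactors.filter (fun p : ℕ => (p : ℝ) ≤ R)).card := by
  rw [← Finset.prod_const]
  exact Finset.prod_le_prod (fun _ _ => eulerFactorSq_nonneg _ _ _) fun p _ =>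
    eulerFactorSq_le (Real.log_pos (by linarith)) t p

lemma eulerSq_neg (R t : ℝ) (n : ℕ) : eulerSq R (-t) n = eulerSq R t n := by
  unfold eulerSq eulerFactorSq
  refine Finset.prod_congr rfl fun p _ => ?_
  rw [neg_mul, neg_div, Real.cos_neg]

lemma continuous_weight_eulerSq (A : ℕ) (R : ℝ) (n : ℕ) :
    Continuous fun t : ℝ => (1 + t ^ 2)⁻¹ ^ A * eulerSq R t n := by
  refine Continuous.mul (Continuous.pow (Continuous.inv₀ (by fun_prop) fun t => ?_) A)
    (continuous_eulerSq R n)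
  positivity

lemma integrable_weight_eulerSq {A : ℕ} (hA : 1 ≤ A) {R : ℝ} (hR : 2 ≤ R) (n : ℕ) :
    MeasureTheory.Integrable fun t : ℝ => (1 + t ^ 2)⁻¹ ^ A * eulerSq R t n := by
  refine MeasureTheory.Integrable.mono' (integrable_inv_one_add_sq.mul_const
    (4 ^ (n.primeFactors.filter (fun p : ℕ => (p : ℝ) ≤ R)).card))
    (continuous_weight_eulerSq A R n).aestronglyMeasurable (Filter.Eventually.of_forall fun t => ?_)
  have h1 : (1 + t ^ 2)⁻¹ ≤ 1 := inv_le_one_of_one_le₀ (by nlinarith [sq_nonneg t])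
  rw [Real.norm_of_nonneg (mul_nonneg (by positivity) (eulerSq_nonneg _ _ _))]
  refine mul_le_mul ?_ (eulerSq_le hR t n) (eulerSq_nonneg _ _ _) (by positivity)
  exact pow_le_of_le_one (by positivity) h1 (by omega)

lemma exists_integral_moment_le {m A : ℕ} (hA1 : 1 ≤ A)
    (hA : (2 * (m + 1)).choose (m + 1) + 2 ≤ 2 * (m + 1) * A) :
    ∃ ε C : ℝ, 0 < ε ∧ 0 < C ∧ ∀ x R : ℝ, 2 ≤ R → R ≤ x →
    ∑ n ∈ Finset.Icc 1 ⌊x⌋₊, (1 + ε) ^ bigOmega n R *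
        (∫ t : ℝ, (1 + t ^ 2)⁻¹ ^ A * eulerSq R t n) ^ (m + 1) ≤
      C * (x / Real.log R) := by
  obtain ⟨ε, C, hε, hC, h⟩ := exists_riemann_sum_moment_le hA
  refine ⟨ε, C * 2 ^ (m + 1), hε, by positivity, ?_⟩
  intro x R hR hx
  set g : ℕ → ℝ → ℝ := fun n t => (1 + t ^ 2)⁻¹ ^ A * eulerSq R t n with hg
  have hgc : ∀ n, Continuous (g n) := fun n => continuous_weight_eulerSq A R n
  have hg0 : ∀ n t, 0 ≤ g n t := fun n t => mul_nonneg (by positivity) (eulerSq_nonneg _ _ _)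
  have hfin : ∀ J : ℕ, ∑ n ∈ Finset.Icc 1 ⌊x⌋₊, (1 + ε) ^ bigOmega n R *
      (∫ t in (0 : ℝ)..((2 ^ J - 1 : ℕ) : ℝ), g n t) ^ (m + 1) ≤ C * (x / Real.log R) := by
    intro J
    have hFc : ∀ n, Continuous fun u : ℝ => ∑ i ∈ Finset.range (2 ^ J - 1), g n (i + u) :=
      fun n => continuous_finsetSum _ fun i _ => (hgc n).comp (by fun_prop)
    calc _ ≤ ∑ n ∈ Finset.Icc 1 ⌊x⌋₊, ∫ u in (0 : ℝ)..1, (1 + ε) ^ bigOmega n R *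
          (∑ i ∈ Finset.range (2 ^ J - 1), g n (i + u)) ^ (m + 1) := by
          refine Finset.sum_le_sum fun n _ => ?_
          rw [intervalIntegral_eq_integral_sum (hgc n), intervalIntegral.integral_const_mul]
          refine mul_le_mul_of_nonneg_left ?_ (by positivity)
          exact intervalIntegral_pow_le (hFc n) (fun u => Finset.sum_nonneg fun i _ => hg0 _ _) _
      _ = ∫ u in (0 : ℝ)..1, ∑ n ∈ Finset.Icc 1 ⌊x⌋₊, (1 + ε) ^ bigOmega n R *
          (∑ i ∈ Finset.range (2 ^ J - 1), g n (i + u)) ^ (m + 1) := by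
          refine (intervalIntegral.integral_finsetSum fun n _ => ?_).symm
          exact (((hFc n).pow (m + 1)).const_mul _).intervalIntegrable _ _
      _ ≤ ∫ _ in (0 : ℝ)..1, C * (x / Real.log R) := by
          refine intervalIntegral.integral_mono_on zero_le_one ?_ (by simp) fun u hu =>
            h x R u J hR hx hu.1 hu.2
          exact (continuous_finsetSum _ fun n _ =>
            ((hFc n).pow (m + 1)).const_mul _).intervalIntegrable _ _
      _ = _ := by simp
  have hlim : Filter.Tendsto (fun J : ℕ => ((2 ^ J - 1 : ℕ) : ℝ)) Filter.atTop Filter.atTop := by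
    refine tendsto_natCast_atTop_atTop.comp (Filter.tendsto_atTop_mono (fun J => ?_)
      Filter.tendsto_id)
    have := Nat.lt_two_pow_self (n := J)
    simp only [id]; omega
  have hlim2 := tendsto_finsetSum (Finset.Icc 1 ⌊x⌋₊) fun n _ =>
    ((MeasureTheory.intervalIntegral_tendsto_integral_Ioi 0
      (integrable_weight_eulerSq hA1 hR n).integrableOn hlim).pow (m + 1)).const_mul
        ((1 + ε) ^ bigOmega n R)
  have hle := le_of_tendsto' hlim2 hfin
  have hsym : ∀ n, ∫ t : ℝ, (1 + t ^ 2)⁻¹ ^ A * eulerSq R t n =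
      2 * ∫ t in Set.Ioi (0 : ℝ), (1 + t ^ 2)⁻¹ ^ A * eulerSq R t n := by
    intro n
    rw [← integral_comp_abs (f := fun t : ℝ => (1 + t ^ 2)⁻¹ ^ A * eulerSq R t n)]
    congr 1
    ext t
    rcases abs_choice t with h | h <;> rw [h]
    rw [eulerSq_neg, neg_sq]
  simp only [hsym, mul_pow]
  calc _ = 2 ^ (m + 1) * ∑ n ∈ Finset.Icc 1 ⌊x⌋₊, (1 + ε) ^ bigOmega n R *
        (∫ t in Set.Ioi (0 : ℝ), (1 + t ^ 2)⁻¹ ^ A * eulerSq R t n) ^ (m + 1) := by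
        rw [Finset.mul_sum]
        exact Finset.sum_congr rfl fun n _ => by ring
    _ ≤ 2 ^ (m + 1) * (C * (x / Real.log R)) := by gcongr
    _ = _ := by ring

open FourierTransform in
lemma integral_norm_sq_fourier_eq {G : ℝ → ℂ} (hc : Continuous G) (hi : MeasureTheory.Integrable G)
    (hF : MeasureTheory.Integrable (𝓕 G)) :
    (MeasureTheory.Integrable fun y => ‖G y‖ ^ 2) ∧ ∫ ξ, ‖(𝓕 G) ξ‖ ^ 2 = ∫ y, ‖G y‖ ^ 2 := by
  have hinv := hc.fourierInv_fourier_eq hi hF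
  constructor
  · have hb : ∀ y, ‖G y‖ ≤ ∫ ξ, ‖(𝓕 G) ξ‖ := fun y => by
      conv_lhs => rw [← hinv]
      rw [Real.fourierInv_eq']
      refine (MeasureTheory.norm_integral_le_integral_norm _).trans (le_of_eq ?_)
      refine MeasureTheory.integral_congr_ae (Filter.Eventually.of_forall fun v => ?_)
      simp only [norm_smul, Complex.norm_exp_ofReal_mul_I, one_mul]
    refine (hi.norm.const_mul (∫ ξ, ‖(𝓕 G) ξ‖)).mono' (by fun_prop)
      (Filter.Eventually.of_forall fun y => ?_)
    rw [Real.norm_of_nonneg (by positivity), sq]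
    exact mul_le_mul_of_nonneg_right (hb y) (norm_nonneg _)
  · have h := VectorFourier.integral_sesq_fourierIntegral_eq_neg_flip (innerSL ℂ (E := ℂ))
      (L := innerₗ ℝ) (μ := MeasureTheory.volume) (ν := MeasureTheory.volume)
      Real.continuous_fourierChar continuous_inner hi hF
    have h2 : ∫ ξ, inner ℂ ((𝓕 G) ξ) ((𝓕 G) ξ) = ∫ y, inner ℂ (G y) ((𝓕⁻ (𝓕 G)) y) := by
      rw [flip_innerₗ] at h
      exact h
    rw [hinv] at h2
    simp only [inner_self_eq_norm_sq_to_K] at h2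
    have e : ∀ g : ℝ → ℂ, ∫ x, ((‖g x‖ : ℝ) : ℂ) ^ 2 = ((∫ x, ‖g x‖ ^ 2 : ℝ) : ℂ) := fun g => by
      rw [← integral_complex_ofReal]
      push_cast
      rfl
    have h3 := h2
    erw [e, e] at h3
    exact_mod_cast h3

lemma integrableOn_pow_mul_cexp (j : ℕ) {r : ℂ} (hr : 0 < r.re) :
    MeasureTheory.IntegrableOn (fun y : ℝ => (y : ℂ) ^ j * Complex.exp (-r * y)) (Set.Ioi 0) := by
  have h := integrableOn_rpow_mul_exp_neg_mul_rpow (p := 1) (s := j) (b := r.re)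
    (by have : (0 : ℝ) ≤ j := by positivity
        linarith) one_pos hr
  refine h.mono' (Continuous.aestronglyMeasurable (by fun_prop)) ?_
  refine (MeasureTheory.ae_restrict_iff' measurableSet_Ioi).mpr
    (Filter.Eventually.of_forall fun y hy => ?_)
  have hy0 : (0 : ℝ) < y := hy
  rw [norm_mul, norm_pow, Complex.norm_real, Real.norm_of_nonneg hy0.le, Complex.norm_exp]
  simp

lemma integral_pow_mul_cexp (j : ℕ) {r : ℂ} (hr : 0 < r.re) :
    ∫ y : ℝ in Set.Ioi 0, (y : ℂ) ^ j * Complex.exp (-r * y) = (j.factorial : ℂ) / r ^ (j + 1) := by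
  have hr0 : r ≠ 0 := by
    rintro rfl
    simp at hr
  induction j with
  | zero =>
    have := integral_exp_mul_complex_Ioi (a := -r) (by simpa using hr) 0
    simp only [pow_zero, one_mul]
    rw [this]
    simp
  | succ j ih =>
    have hd : ∀ y ∈ Set.Ici (0 : ℝ), HasDerivAt
        (fun y : ℝ => (y : ℂ) ^ (j + 1) * Complex.exp (-r * y))
        (((j : ℂ) + 1) * ((y : ℂ) ^ j * Complex.exp (-r * y))
          - r * ((y : ℂ) ^ (j + 1) * Complex.exp (-r * y))) y := fun y _ => by
      have h1 : HasDerivAt (fun y : ℝ => (y : ℂ)) 1 y := Complex.ofRealCLM.hasDerivAt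
      have h2 := (h1.pow (j + 1)).mul ((h1.const_mul (-r)).cexp)
      refine h2.congr_deriv ?_
      push_cast
      simp only [Pi.pow_apply]
      ring
    have i1 := integrableOn_pow_mul_cexp j hr
    have i2 := integrableOn_pow_mul_cexp (j + 1) hr
    have hlim : Filter.Tendsto (fun y : ℝ => (y : ℂ) ^ (j + 1) * Complex.exp (-r * y))
        Filter.atTop (nhds 0) := by
      rw [tendsto_zero_iff_norm_tendsto_zero]
      have h3 := (tendsto_rpow_mul_exp_neg_mul_atTop_nhds_zero ((j + 1 : ℕ) : ℝ) r.re hr)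
      refine h3.congr' ?_
      filter_upwards [Filter.eventually_gt_atTop 0] with y hy
      rw [norm_mul, norm_pow, Complex.norm_real, Real.norm_of_nonneg hy.le, Complex.norm_exp,
        Real.rpow_natCast]
      simp
    have h := MeasureTheory.integral_Ioi_of_hasDerivAt_of_tendsto' hd
      ((i1.const_mul _).sub (i2.const_mul _)) hlim
    rw [MeasureTheory.integral_sub (i1.const_mul _) (i2.const_mul _),
      MeasureTheory.integral_const_mul, MeasureTheory.integral_const_mul, ih] at h
    simp only [Complex.ofReal_zero, ne_eq, Nat.add_eq_zero_iff, one_ne_zero, and_false,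
      not_false_eq_true, zero_pow, zero_mul, sub_zero] at h
    rw [Nat.factorial_succ, pow_succ r (j + 1), eq_div_iff (by positivity)]
    set I := ∫ y : ℝ in Set.Ioi 0, (y : ℂ) ^ (j + 1) * Complex.exp (-r * y)
    have h4 : r ^ (j + 1) * (((j : ℂ) + 1) * (j.factorial / r ^ (j + 1)) - r * I) = 0 := by
      rw [h, mul_zero]
    field_simp at h4
    push_cast
    linear_combination -h4

/-- The damped truncated power `y ↦ max (y - a) 0 ^ j * e^{-y}`. -/
noncomputable def dampedRamp (j : ℕ) (a y : ℝ) : ℝ := max (y - a) 0 ^ j * Real.exp (-y)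

lemma continuous_dampedRamp (j : ℕ) (a : ℝ) : Continuous (dampedRamp j a) := by
  unfold dampedRamp
  fun_prop

lemma dampedRamp_eq_indicator {j : ℕ} (hj : 1 ≤ j) (a y : ℝ) :
    ((dampedRamp j a y : ℝ) : ℂ) = (Set.Ioi (0 : ℝ)).indicator
      (fun u : ℝ => Complex.exp (-a) * ((u : ℂ) ^ j * Complex.exp (-1 * u))) (y - a) := by
  by_cases h : 0 < y - a
  · rw [Set.indicator_of_mem (by exact h), dampedRamp, max_eq_left h.le]
    push_cast
    rw [mul_left_comm, ← Complex.exp_add]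
    congr 2
    ring
  · rw [Set.indicator_of_notMem (by exact h), dampedRamp, max_eq_right (not_lt.mp h),
      zero_pow (by omega), zero_mul, Complex.ofReal_zero]

lemma integrable_dampedRamp {j : ℕ} (hj : 1 ≤ j) (a : ℝ) :
    MeasureTheory.Integrable fun y => ((dampedRamp j a y : ℝ) : ℂ) := by
  simp_rw [dampedRamp_eq_indicator hj a]
  refine MeasureTheory.Integrable.comp_sub_right (f := (Set.Ioi (0 : ℝ)).indicator
      (fun u : ℝ => Complex.exp (-a) * ((u : ℂ) ^ j * Complex.exp (-1 * u)))) ?_ a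
  rw [MeasureTheory.integrable_indicator_iff measurableSet_Ioi]
  exact (integrableOn_pow_mul_cexp j (by simp)).const_mul _

open FourierTransform in
lemma fourier_dampedRamp {j : ℕ} (hj : 1 ≤ j) (a ξ : ℝ) :
    (𝓕 fun y => ((dampedRamp j a y : ℝ) : ℂ)) ξ =
      (j.factorial : ℂ) / (1 + (2 * Real.pi * ξ : ℝ) * Complex.I) ^ (j + 1) *
        Complex.exp (-(1 + (2 * Real.pi * ξ : ℝ) * Complex.I) * a) := by
  set z : ℂ := 1 + (2 * Real.pi * ξ : ℝ) * Complex.I with hz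
  have hzre : 0 < z.re := by simp [hz]
  rw [Real.fourier_real_eq_integral_exp_smul]
  have h : ∀ v : ℝ, Complex.exp (((-2 * Real.pi * v * ξ : ℝ) : ℂ) * Complex.I) •
      ((dampedRamp j a v : ℝ) : ℂ) = (Set.Ioi (0 : ℝ)).indicator
        (fun u : ℝ => Complex.exp (-z * a) * ((u : ℂ) ^ j * Complex.exp (-z * u))) (v - a) := by
    intro v
    rw [dampedRamp_eq_indicator hj, smul_eq_mul]
    by_cases h : 0 < v - a
    · rw [Set.indicator_of_mem (by exact h), Set.indicator_of_mem (by exact h), ← mul_assoc,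
        ← Complex.exp_add, mul_left_comm, ← Complex.exp_add, mul_left_comm, ← Complex.exp_add]
      congr 2
      rw [hz]
      push_cast
      ring
    · rw [Set.indicator_of_notMem (by exact h), Set.indicator_of_notMem (by exact h), mul_zero]
  simp_rw [h]
  rw [MeasureTheory.integral_sub_right_eq_self (fun v => (Set.Ioi (0 : ℝ)).indicator
        (fun u : ℝ => Complex.exp (-z * a) * ((u : ℂ) ^ j * Complex.exp (-z * u))) v) a,
    MeasureTheory.integral_indicator measurableSet_Ioi, MeasureTheory.integral_const_mul,
    integral_pow_mul_cexp j hzre, mul_comm]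

open FourierTransform in
lemma fourier_sum_dampedRamp {ι : Type*} (S : Finset ι) (c a : ι → ℝ) {j : ℕ} (hj : 1 ≤ j)
    (ξ : ℝ) :
    (𝓕 fun y => ∑ i ∈ S, (c i : ℂ) * ((dampedRamp j (a i) y : ℝ) : ℂ)) ξ =
      (j.factorial : ℂ) / (1 + (2 * Real.pi * ξ : ℝ) * Complex.I) ^ (j + 1) *
        ∑ i ∈ S, (c i : ℂ) * Complex.exp (-(1 + (2 * Real.pi * ξ : ℝ) * Complex.I) * a i) := by
  rw [Real.fourier_real_eq_integral_exp_smul]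
  simp_rw [Finset.smul_sum]
  have h_int : ∀ i, MeasureTheory.Integrable fun v : ℝ =>
      Complex.exp (((-2 * Real.pi * v * ξ : ℝ) : ℂ) * Complex.I) •
        ((c i : ℂ) * ((dampedRamp j (a i) v : ℝ) : ℂ)) := fun i => by
    refine ((integrable_dampedRamp hj (a i)).const_mul (c i : ℂ)).norm.mono' ?_
      (Filter.Eventually.of_forall fun v => ?_)
    · have := continuous_dampedRamp j (a i)
      exact Continuous.aestronglyMeasurable (by fun_prop)
    · rw [norm_smul, Complex.norm_exp_ofReal_mul_I, one_mul]
  rw [MeasureTheory.integral_finsetSum _ fun i _ => h_int i, Finset.mul_sum]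
  refine Finset.sum_congr rfl fun i _ => ?_
  have h := fourier_dampedRamp hj (a i) ξ
  rw [Real.fourier_real_eq_integral_exp_smul] at h
  simp_rw [smul_eq_mul] at h ⊢
  simp_rw [mul_left_comm _ (c i : ℂ)]
  rw [MeasureTheory.integral_const_mul, h]

lemma norm_sq_one_add_mul_I (t : ℝ) : ‖(1 + (t : ℂ) * Complex.I)‖ ^ 2 = 1 + t ^ 2 := by
  rw [← Complex.normSq_eq_norm_sq, Complex.normSq_apply]
  simp
  ring

lemma one_add_mul_I_ne_zero (t : ℝ) : (1 + (t : ℂ) * Complex.I) ≠ 0 := by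
  intro h
  have := norm_sq_one_add_mul_I t
  rw [h] at this
  simp at this
  nlinarith [sq_nonneg t]

open FourierTransform in
/-- Plancherel bound for sums of truncated powers. -/
lemma intervalIntegral_sq_sum_ramp_le {ι : Type*} (S : Finset ι) (c a : ι → ℝ) {j : ℕ}
    (hj : 1 ≤ j) :
    ∫ y in (0 : ℝ)..1, (∑ i ∈ S, c i * max (y - a i) 0 ^ j) ^ 2 ≤
      Real.exp 2 * ((j.factorial : ℝ) ^ 2 * (2 * Real.pi)⁻¹ *
        ∫ t : ℝ, (1 + t ^ 2)⁻¹ ^ (j + 1) *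
          ‖∑ i ∈ S, (c i : ℂ) * Complex.exp (-(1 + (t : ℂ) * Complex.I) * a i)‖ ^ 2) := by
  set G : ℝ → ℂ := fun y => ∑ i ∈ S, (c i : ℂ) * ((dampedRamp j (a i) y : ℝ) : ℂ) with hG
  have hGr : ∀ y, G y = (((∑ i ∈ S, c i * max (y - a i) 0 ^ j) * Real.exp (-y) : ℝ) : ℂ) := by
    intro y
    simp only [hG, dampedRamp]
    push_cast
    rw [Finset.sum_mul]
    exact Finset.sum_congr rfl fun i _ => by ring
  have hGc : Continuous G := by
    refine continuous_finsetSum _ fun i _ => ?_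
    have := continuous_dampedRamp j (a i)
    fun_prop
  have hGi : MeasureTheory.Integrable G :=
    MeasureTheory.integrable_finsetSum _ fun i _ => (integrable_dampedRamp hj (a i)).const_mul _
  have hFG := fourier_sum_dampedRamp S c a hj
  have hFi : MeasureTheory.Integrable (𝓕 G) := by
    have hb := (integrable_inv_one_add_sq.comp_mul_left'
      (by positivity : (2 * Real.pi) ≠ 0)).const_mul
        (j.factorial * ∑ i ∈ S, |c i| * Real.exp (-(a i)))
    refine hb.mono' ?_ (Filter.Eventually.of_forall fun ξ => ?_)
    · refine Continuous.aestronglyMeasurable ?_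
      have : 𝓕 G = fun ξ : ℝ => _ := funext hFG
      rw [this]
      refine Continuous.mul (Continuous.div continuous_const (by fun_prop) fun ξ =>
        pow_ne_zero _ (one_add_mul_I_ne_zero _)) (by fun_prop)
    · rw [hFG ξ, norm_mul, norm_div, norm_pow, Complex.norm_natCast]
      set z : ℂ := 1 + ((2 * Real.pi * ξ : ℝ) : ℂ) * Complex.I with hz
      have h1 : ‖z‖ ^ 2 = 1 + (2 * Real.pi * ξ) ^ 2 := norm_sq_one_add_mul_I _
      have h1' : 1 ≤ ‖z‖ := by
        by_contra! hlt
        nlinarith [sq_nonneg (2 * Real.pi * ξ), norm_nonneg z]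
      have h2 : 1 + (2 * Real.pi * ξ) ^ 2 ≤ ‖z‖ ^ (j + 1) :=
        h1 ▸ pow_le_pow_right₀ h1' (by omega)
      have h3 : ‖∑ i ∈ S, (c i : ℂ) * Complex.exp (-z * a i)‖ ≤
          ∑ i ∈ S, |c i| * Real.exp (-(a i)) := by
        refine (norm_sum_le _ _).trans (le_of_eq (Finset.sum_congr rfl fun i _ => ?_))
        rw [norm_mul, Complex.norm_real, Real.norm_eq_abs, Complex.norm_exp]
        simp [hz]
      calc (j.factorial : ℝ) / ‖z‖ ^ (j + 1) * ‖∑ i ∈ S, (c i : ℂ) * Complex.exp (-z * a i)‖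
          ≤ (j.factorial : ℝ) / (1 + (2 * Real.pi * ξ) ^ 2) *
            ∑ i ∈ S, |c i| * Real.exp (-(a i)) := by gcongr
        _ = _ := by ring
  obtain ⟨hGsq, hpl⟩ := integral_norm_sq_fourier_eq hGc hGi hFi
  have hnorm : ∀ ξ, ‖(𝓕 G) ξ‖ ^ 2 = (fun t : ℝ => (j.factorial : ℝ) ^ 2 *
      ((1 + t ^ 2)⁻¹ ^ (j + 1) *
        ‖∑ i ∈ S, (c i : ℂ) * Complex.exp (-(1 + (t : ℂ) * Complex.I) * a i)‖ ^ 2))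
        (2 * Real.pi * ξ) := by
    intro ξ
    rw [hFG ξ, norm_mul, norm_div, norm_pow, Complex.norm_natCast, mul_pow, div_pow, ← pow_mul,
      mul_comm (j + 1) 2, pow_mul, norm_sq_one_add_mul_I]
    simp only [inv_pow]
    ring
  have hF2 : ∫ ξ, ‖(𝓕 G) ξ‖ ^ 2 = (j.factorial : ℝ) ^ 2 * (2 * Real.pi)⁻¹ *
        ∫ t : ℝ, (1 + t ^ 2)⁻¹ ^ (j + 1) *
          ‖∑ i ∈ S, (c i : ℂ) * Complex.exp (-(1 + (t : ℂ) * Complex.I) * a i)‖ ^ 2 := by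
    simp_rw [hnorm]
    rw [MeasureTheory.Measure.integral_comp_mul_left (fun t : ℝ => (j.factorial : ℝ) ^ 2 *
      ((1 + t ^ 2)⁻¹ ^ (j + 1) *
        ‖∑ i ∈ S, (c i : ℂ) * Complex.exp (-(1 + (t : ℂ) * Complex.I) * a i)‖ ^ 2)) (2 * Real.pi),
      MeasureTheory.integral_const_mul, abs_of_pos (by positivity), smul_eq_mul]
    ring
  rw [← hF2, hpl, ← MeasureTheory.integral_const_mul, intervalIntegral.integral_of_le zero_le_one]
  refine (MeasureTheory.setIntegral_mono_on ?_ ((hGsq.const_mul _).integrableOn)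
    measurableSet_Ioc fun y hy => ?_).trans
    (MeasureTheory.setIntegral_le_integral (hGsq.const_mul _)
      (Filter.Eventually.of_forall fun y => by positivity))
  · exact (Continuous.integrableOn_Icc (by fun_prop)).mono_set Set.Ioc_subset_Icc_self
  · rw [hGr, Complex.norm_real, Real.norm_eq_abs, sq_abs, mul_pow, ← Real.exp_nat_mul,
      mul_left_comm, ← Real.exp_add]
    refine le_mul_of_one_le_right (sq_nonneg _) (Real.one_le_exp ?_)
    push_cast
    linarith [hy.2]

lemma norm_one_sub_cexp_sq (u t : ℝ) :
    ‖(1 : ℂ) - Complex.exp (-(1 + (t : ℂ) * Complex.I) * (u : ℝ))‖ ^ 2 =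
      1 - 2 * Real.exp (-u) * Real.cos (t * u) + Real.exp (-u) ^ 2 := by
  have e : (-(1 + (t : ℂ) * Complex.I) * (u : ℝ)) =
      ((-u : ℝ) : ℂ) + ((-(t * u) : ℝ) : ℂ) * Complex.I := by
    push_cast
    ring
  rw [e, ← Complex.normSq_eq_norm_sq, Complex.normSq_apply]
  simp only [Complex.sub_re, Complex.sub_im, Complex.one_re, Complex.one_im, Complex.exp_re,
    Complex.exp_im, Complex.add_re, Complex.add_im, Complex.ofReal_re, Complex.ofReal_im,
    Complex.mul_I_re, Complex.mul_I_im, zero_add, neg_zero, add_zero, Real.cos_neg, Real.sin_neg]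
  linear_combination (Real.exp (-u)) ^ 2 * Real.sin_sq_add_cos_sq (t * u)

/-- The product of the primes `p ∣ n` with `p ≤ R`. -/
noncomputable def smoothRadical (n : ℕ) (R : ℝ) : ℕ :=
  ∏ p ∈ n.primeFactors.filter (fun p : ℕ => (p : ℝ) ≤ R), p

lemma primeFactors_smoothRadical (n : ℕ) (R : ℝ) : (smoothRadical n R).primeFactors =
    n.primeFactors.filter (fun p : ℕ => (p : ℝ) ≤ R) :=
  Nat.primeFactors_prod fun _ hp => Nat.prime_of_mem_primeFactors (Finset.mem_filter.mp hp).1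

lemma squarefree_smoothRadical (n : ℕ) (R : ℝ) : Squarefree (smoothRadical n R) := by
  refine Finset.squarefree_prod_of_pairwise_isCoprime (fun p hp q hq hpq => ?_) fun p hp => ?_
  · exact Nat.coprime_iff_isRelPrime.mp ((Nat.coprime_primes
      (Nat.prime_of_mem_primeFactors (Finset.mem_filter.mp (Finset.mem_coe.mp hp)).1)
      (Nat.prime_of_mem_primeFactors (Finset.mem_filter.mp (Finset.mem_coe.mp hq)).1)).mpr
        hpq)
  · exact (Nat.prime_of_mem_primeFactors (Finset.mem_filter.mp hp).1).squarefree

lemma smoothRadical_dvd (n : ℕ) (R : ℝ) : smoothRadical n R ∣ n :=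
  (Finset.prod_dvd_prod_of_subset _ _ _ (Finset.filter_subset _ _)).trans
    (Nat.prod_primeFactors_dvd n)

lemma norm_sum_moebius_cexp_sq (R t : ℝ) (n : ℕ) :
    ‖∑ d ∈ (smoothRadical n R).divisors, (((ArithmeticFunction.moebius d : ℤ) : ℝ) : ℂ) *
      Complex.exp (-(1 + (t : ℂ) * Complex.I) * ((Real.log d / Real.log R : ℝ) : ℂ))‖ ^ 2 =
      eulerSq R t n := by
  set F : ArithmeticFunction ℂ := ⟨fun d => if d = 0 then 0 else
    Complex.exp (-(1 + (t : ℂ) * Complex.I) * ((Real.log d / Real.log R : ℝ) : ℂ)), if_pos rfl⟩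
    with hF
  have hFd : ∀ d : ℕ, d ≠ 0 → F d =
      Complex.exp (-(1 + (t : ℂ) * Complex.I) * ((Real.log d / Real.log R : ℝ) : ℂ)) :=
    fun d hd => if_neg hd
  have hFm : F.IsMultiplicative := by
    rw [ArithmeticFunction.IsMultiplicative.iff_ne_zero]
    refine ⟨by simp [hFd 1 one_ne_zero], fun {a b} ha hb _ => ?_⟩
    rw [hFd _ (mul_ne_zero ha hb), hFd a ha, hFd b hb, ← Complex.exp_add]
    congr 1
    push_cast [Real.log_mul (Nat.cast_ne_zero.mpr ha) (Nat.cast_ne_zero.mpr hb)]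
    ring
  have h := ArithmeticFunction.IsMultiplicative.prodPrimeFactors_one_sub_of_squarefree F hFm
    (squarefree_smoothRadical n R)
  have hs : ∑ d ∈ (smoothRadical n R).divisors, (((ArithmeticFunction.moebius d : ℤ) : ℝ) : ℂ) *
      Complex.exp (-(1 + (t : ℂ) * Complex.I) * ((Real.log d / Real.log R : ℝ) : ℂ)) =
      ∏ p ∈ (smoothRadical n R).primeFactors, (1 - F p) := by
    rw [h]
    refine Finset.sum_congr rfl fun d hd => ?_
    rw [hFd d (Nat.pos_of_mem_divisors hd).ne']
    push_cast
    rfl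
  rw [hs, primeFactors_smoothRadical, norm_prod, ← Finset.prod_pow, eulerSq]
  refine Finset.prod_congr rfl fun p hp => ?_
  rw [hFd p (Nat.prime_of_mem_primeFactors (Finset.mem_filter.mp hp).1).ne_zero,
    norm_one_sub_cexp_sq, eulerFactorSq, mul_div_assoc]

lemma Mf_eq_sum_divisors_smoothRadical {f : ℝ → ℝ} (hsupp : ∀ t : ℝ, 1 < t → f t = 0) {R : ℝ}
    (hR : 2 ≤ R) {n : ℕ} (hn : n ≠ 0) :
    Mf f n R = ∑ d ∈ (smoothRadical n R).divisors,
      ((ArithmeticFunction.moebius d : ℤ) : ℝ) * f (Real.log d / Real.log R) := by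
  rw [Mf]
  refine (Finset.sum_subset (Nat.divisors_subset_of_dvd hn (smoothRadical_dvd n R))
    fun d hd hdq => ?_).symm
  by_cases hsq : Squarefree d
  · have hdn := Nat.dvd_of_mem_divisors hd
    obtain ⟨p, hp, hpR⟩ : ∃ p ∈ d.primeFactors, R < (p : ℝ) := by
      by_contra! hall
      refine hdq (Nat.mem_divisors.mpr ⟨?_, (squarefree_smoothRadical n R).ne_zero⟩)
      rw [← Nat.prod_primeFactors_of_squarefree hsq]
      exact Finset.prod_dvd_prod_of_subset _ _ _ fun p hp =>
        Finset.mem_filter.mpr ⟨Nat.primeFactors_mono hdn hn hp, hall p hp⟩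
    have hpd : (p : ℝ) ≤ d := by
      exact_mod_cast Nat.le_of_dvd (Nat.pos_of_mem_divisors hd) (Nat.dvd_of_mem_primeFactors hp)
    rw [hsupp, mul_zero]
    rw [one_lt_div (Real.log_pos (by linarith))]
    exact Real.log_lt_log (by linarith) (by linarith)
  · rw [ArithmeticFunction.moebius_eq_zero_of_not_squarefree hsq]
    simp

lemma iteratedDeriv_eq_zero_at_one {A : ℕ} {f : ℝ → ℝ} (hsupp : ∀ t : ℝ, 1 < t → f t = 0)
    (hsmooth : ContDiff ℝ A f) {j : ℕ} (hj : j ≤ A) : iteratedDeriv j f 1 = 0 := by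
  have hc : Continuous (iteratedDeriv j f) :=
    hsmooth.continuous_iteratedDeriv j (by exact_mod_cast hj)
  have hz : ∀ y : ℝ, 1 < y → iteratedDeriv j f y = 0 := fun y hy => by
    have : f =ᶠ[nhds y] fun _ => (0 : ℝ) := by
      filter_upwards [lt_mem_nhds hy] with z hz using hsupp z hz
    rw [this.iteratedDeriv_eq]
    simp
  have h1 : Filter.Tendsto (iteratedDeriv j f) (nhdsWithin 1 (Set.Ioi 1))
      (nhds (iteratedDeriv j f 1)) := hc.continuousAt.tendsto.mono_left nhdsWithin_le_nhds
  refine tendsto_nhds_unique h1 (tendsto_const_nhds.congr' ?_)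
  filter_upwards [self_mem_nhdsWithin] with y hy using (hz y hy).symm

/-- Taylor's formula at `1` with integral remainder. -/
lemma eq_integral_iteratedDeriv {A : ℕ} {f : ℝ → ℝ} (hsupp : ∀ t : ℝ, 1 < t → f t = 0)
    (hsmooth : ContDiff ℝ A f) (x : ℝ) (j : ℕ) (hj : j + 1 ≤ A) :
    f x = (-1) ^ (j + 1) / (j.factorial : ℝ) *
      ∫ y in x..1, iteratedDeriv (j + 1) f y * (y - x) ^ j := by
  have hcont : ∀ i ≤ A, Continuous (iteratedDeriv i f) := fun i hi =>
    hsmooth.continuous_iteratedDeriv i (by exact_mod_cast hi)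
  have hder : ∀ i < A, ∀ y, HasDerivAt (iteratedDeriv i f) (iteratedDeriv (i + 1) f y) y :=
    fun i hi y => by
      rw [iteratedDeriv_succ]
      exact (hsmooth.differentiable_iteratedDeriv i (by exact_mod_cast hi) y).hasDerivAt
  induction j with
  | zero =>
    have h := intervalIntegral.integral_eq_sub_of_hasDerivAt (a := x) (b := 1)
      (fun y _ => hder 0 hj y) ((hcont 1 hj).intervalIntegrable _ _)
    have h1 := iteratedDeriv_eq_zero_at_one hsupp hsmooth A.zero_le
    simp only [zero_add, pow_zero, mul_one, iteratedDeriv_zero] at h h1 ⊢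
    rw [h, h1]
    simp
  | succ j ih =>
    have c1 := hcont (j + 1) (by omega)
    have c2 := hcont (j + 2) (by omega)
    have hd : ∀ y, HasDerivAt (fun y => iteratedDeriv (j + 1) f y * (y - x) ^ (j + 1))
        (iteratedDeriv (j + 2) f y * (y - x) ^ (j + 1) +
          (j + 1) * (iteratedDeriv (j + 1) f y * (y - x) ^ j)) y := fun y => by
      have h2 := (hder (j + 1) (by omega) y).mul (((hasDerivAt_id y).sub_const x).pow (j + 1))
      refine h2.congr_deriv ?_
      simp only [Pi.pow_apply, id_eq]
      push_cast
      ring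
    have i1 : IntervalIntegrable (fun y => iteratedDeriv (j + 2) f y * (y - x) ^ (j + 1))
        MeasureTheory.volume x 1 := Continuous.intervalIntegrable (by fun_prop) _ _
    have i2 : IntervalIntegrable (fun y => (j + 1 : ℝ) * (iteratedDeriv (j + 1) f y * (y - x) ^ j))
        MeasureTheory.volume x 1 := Continuous.intervalIntegrable (by fun_prop) _ _
    have h := intervalIntegral.integral_eq_sub_of_hasDerivAt (fun y _ => hd y) (i1.add i2)
    rw [intervalIntegral.integral_add i1 i2, intervalIntegral.integral_const_mul,
      iteratedDeriv_eq_zero_at_one hsupp hsmooth (by omega : j + 1 ≤ A)] at h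
    rw [ih (by omega)]
    simp only [zero_mul, sub_self, ne_eq, Nat.add_eq_zero_iff, one_ne_zero, and_false,
      not_false_eq_true, zero_pow, mul_zero] at h
    rw [Nat.factorial_succ]
    push_cast
    have hj1 : ((j : ℝ) + 1) ≠ 0 := by positivity
    have e : ∫ y in x..1, iteratedDeriv (j + 2) f y * (y - x) ^ (j + 1) =
        -((j + 1 : ℝ) * ∫ y in x..1, iteratedDeriv (j + 1) f y * (y - x) ^ j) := by linarith
    rw [show j + 1 + 1 = j + 2 from rfl, e, pow_succ (-1 : ℝ) (j + 1)]
    field_simp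

lemma eq_integral_truncated {A : ℕ} {f : ℝ → ℝ} (hsupp : ∀ t : ℝ, 1 < t → f t = 0)
    (hsmooth : ContDiff ℝ A f) {x : ℝ} (hx : 0 ≤ x) {j : ℕ} (hj1 : 1 ≤ j) (hj : j + 1 ≤ A) :
    f x = (-1) ^ (j + 1) / (j.factorial : ℝ) *
      ∫ y in (0 : ℝ)..1, iteratedDeriv (j + 1) f y * max (y - x) 0 ^ j := by
  have c : Continuous (iteratedDeriv (j + 1) f) :=
    hsmooth.continuous_iteratedDeriv (j + 1) (by exact_mod_cast hj)
  have hz : ∀ b ≤ x, 0 ≤ b →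
      ∫ y in (0 : ℝ)..b, iteratedDeriv (j + 1) f y * max (y - x) 0 ^ j = 0 := fun b hb hb0 => by
    rw [intervalIntegral.integral_congr (g := fun _ => (0 : ℝ)), intervalIntegral.integral_zero]
    intro y hy
    rw [Set.uIcc_of_le hb0] at hy
    simp only
    rw [max_eq_right (by linarith [hy.2]), zero_pow (by omega), mul_zero]
  rcases le_or_gt x 1 with h1 | h1
  · have ii : ∀ a b : ℝ, IntervalIntegrable
        (fun y => iteratedDeriv (j + 1) f y * max (y - x) 0 ^ j) MeasureTheory.volume a b :=
      fun a b => Continuous.intervalIntegrable (by fun_prop) _ _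
    rw [← intervalIntegral.integral_add_adjacent_intervals (ii 0 x) (ii x 1), hz x le_rfl hx,
      zero_add, eq_integral_iteratedDeriv hsupp hsmooth x j hj]
    congr 1
    refine intervalIntegral.integral_congr fun y hy => ?_
    rw [Set.uIcc_of_le h1] at hy
    rw [max_eq_left (by linarith [hy.1])]
  · rw [hsupp x h1, hz 1 h1.le zero_le_one, mul_zero]

lemma exists_Mf_sq_le {A : ℕ} (hA2 : 2 ≤ A) {f : ℝ → ℝ} (hsupp : ∀ t : ℝ, 1 < t → f t = 0)
    (hsmooth : ContDiff ℝ A f) {B : ℝ} (hB : ∀ x, |iteratedDeriv A f x| ≤ B) :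
    ∃ C : ℝ, 0 < C ∧ ∀ (n : ℕ) (R : ℝ), n ≠ 0 → 2 ≤ R →
      Mf f n R ^ 2 ≤ C * ∫ t : ℝ, (1 + t ^ 2)⁻¹ ^ A * eulerSq R t n := by
  obtain ⟨j, rfl⟩ : ∃ j, A = j + 1 := ⟨A - 1, by omega⟩
  have hj1 : 1 ≤ j := by omega
  set κ : ℝ := (-1) ^ (j + 1) / (j.factorial : ℝ) with hκ
  refine ⟨κ ^ 2 * (B ^ 2 * (Real.exp 2 * ((j.factorial : ℝ) ^ 2 * (2 * Real.pi)⁻¹))) + 1,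
    by positivity, fun n R hn hR => ?_⟩
  have c : Continuous (iteratedDeriv (j + 1) f) := hsmooth.continuous_iteratedDeriv (j + 1) le_rfl
  set S := (smoothRadical n R).divisors with hS
  set Φ : ℝ → ℝ := fun y => ∑ d ∈ S, ((ArithmeticFunction.moebius d : ℤ) : ℝ) *
    max (y - Real.log d / Real.log R) 0 ^ j with hΦ
  have hΦc : Continuous Φ := continuous_finsetSum _ fun d _ => by fun_prop
  have hM : Mf f n R = κ * ∫ y in (0 : ℝ)..1, iteratedDeriv (j + 1) f y * Φ y := by
    rw [Mf_eq_sum_divisors_smoothRadical hsupp hR hn]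
    simp only [hΦ, Finset.mul_sum]
    rw [intervalIntegral.integral_finsetSum
      fun d _ => Continuous.intervalIntegrable (by fun_prop) _ _, Finset.mul_sum]
    refine Finset.sum_congr rfl fun d hd => ?_
    have hd0 : 0 ≤ Real.log d / Real.log R :=
      div_nonneg (Real.log_natCast_nonneg d) (Real.log_nonneg (by linarith))
    rw [eq_integral_truncated hsupp hsmooth hd0 hj1 le_rfl, mul_left_comm]
    congr 1
    rw [← intervalIntegral.integral_const_mul]
    exact intervalIntegral.integral_congr fun y _ => by ring
  have hI0 : 0 ≤ ∫ t : ℝ, (1 + t ^ 2)⁻¹ ^ (j + 1) * eulerSq R t n :=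
    MeasureTheory.integral_nonneg fun t => mul_nonneg (by positivity) (eulerSq_nonneg _ _ _)
  have hpl := intervalIntegral_sq_sum_ramp_le S
    (fun d => ((ArithmeticFunction.moebius d : ℤ) : ℝ)) (fun d => Real.log d / Real.log R) hj1
  simp_rw [hS, norm_sum_moebius_cexp_sq] at hpl
  have h1 : (∫ y in (0 : ℝ)..1, iteratedDeriv (j + 1) f y * Φ y) ^ 2 ≤
      B ^ 2 * ∫ y in (0 : ℝ)..1, Φ y ^ 2 := by
    have ha := intervalIntegral.abs_integral_le_integral_abs
      (f := fun y => iteratedDeriv (j + 1) f y * Φ y) (μ := MeasureTheory.volume)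
      (zero_le_one (α := ℝ))
    calc (∫ y in (0 : ℝ)..1, iteratedDeriv (j + 1) f y * Φ y) ^ 2
        = |∫ y in (0 : ℝ)..1, iteratedDeriv (j + 1) f y * Φ y| ^ 2 := (sq_abs _).symm
      _ ≤ (∫ y in (0 : ℝ)..1, |iteratedDeriv (j + 1) f y * Φ y|) ^ 2 := by gcongr
      _ ≤ ∫ y in (0 : ℝ)..1, |iteratedDeriv (j + 1) f y * Φ y| ^ 2 :=
          intervalIntegral_pow_le (by fun_prop) (fun _ => abs_nonneg _) 2
      _ ≤ ∫ y in (0 : ℝ)..1, B ^ 2 * Φ y ^ 2 := by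
          refine intervalIntegral.integral_mono_on zero_le_one
            (Continuous.intervalIntegrable (by fun_prop) _ _)
            (Continuous.intervalIntegrable (by fun_prop) _ _) fun y _ => ?_
          rw [abs_mul, mul_pow, sq_abs (Φ y)]
          gcongr
          exact hB y
      _ = _ := intervalIntegral.integral_const_mul _ _
  rw [hM, mul_pow]
  calc κ ^ 2 * (∫ y in (0 : ℝ)..1, iteratedDeriv (j + 1) f y * Φ y) ^ 2
      ≤ κ ^ 2 * (B ^ 2 * (Real.exp 2 * ((j.factorial : ℝ) ^ 2 * (2 * Real.pi)⁻¹ *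
        ∫ t : ℝ, (1 + t ^ 2)⁻¹ ^ (j + 1) * eulerSq R t n))) := by
        gcongr
        exact h1.trans (by gcongr)
    _ = κ ^ 2 * (B ^ 2 * (Real.exp 2 * ((j.factorial : ℝ) ^ 2 * (2 * Real.pi)⁻¹))) *
        ∫ t : ℝ, (1 + t ^ 2)⁻¹ ^ (j + 1) * eulerSq R t n := by ring
    _ ≤ _ := mul_le_mul_of_nonneg_right (by linarith) hI0

lemma one_le_inv_mul_pow {ε T : ℝ} (hε : 0 < ε) (hT : 0 < T) {N : ℕ} (hN : T ≤ N) :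
    1 ≤ (ε * T)⁻¹ * (1 + ε) ^ N := by
  have h := one_add_mul_le_pow (by linarith : (-2 : ℝ) ≤ ε) N
  rw [inv_mul_eq_div, one_le_div (by positivity)]
  nlinarith

lemma choose_add_two_le {m A : ℕ} (hA : (2 * (m + 1)).choose (m + 1) < 2 * (m + 1) * A) :
    (2 * (m + 1)).choose (m + 1) + 2 ≤ 2 * (m + 1) * A := by
  obtain ⟨c, hc⟩ : 2 ∣ (2 * (m + 1)).choose (m + 1) := Nat.two_dvd_centralBinom_succ m
  rw [mul_assoc] at hA ⊢
  omega

/-- Let `k ≥ 1` and `A ≥ 2` with `A > binom(2k,k)/(2k)`, and let `f` be supported on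
`(−∞,1]`, of class `C^A` with `f, f′, …, f^{(A)}` uniformly bounded. Then there is
`C(k,f) > 0` such that for all `x ≥ R ≥ 2` and every real `T ≥ 1`,
`Σ_{n ≤ x, Ω(n;R) ≥ T} M_f(n;R)^{2k} ≤ C(k,f)·x/(T·log R)`. -/
theorem moment_smooth_many_prime_factors_bound (k A : ℕ) (hk : 1 ≤ k) (hA2 : 2 ≤ A)
    (hA : Nat.choose (2 * k) k < 2 * k * A)
    (f : ℝ → ℝ) (hsupp : ∀ t : ℝ, 1 < t → f t = 0)
    (hsmooth : ContDiff ℝ A f)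
    (hbdd : ∀ i ≤ A, ∃ B : ℝ, ∀ x : ℝ, |iteratedDeriv i f x| ≤ B) :
    ∃ C : ℝ, 0 < C ∧ ∀ x R T : ℝ, 2 ≤ R → R ≤ x → 1 ≤ T →
      ∑ n ∈ (Finset.Icc 1 ⌊x⌋₊).filter (fun n : ℕ => T ≤ (bigOmega n R : ℝ)),
        Mf f n R ^ (2 * k) ≤ C * x / (T * Real.log R) := by
  obtain ⟨m, rfl⟩ : ∃ m, k = m + 1 := ⟨k - 1, by omega⟩
  obtain ⟨B, hB⟩ := hbdd A le_rfl
  obtain ⟨C₁, hC₁, hM⟩ := exists_Mf_sq_le hA2 hsupp hsmooth hB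
  obtain ⟨ε, C₂, hε, hC₂, hmom⟩ :=
    exists_integral_moment_le (by omega : 1 ≤ A) (choose_add_two_le hA)
  refine ⟨ε⁻¹ * C₁ ^ (m + 1) * C₂, by positivity, fun x R T hR hRx hT => ?_⟩
  have hT0 : 0 < T := by linarith
  have hI0 : ∀ n, 0 ≤ ∫ t : ℝ, (1 + t ^ 2)⁻¹ ^ A * eulerSq R t n := fun n =>
    MeasureTheory.integral_nonneg fun t => mul_nonneg (by positivity) (eulerSq_nonneg _ _ _)
  calc ∑ n ∈ (Finset.Icc 1 ⌊x⌋₊).filter (fun n : ℕ => T ≤ (bigOmega n R : ℝ)),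
        Mf f n R ^ (2 * (m + 1))
      ≤ ∑ n ∈ (Finset.Icc 1 ⌊x⌋₊).filter (fun n : ℕ => T ≤ (bigOmega n R : ℝ)),
        ((ε * T)⁻¹ * C₁ ^ (m + 1)) * ((1 + ε) ^ bigOmega n R *
          (∫ t : ℝ, (1 + t ^ 2)⁻¹ ^ A * eulerSq R t n) ^ (m + 1)) := by
        refine Finset.sum_le_sum fun n hn => ?_
        rw [Finset.mem_filter, Finset.mem_Icc] at hn
        have h1 := one_le_inv_mul_pow hε hT0 hn.2
        have h2 := hM n R (by omega) hR
        calc Mf f n R ^ (2 * (m + 1)) = (Mf f n R ^ 2) ^ (m + 1) := pow_mul _ _ _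
          _ ≤ (C₁ * ∫ t : ℝ, (1 + t ^ 2)⁻¹ ^ A * eulerSq R t n) ^ (m + 1) := by gcongr
          _ ≤ ((ε * T)⁻¹ * (1 + ε) ^ bigOmega n R) *
              (C₁ * ∫ t : ℝ, (1 + t ^ 2)⁻¹ ^ A * eulerSq R t n) ^ (m + 1) :=
            le_mul_of_one_le_left (pow_nonneg (mul_nonneg hC₁.le (hI0 n)) _) h1
          _ = _ := by
            rw [mul_pow]
            ring
    _ ≤ ∑ n ∈ Finset.Icc 1 ⌊x⌋₊, ((ε * T)⁻¹ * C₁ ^ (m + 1)) * ((1 + ε) ^ bigOmega n R *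
          (∫ t : ℝ, (1 + t ^ 2)⁻¹ ^ A * eulerSq R t n) ^ (m + 1)) := by
        refine Finset.sum_le_sum_of_subset_of_nonneg (Finset.filter_subset _ _) fun n _ _ => ?_
        have := hI0 n
        positivity
    _ ≤ ((ε * T)⁻¹ * C₁ ^ (m + 1)) * (C₂ * (x / Real.log R)) := by
        rw [← Finset.mul_sum]
        exact mul_le_mul_of_nonneg_left (hmom x R hR hRx) (by positivity)
    _ = ε⁻¹ * C₁ ^ (m + 1) * C₂ * x / (T * Real.log R) := by
        rw [mul_inv]
        ring
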